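/- Assume the Riemann Hypothesis and fix ε > 0. There exist constants c(ε), C(ε) > 0 and x₀(ε) such that for all x ≥ x₀ and all y with (1+ε) log x ≤ y ≤ (log x)^{2−ε}: Ψ(x,y)/( x ρ(u) Z(σ) ) = G(σ,y)·exp(−E₁) and Ψ(x,y)/( x ρ(u) Z(σ) ) = G(α,y)·exp(E₂), where c(ε)·(log x)³/(y² log y) ≤ E₁, E₂ ≤ C(ε)·(log x)³/(y² log y). -/

import Mathlib

open Real Filter

/-- `Psi x y` is the number of `y`-friable integers up to `x`. -/
noncomputable def Psi (x y : ℝ) : ℕ :=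
  Set.ncard {n : ℕ | 1 ≤ n ∧ (n : ℝ) ≤ x ∧ ∀ p : ℕ, p.Prime → p ∣ n → (p : ℝ) ≤ y}

/-- The partial zeta function `ζ(s,y)` for real `s`. -/
noncomputable def zetaP (s y : ℝ) : ℝ :=
  ∏ p ∈ Nat.primesBelow (⌊y⌋₊ + 1), (1 - (p : ℝ) ^ (-s))⁻¹

/-- `Z(t) = ζ(t)(t-1)/t` for `t ∈ (0,1)`, with `Z(1) = 1`. -/
noncomputable def Zfun (t : ℝ) : ℝ :=
  if t = 1 then 1 else (riemannZeta (t : ℂ)).re * (t - 1) / t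

/-- Laplace transform `ρ̂(s) = ∫₀^∞ e^{-sv} ρ(v) dv` of a function `ρ`. -/
noncomputable def rhoHat (ρ : ℝ → ℝ) (s : ℝ) : ℝ :=
  ∫ v in Set.Ioi (0 : ℝ), Real.exp (-s * v) * ρ v

/-- `F(s,y) = ζ(s)(s-1)(log y) ρ̂((s-1) log y)` for real `s`. -/
noncomputable def Ffun (ρ : ℝ → ℝ) (s y : ℝ) : ℝ :=
  (riemannZeta (s : ℂ)).re * (s - 1) * Real.log y * rhoHat ρ ((s - 1) * Real.log y)

/-- `G(s,y) = ζ(s,y)/F(s,y)`. -/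
noncomputable def Gfun (ρ : ℝ → ℝ) (s y : ℝ) : ℝ := zetaP s y / Ffun ρ s y

section
open Real Filter Topology MeasureTheory Set

lemma st9_floor_sum (t : ℝ) : (∑ k ∈ Finset.Icc 1 ⌊t⌋₊, (1:ℕ → ℂ) k) = (⌊t⌋₊ : ℂ) := by
  simp

/-- the fractional part cut to (1,∞) -/
noncomputable def st9_fr (t : ℝ) : ℂ := (Ioi (1:ℝ)).indicator (fun t => ((Int.fract t : ℝ) : ℂ)) t

lemma st9_fr_meas : Measurable st9_fr := by
  unfold st9_fr
  exact (Complex.measurable_ofReal.comp measurable_fract).indicator measurableSet_Ioi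

lemma st9_fr_bound (t : ℝ) : ‖st9_fr t‖ ≤ 1 := by
  unfold st9_fr indicator
  split_ifs
  · rw [Complex.norm_real, Real.norm_eq_abs, abs_of_nonneg (Int.fract_nonneg t)]
    exact (Int.fract_lt_one t).le
  · simp

lemma st9_fr_locint : LocallyIntegrableOn st9_fr (Ioi 0) := by
  apply LocallyIntegrable.locallyIntegrableOn
  intro x
  refine ⟨Icc (x-1) (x+1), Icc_mem_nhds (by linarith) (by linarith), ?_⟩
  refine IntegrableOn.of_bound ?_ st9_fr_meas.aestronglyMeasurable 1 ?_
  · simp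
  · exact ae_of_all _ st9_fr_bound

lemma st9_mellin_diff {s : ℂ} (hs : s.re < 0) : DifferentiableAt ℂ (mellin st9_fr) s := by
  refine mellin_differentiableAt_of_isBigO_rpow (a := 0) (b := s.re - 1) st9_fr_locint ?_ hs ?_ (by linarith)
  · refine Asymptotics.IsBigO.of_bound 1 (Eventually.of_forall fun t => ?_)
    simpa using st9_fr_bound t
  · refine Asymptotics.IsBigO.of_bound 1 ?_
    have : ∀ᶠ t in 𝓝[>] (0:ℝ), t < 1 := nhdsWithin_le_nhds (gt_mem_nhds one_pos)
    filter_upwards [this] with t ht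
    have : st9_fr t = 0 := by
      unfold st9_fr
      rw [indicator_of_notMem]
      simp [ht.le]
    rw [this]; simp

lemma st9_mellin_eq (s : ℂ) : mellin st9_fr s = ∫ t in Ioi (1:ℝ), (t:ℂ)^(s-1) * ((Int.fract t : ℝ) : ℂ) := by
  unfold mellin
  have : ∀ t : ℝ, (t:ℂ)^(s-1) • st9_fr t = (Ioi (1:ℝ)).indicator (fun t : ℝ => (t:ℂ)^(s-1) * ((Int.fract t : ℝ) : ℂ)) t := by
    intro t
    unfold st9_fr
    by_cases h : t ∈ Ioi (1:ℝ) <;> simp [h, indicator]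
  simp_rw [this]
  rw [setIntegral_indicator measurableSet_Ioi]
  congr 2
  ext t; simp only [mem_inter_iff, mem_Ioi]; constructor
  · exact fun h => h.2
  · exact fun h => ⟨by linarith, h⟩

lemma st9_cpow_int {s : ℂ} (hs : 0 < s.re) : IntegrableOn (fun t : ℝ => (t:ℂ)^(-s-1) * ((Int.fract t : ℝ) : ℂ)) (Ioi 1) := by
  have h1 : IntegrableOn (fun t : ℝ => (t:ℂ)^(-s-1)) (Ioi 1) :=
    integrableOn_Ioi_cpow_of_lt (by simp; linarith) one_pos
  refine Integrable.mono h1 ?_ ?_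
  · exact h1.aestronglyMeasurable.mul (Complex.measurable_ofReal.comp measurable_fract).aestronglyMeasurable
  · refine ae_of_all _ fun t => ?_
    rw [norm_mul]
    refine mul_le_of_le_one_right (norm_nonneg _) ?_
    rw [Complex.norm_real, Real.norm_eq_abs, abs_of_nonneg (Int.fract_nonneg t)]
    exact (Int.fract_lt_one t).le

lemma st9_mellin_bound {s : ℂ} (hs : 0 < s.re) : ‖mellin st9_fr (-s)‖ ≤ 1 / s.re := by
  rw [st9_mellin_eq]
  have h2 : ∫ t in Ioi (1:ℝ), t^(-s.re-1) = 1 / s.re := by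
    rw [integral_Ioi_rpow_of_lt (by linarith) one_pos]
    simp
  rw [← h2]
  refine norm_integral_le_of_norm_le (integrableOn_Ioi_rpow_of_lt (by linarith) one_pos) ?_
  refine (ae_restrict_iff' measurableSet_Ioi).2 (ae_of_all _ fun t ht => ?_)
  have ht0 : (0:ℝ) < t := lt_trans one_pos ht
  rw [norm_mul, Complex.norm_cpow_eq_rpow_re_of_pos ht0]
  simp only [Complex.sub_re, Complex.neg_re, Complex.one_re]
  refine mul_le_of_le_one_right (by positivity) ?_
  rw [Complex.norm_real, Real.norm_eq_abs, abs_of_nonneg (Int.fract_nonneg t)]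
  exact (Int.fract_lt_one t).le

lemma st9_zeta1_aux {s : ℂ} (hs : 1 < s.re) :
    riemannZeta₁ s = s - s * (s-1) * mellin st9_fr (-s) := by
  have hs1 : s ≠ 1 := by rintro rfl; simp at hs
  have hs1' : s - 1 ≠ 0 := sub_ne_zero.2 hs1
  have h1 : riemannZeta s = s * ∫ t in Ioi (1:ℝ), (∑ k ∈ Finset.Icc 1 ⌊t⌋₊, (1:ℕ → ℂ) k) * (t:ℂ)^(-(s+1)) := by
    rw [← LSeries_one_eq_riemannZeta hs]
    refine LSeries_eq_mul_integral' 1 (r := 1) zero_le_one hs ?_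
    refine Asymptotics.IsBigO.of_bound 1 (Eventually.of_forall fun n => ?_)
    simp
  have h3 : ∀ t ∈ Ioi (1:ℝ), (∑ k ∈ Finset.Icc 1 ⌊t⌋₊, (1:ℕ → ℂ) k) * (t:ℂ)^(-(s+1)) =
      (t:ℂ)^(-s) - (t:ℂ)^(-s-1) * ((Int.fract t : ℝ) : ℂ) := by
    intro t ht
    have ht0 : (0:ℝ) < t := lt_trans one_pos ht
    rw [st9_floor_sum]
    have : ((⌊t⌋₊ : ℝ)) = t - Int.fract t := by
      rw [natCast_floor_eq_intCast_floor ht0.le]; unfold Int.fract; ring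
    have h : ((⌊t⌋₊ : ℂ)) = ((t - Int.fract t : ℝ) : ℂ) := by rw [← this]; simp
    rw [h]
    have h4 : (t:ℂ)^(-s) = t * (t:ℂ)^(-s-1) := by
      rw [Complex.cpow_sub _ _ (by exact_mod_cast ht0.ne')]
      have : (t:ℂ) ≠ 0 := by exact_mod_cast ht0.ne'
      simp; field_simp
    rw [h4, show -(s+1) = -s-1 by ring]
    push_cast; ring
  rw [setIntegral_congr_fun measurableSet_Ioi h3, integral_sub, integral_Ioi_cpow_of_lt (by simp; linarith) one_pos] at h1
  · rw [st9_mellin_eq]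
    have h5 : riemannZeta₁ s = (s-1) * riemannZeta s := by
      rw [riemannZeta_eq_inv_sub_mul hs1]; field_simp
    rw [h5, h1]
    have : -s + 1 ≠ 0 := by intro h; apply hs1'; linear_combination -h
    simp
    field_simp
    ring
  · exact integrableOn_Ioi_cpow_of_lt (by simp; linarith) one_pos
  · exact st9_cpow_int (by linarith)

lemma st9_zeta1_eq {s : ℂ} (hs : 0 < s.re) :
    riemannZeta₁ s = s - s * (s-1) * mellin st9_fr (-s) := by
  have hU : IsOpen {z : ℂ | 0 < z.re} := isOpen_lt continuous_const Complex.continuous_re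
  have hd : DifferentiableOn ℂ (fun s => s - s * (s-1) * mellin st9_fr (-s)) {z : ℂ | 0 < z.re} := by
    intro z hz
    have := (st9_mellin_diff (s := -z) (by simpa using hz)).comp z (differentiableAt_id.neg)
    refine DifferentiableAt.differentiableWithinAt ?_
    refine differentiableAt_id.sub ((differentiableAt_id.mul (differentiableAt_id.sub_const 1)).mul this)
  have hc : IsPreconnected {z : ℂ | 0 < z.re} := (convex_halfSpace_re_gt 0).isPreconnected
  have := (differentiable_riemannZeta₁.differentiableOn.analyticOnNhd hU).eqOn_of_preconnected_of_eventuallyEq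
    (hd.analyticOnNhd hU) hc (z₀ := 2) (by simp) ?_
  · exact this hs
  · have : {z : ℂ | 1 < z.re} ∈ 𝓝 (2:ℂ) := (isOpen_lt continuous_const Complex.continuous_re).mem_nhds (by simp)
    filter_upwards [this] with z hz using st9_zeta1_aux hz

lemma st9_zeta1_bound {s : ℂ} (hs : 1/2 ≤ s.re) : ‖riemannZeta₁ s‖ ≤ ‖s‖ * (1 + 2 * ‖s-1‖) := by
  rw [st9_zeta1_eq (by linarith)]
  have h := st9_mellin_bound (s := s) (by linarith)
  have h2 : 1 / s.re ≤ 2 := by rw [div_le_iff₀ (by linarith)]; linarith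
  calc ‖s - s * (s-1) * mellin st9_fr (-s)‖ ≤ ‖s‖ + ‖s * (s-1) * mellin st9_fr (-s)‖ := norm_sub_le _ _
    _ = ‖s‖ + ‖s‖ * ‖s-1‖ * ‖mellin st9_fr (-s)‖ := by rw [norm_mul, norm_mul]
    _ ≤ ‖s‖ + ‖s‖ * ‖s-1‖ * 2 := by gcongr; linarith
    _ = _ := by ring

lemma st9_zeta1_pos {s : ℝ} (hs : 0 ≤ s) (hs1 : s < 1) : 0 < (riemannZeta₁ (s:ℂ)).re := by
  rcases hs.eq_or_lt with rfl | hs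
  · have : riemannZeta (0:ℂ) = ((0:ℂ) - 1)⁻¹ * riemannZeta₁ 0 := riemannZeta_eq_inv_sub_mul (by norm_num)
    rw [riemannZeta_zero] at this
    have h : riemannZeta₁ 0 = 1/2 := by
      field_simp at this; linear_combination (-1/2) * this
    simp [h]
  · rw [st9_zeta1_eq (by simpa using hs), st9_mellin_eq]
    have : ∫ t in Ioi (1:ℝ), (t:ℂ)^(-(s:ℂ)-1) * ((Int.fract t : ℝ) : ℂ) = ((∫ t in Ioi (1:ℝ), t^(-s-1) * Int.fract t : ℝ) : ℂ) := by
      rw [← integral_complex_ofReal]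
      refine setIntegral_congr_fun measurableSet_Ioi fun t ht => ?_
      have ht0 : (0:ℝ) < t := lt_trans one_pos ht
      push_cast
      rw [Complex.ofReal_cpow ht0.le]; push_cast; rfl
    rw [this]
    have h0 : 0 ≤ ∫ t in Ioi (1:ℝ), t^(-s-1) * Int.fract t := by
      refine setIntegral_nonneg measurableSet_Ioi fun t ht => ?_
      have ht0 : (0:ℝ) < t := lt_trans one_pos ht
      have := Int.fract_nonneg t
      positivity
    rw [← Complex.ofReal_one, ← Complex.ofReal_sub, ← Complex.ofReal_mul, ← Complex.ofReal_mul, ← Complex.ofReal_sub, Complex.ofReal_re]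
    nlinarith [mul_nonneg (mul_nonneg hs.le (sub_nonneg.2 hs1.le)) h0]
end

section
open Real Filter Topology MeasureTheory Set

lemma st9_zeta1_ne (hRH : RiemannHypothesis) {s : ℂ} (hs : 1/2 < s.re) : riemannZeta₁ s ≠ 0 := by
  intro h
  by_cases h1 : s = 1
  · subst h1; simp at h
  have hz : riemannZeta s = 0 := by rw [riemannZeta_eq_inv_sub_mul h1, h, mul_zero]
  have := hRH s hz ?_ h1
  · linarith
  · rintro ⟨n, rfl⟩
    have : ((-2 * ((n:ℂ) + 1)).re) = -2 * ((n:ℝ)+1) := by simp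
    rw [this] at hs
    have : (0:ℝ) ≤ n := n.cast_nonneg
    linarith

lemma st9_zeta_two_lower (t : ℝ) : 1/3 ≤ ‖riemannZeta (2 + t * Complex.I)‖ := by
  set s : ℂ := 2 + t * Complex.I with hs
  have hre : s.re = 2 := by simp [hs]
  have h1 : riemannZeta s = ∑' n : ℕ, 1 / ((n:ℂ) + 1) ^ s := zeta_eq_tsum_one_div_nat_add_one_cpow (by rw [hre]; norm_num)
  have h2 : HasSum (fun n : ℕ => 1 / ((n:ℝ) + 1)^2) (π^2/6) := by
    have := hasSum_zeta_two
    rw [← hasSum_nat_add_iff' 1] at this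
    simpa using this
  have hn : ∀ n : ℕ, ‖1 / ((n:ℂ) + 1) ^ s‖ = 1 / ((n:ℝ) + 1)^2 := by
    intro n
    rw [norm_div, norm_one]
    have : ((n:ℂ) + 1) = (((n:ℝ) + 1 : ℝ) : ℂ) := by push_cast; rfl
    rw [this, Complex.norm_cpow_eq_rpow_re_of_pos (by positivity), hre]
    norm_num
  have hsum : Summable (fun n : ℕ => 1 / ((n:ℂ) + 1) ^ s) := by
    apply Summable.of_norm
    simp_rw [hn]; exact h2.summable
  rw [hsum.tsum_eq_zero_add] at h1
  have h3 : HasSum (fun n : ℕ => 1 / (((n+1:ℕ):ℝ) + 1)^2) (π^2/6 - 1) := by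
    have := (hasSum_nat_add_iff' 1).2 h2
    simpa using this
  have h4 : ‖∑' n : ℕ, 1 / (((n+1 : ℕ):ℂ) + 1) ^ s‖ ≤ π^2/6 - 1 := by
    refine tsum_of_norm_bounded h3 fun n => ?_
    rw [hn]
  have hpi : π^2 < 10 := by
    have := Real.pi_lt_d2; have := Real.pi_pos; nlinarith
  have h5 : riemannZeta s = 1 + ∑' n : ℕ, 1 / (((n+1 : ℕ):ℂ) + 1) ^ s := by
    rw [h1]; simp
  rw [h5]
  have := norm_sub_le (1 + ∑' n : ℕ, 1 / (((n+1 : ℕ):ℂ) + 1) ^ s) (∑' n : ℕ, 1 / (((n+1 : ℕ):ℂ) + 1) ^ s)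
  rw [add_sub_cancel_right, norm_one] at this
  linarith

lemma st9_zeta1_two_lower (t : ℝ) : 1/3 ≤ ‖riemannZeta₁ (2 + t * Complex.I)‖ := by
  have h1 : (2 + t * Complex.I : ℂ) ≠ 1 := by
    intro h; have := congrArg Complex.re h; simp at this
  have h2 := st9_zeta_two_lower t
  rw [riemannZeta_eq_inv_sub_mul h1, norm_mul, norm_inv] at h2
  have h3 : 1 ≤ ‖(2 + t * Complex.I : ℂ) - 1‖ := by
    have := Complex.abs_re_le_norm ((2 + t * Complex.I : ℂ) - 1)
    simp at this
    norm_num at this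
    simpa using this
  have h4 : ‖(2 + t * Complex.I : ℂ) - 1‖⁻¹ ≤ 1 := inv_le_one_of_one_le₀ h3
  nlinarith [norm_nonneg (riemannZeta₁ (2 + t * Complex.I))]

noncomputable def st9_LD (s : ℂ) : ℂ := deriv riemannZeta₁ s / riemannZeta₁ s

lemma st9_LD_diff (hRH : RiemannHypothesis) {s : ℂ} (hs : 1/2 < s.re) : DifferentiableAt ℂ st9_LD s := by
  have := (differentiable_riemannZeta₁.contDiff (n := 2)).differentiable_deriv_two s
  exact this.div (differentiable_riemannZeta₁ s) (st9_zeta1_ne hRH hs)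

lemma st9_LD_bound (hRH : RiemannHypothesis) {δ : ℝ} (hδ : 0 < δ) :
    ∃ C : ℝ, 0 < C ∧ ∀ s : ℂ, 1/2 + δ ≤ s.re → s.re ≤ 2 → ‖st9_LD s‖ ≤ C * Real.log (|s.im| + 3) := by
  refine ⟨60/δ^2, by positivity, fun s hs hs2 => ?_⟩
  set t := s.im with ht
  set c : ℂ := 2 + t * Complex.I with hc
  have hδ2 : δ ≤ 3/2 := by linarith
  have hball : ∀ z ∈ Metric.ball c (3/2), 1/2 < z.re := by
    intro z hz
    rw [Metric.mem_ball, dist_eq_norm] at hz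
    have := (abs_le.1 (Complex.abs_re_le_norm (z - c))).1
    simp [hc] at this
    linarith
  have hd : DifferentiableOn ℂ st9_LD (Metric.ball c (3/2)) := fun z hz =>
    (st9_LD_diff hRH (hball z hz)).differentiableWithinAt
  have hcb : c ∈ Metric.ball c (3/2) := Metric.mem_ball_self (by norm_num)
  obtain ⟨g, hg0, hg⟩ := (hd.isExactOn_ball).with_val_at c 0
  -- exp g = N / N c
  have hexp : ∀ z ∈ Metric.ball c (3/2), riemannZeta₁ z * Complex.exp (- g z) = riemannZeta₁ c := by
    have hder : ∀ z ∈ Metric.ball c (3/2), HasDerivAt (fun z => riemannZeta₁ z * Complex.exp (- g z)) 0 z := by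
      intro z hz
      have h1 := (differentiable_riemannZeta₁ z).hasDerivAt
      have h2 := (hg z hz).neg.cexp
      refine (h1.mul h2).congr_deriv ?_
      have := st9_zeta1_ne hRH (hball z hz)
      unfold st9_LD
      field_simp
      ring
    intro z hz
    have hconv : Convex ℝ (Metric.ball c (3/2)) := convex_ball _ _
    have := hconv.is_const_of_fderivWithin_eq_zero (𝕜 := ℂ) (f := fun z => riemannZeta₁ z * Complex.exp (- g z))
      (fun z hz => (hder z hz).differentiableAt.differentiableWithinAt) (fun z hz => by
        rw [fderivWithin_of_isOpen Metric.isOpen_ball hz]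
        have := (hder z hz).hasFDerivAt.fderiv
        rw [this]; ext; simp) hz hcb
    rw [this, hg0]; simp
  set M := 5 * Real.log (|t| + 3) with hM
  have hlog3 : 0 < Real.log 3 := Real.log_pos (by norm_num)
  have hlog : Real.log 3 ≤ Real.log (|t| + 3) := Real.log_le_log (by norm_num) (by linarith [abs_nonneg t])
  have hM0 : 0 < M := by rw [hM]; linarith
  have hNc := st9_zeta1_two_lower t
  have hre : ∀ z ∈ Metric.ball c (3/2), (g z).re ≤ M := by
    intro z hz
    have h1 := congrArg norm (hexp z hz)
    rw [norm_mul, Complex.norm_exp, Complex.neg_re] at h1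
    have h2 := st9_zeta1_bound (hball z hz).le
    have hzc : ‖z - c‖ < 3/2 := by rw [← dist_eq_norm]; exact hz
    have hcn : ‖c‖ ≤ 2 + |t| := by
      rw [hc]; refine (norm_add_le _ _).trans ?_
      simp
    have hz1 : ‖z‖ ≤ |t| + 7/2 := by
      have := norm_add_le (z - c) c; rw [sub_add_cancel] at this; linarith
    have hz2 : ‖z - 1‖ ≤ |t| + 5/2 := by
      have h3 : ‖c - 1‖ ≤ 1 + |t| := by
        rw [hc, show (2 + t * Complex.I - 1 : ℂ) = 1 + t * Complex.I by ring]
        refine (norm_add_le _ _).trans ?_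
        simp
      have := norm_add_le (z - c) (c - 1); rw [sub_add_sub_cancel] at this; linarith
    have hb : ‖riemannZeta₁ z‖ ≤ 4 * (|t| + 3)^2 := by
      have := abs_nonneg t
      calc _ ≤ ‖z‖ * (1 + 2 * ‖z-1‖) := h2
        _ ≤ (|t| + 7/2) * (1 + 2 * (|t| + 5/2)) := by gcongr
        _ ≤ _ := by nlinarith
    have he : Real.exp ((g z).re) ≤ 12 * (|t|+3)^2 := by
      have h3 : ‖riemannZeta₁ z‖ = ‖riemannZeta₁ c‖ * Real.exp ((g z).re) := by
        rw [← h1, mul_assoc, ← Real.exp_add]; simp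
      have : (1/3) * Real.exp ((g z).re) ≤ ‖riemannZeta₁ c‖ * Real.exp ((g z).re) :=
        mul_le_mul_of_nonneg_right hNc (Real.exp_pos _).le
      linarith
    have h12 : Real.log 12 ≤ 3 * Real.log 3 := by
      rw [← Real.log_rpow (by norm_num)]
      exact Real.log_le_log (by norm_num) (by norm_num)
    have h4 := Real.log_le_log (Real.exp_pos _) he
    rw [Real.log_exp, Real.log_mul (by norm_num) (by positivity), Real.log_pow] at h4
    push_cast at h4
    rw [hM]; linarith
  -- Borel-Caratheodory
  have hbc : ∀ z, ‖z - c‖ ≤ 3/2 - δ/2 → ‖g z‖ ≤ 6 * M / δ := by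
    intro z hz
    have hzb : z - c ∈ Metric.ball (0:ℂ) (3/2) := by
      rw [mem_ball_zero_iff]; linarith
    have hsh : ∀ w ∈ Metric.ball (0:ℂ) (3/2), w + c ∈ Metric.ball c (3/2) := by
      intro w hw; rw [Metric.mem_ball, dist_eq_norm, add_sub_cancel_right]; simpa using hw
    have := Complex.borelCaratheodory_zero (f := fun w => g (w + c)) (R := 3/2) hM0 (fun w hw => ?_)
      (fun w hw => hre _ (hsh w hw)) (by norm_num) hzb (by simpa using hg0)
    · simp only [sub_add_cancel] at this
      refine this.trans ?_
      have h5 : δ/2 ≤ 3/2 - ‖z - c‖ := by linarith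
      calc 2 * M * ‖z - c‖ / (3/2 - ‖z - c‖) ≤ 2 * M * (3/2) / (δ/2) := by
            gcongr; linarith
        _ = _ := by field_simp; ring
    · have h6 : DifferentiableAt ℂ g (w + c) := (hg _ (hsh w hw)).differentiableAt
      have h7 : DifferentiableAt ℂ (fun w => w + c) w := by fun_prop
      exact (h6.comp w h7).differentiableWithinAt
  have hsc : ‖s - c‖ ≤ 3/2 - δ := by
    have : s - c = ((s.re - 2 : ℝ) : ℂ) := by
      apply Complex.ext <;> simp [hc, ht]
    rw [this, Complex.norm_real, Real.norm_eq_abs, abs_le]; constructor <;> linarith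
  have hsb : s ∈ Metric.ball c (3/2) := by rw [Metric.mem_ball, dist_eq_norm]; linarith
  have hder := Complex.norm_deriv_le_of_forall_mem_sphere_norm_le (c := s) (R := δ/2) (C := 6 * M / δ) (f := g) (by linarith) ?_ ?_
  · rw [(hg s hsb).deriv] at hder
    refine hder.trans (le_of_eq ?_)
    rw [hM]; field_simp; ring
  · refine DifferentiableOn.diffContOnCl fun z hz => ?_
    rw [closure_ball _ (by linarith), Metric.mem_closedBall, dist_eq_norm] at hz
    have : ‖z - c‖ < 3/2 := by
      have := norm_add_le (z - s) (s - c); rw [sub_add_sub_cancel] at this; linarith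
    exact (hg z (by rw [Metric.mem_ball, dist_eq_norm]; exact this)).differentiableAt.differentiableWithinAt
  · intro z hz
    rw [Metric.mem_sphere, dist_eq_norm] at hz
    apply hbc
    have := norm_add_le (z - s) (s - c); rw [sub_add_sub_cancel] at this; linarith
end

section
open Real Filter Topology MeasureTheory Set

lemma st9_fourier_inv {f : ℝ → ℂ} (hc : Continuous f) (hi : Integrable f) {g : ℝ → ℂ}
    (hg : ∀ t : ℝ, ∫ v : ℝ, f v * Complex.exp (-(t * v * Complex.I)) = g t) (hgi : Integrable g) (v : ℝ) :
    f v = 1 / (2 * π) * ∫ t : ℝ, g t * Complex.exp (t * v * Complex.I) := by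
  have h1 : ∀ w, FourierTransform.fourier f w = g (2 * π * w) := by
    intro w
    rw [Real.fourier_real_eq_integral_exp_smul, ← hg]
    congr 1; ext v
    rw [smul_eq_mul, mul_comm]; congr 2; push_cast; ring
  have h2 : Integrable (FourierTransform.fourier f) := by
    have : FourierTransform.fourier f = fun w => g (2 * π * w) := funext h1
    rw [this]
    exact hgi.comp_mul_left' (by positivity)
  have h3 := hi.fourierInv_fourier_eq h2 (hc.continuousAt (x := v))
  rw [← h3, Real.fourierInv_eq']
  have h4 := Measure.integral_comp_mul_left (fun t : ℝ => g t * Complex.exp (t * v * Complex.I)) (2 * π)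
  rw [abs_of_pos (by positivity)] at h4
  have h5 : (1 / (2 * π) : ℂ) = (((2 * π)⁻¹ : ℝ) : ℂ) := by push_cast; ring
  rw [h5, ← Complex.real_smul, ← h4]
  congr 1; ext w
  rw [h1, smul_eq_mul, mul_comm]
  congr 2
  simp [inner]; ring

lemma st9_laplace_inv {F : ℝ → ℂ} {c : ℝ} {H : ℝ → ℂ} (hF : Continuous F) (h0 : ∀ v ≤ 0, F v = 0)
    (hi : IntegrableOn (fun v : ℝ => Complex.exp (-(c * v)) * F v) (Ioi 0))
    (hH : ∀ t : ℝ, ∫ v in Ioi (0:ℝ), Complex.exp (-((c + t * Complex.I) * v)) * F v = H t)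
    (hHi : Integrable H) (v : ℝ) :
    F v = 1 / (2 * π) * ∫ t : ℝ, H t * Complex.exp ((c + t * Complex.I) * v) := by
  have hz : ∀ v ∉ Ioi (0:ℝ), F v = 0 := fun v hv => h0 v (by simpa using hv)
  have h1 : Integrable (fun v : ℝ => Complex.exp (-(c * v)) * F v) := by
    rwa [integrableOn_iff_integrable_of_support_subset] at hi
    intro v hv
    by_contra h
    simp [hz v h] at hv
  have h2 := st9_fourier_inv (f := fun v : ℝ => Complex.exp (-(c * v)) * F v) (by fun_prop) h1 (g := H)
    (fun t => ?_) hHi v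
  · have h3 : F v = Complex.exp (c * v) * (Complex.exp (-(c * v)) * F v) := by
      rw [← mul_assoc, ← Complex.exp_add]; simp
    rw [h3, h2, mul_left_comm, ← integral_const_mul]
    congr 2; ext t
    rw [mul_left_comm, ← Complex.exp_add]; congr 2; ring
  · rw [← hH t, ← setIntegral_eq_integral_of_forall_compl_eq_zero (s := Ioi (0:ℝ))]
    · congr 1; ext v
      rw [mul_right_comm, ← Complex.exp_add]; congr 2; ring
    · intro v hv; simp [hz v hv]

lemma st9_int_vexp {s : ℂ} (hs : 0 < s.re) :
    IntegrableOn (fun v : ℝ => Complex.exp (-(s * v)) * (v:ℂ)) (Ioi 0) ∧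
    ∫ v in Ioi (0:ℝ), Complex.exp (-(s * v)) * (v:ℂ) = 1 / s ^ 2 := by
  have hs0 : s ≠ 0 := by rintro rfl; simp at hs
  have hnorm : ∀ v : ℝ, ‖Complex.exp (-(s * v))‖ = Real.exp (-s.re * v) := by
    intro v; rw [Complex.norm_exp]; simp
  have hint : IntegrableOn (fun v : ℝ => Complex.exp (-(s * v)) * (v:ℂ)) (Ioi 0) := by
    have h := integrableOn_rpow_mul_exp_neg_mul_rpow (p := 1) (s := 1) (b := s.re) (by norm_num) (by norm_num) hs
    refine h.mono' (Continuous.aestronglyMeasurable (by fun_prop)) ?_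
    refine (ae_restrict_iff' measurableSet_Ioi).2 (Eventually.of_forall fun v hv => ?_)
    rw [norm_mul, hnorm, Complex.norm_real, Real.norm_eq_abs, abs_of_pos hv]
    simp [mul_comm]
  refine ⟨hint, ?_⟩
  have hd : ∀ v ∈ Ici (0:ℝ), HasDerivAt (fun v : ℝ => -(Complex.exp (-(s * v)) * ((v:ℂ) / s + 1 / s^2)))
      (Complex.exp (-(s * v)) * (v:ℂ)) v := by
    intro v _
    have h1 : HasDerivAt (fun v : ℝ => (v:ℂ)) 1 v := Complex.ofRealCLM.hasDerivAt
    have h2 := (((h1.const_mul s).neg.cexp).mul ((h1.div_const s).add_const (1 / s^2))).neg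
    refine h2.congr_deriv ?_
    simp only [Pi.neg_apply]
    field_simp
    ring
  have hlim : Tendsto (fun v : ℝ => -(Complex.exp (-(s * v)) * ((v:ℂ) / s + 1 / s^2))) atTop (𝓝 0) := by
    have a1 : Tendsto (fun v : ℝ => Complex.exp (-(s * v)) * (v:ℂ)) atTop (𝓝 0) := by
      rw [tendsto_zero_iff_norm_tendsto_zero]
      refine (tendsto_rpow_mul_exp_neg_mul_atTop_nhds_zero 1 s.re hs).congr' ?_
      filter_upwards [eventually_gt_atTop 0] with v hv
      rw [norm_mul, hnorm, Complex.norm_real, Real.norm_eq_abs, abs_of_pos hv]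
      simp [mul_comm]
    have a2 : Tendsto (fun v : ℝ => Complex.exp (-(s * v))) atTop (𝓝 0) := by
      rw [tendsto_zero_iff_norm_tendsto_zero]
      refine (tendsto_rpow_mul_exp_neg_mul_atTop_nhds_zero 0 s.re hs).congr' ?_
      filter_upwards [eventually_gt_atTop 0] with v hv
      rw [hnorm]; simp
    have := ((a1.div_const s).add (a2.mul_const (1 / s^2))).neg
    simp only [zero_div, zero_mul, add_zero, neg_zero] at this
    refine this.congr fun v => ?_
    ring
  rw [integral_Ioi_of_hasDerivAt_of_tendsto' hd hint hlim]
  simp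

lemma st9_int_exp {s : ℂ} (hs : 0 < s.re) :
    IntegrableOn (fun v : ℝ => Complex.exp (-(s * v))) (Ioi 0) ∧
    ∫ v in Ioi (0:ℝ), Complex.exp (-(s * v)) = 1 / s := by
  have h := integrableOn_exp_mul_complex_Ioi (a := -s) (by simpa using hs) 0
  have h' := integral_exp_mul_complex_Ioi (a := -s) (by simpa using hs) 0
  simp only [neg_mul] at h h'
  refine ⟨h, ?_⟩
  rw [h']; simp

lemma st9_norm_ge {c t : ℝ} : c^2 + t^2 = ‖(c + t * Complex.I : ℂ)‖^2 := by
  rw [← Complex.normSq_eq_norm_sq, Complex.normSq_apply]; simp; ring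

lemma st9_line_ne {c : ℝ} (hc : 0 < c) (t : ℝ) : (c + t * Complex.I : ℂ) ≠ 0 := by
  intro h; have := congrArg Complex.re h; simp at this; linarith

lemma st9_integrable_inv_sq {c : ℝ} (hc : 0 < c) : Integrable (fun t : ℝ => (c^2 + t^2)⁻¹) := by
  have h := (integrable_inv_one_add_sq).comp_mul_left' (R := c⁻¹) (by positivity)
  refine (h.const_mul (c^2)⁻¹).congr (Eventually.of_forall fun t => ?_)
  simp only []
  field_simp

lemma st9_integrable_line_sq {c : ℝ} (hc : 0 < c) :
    Integrable (fun t : ℝ => 1 / (c + t * Complex.I : ℂ)^2) := by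
  refine (st9_integrable_inv_sq hc).mono' ?_ (Eventually.of_forall fun t => ?_)
  · refine Continuous.aestronglyMeasurable ?_
    refine Continuous.div (by fun_prop) (by fun_prop) fun t => pow_ne_zero 2 (st9_line_ne hc t)
  · rw [norm_div, norm_one, norm_pow, ← st9_norm_ge, one_div]

lemma st9_perron {c : ℝ} (hc : 0 < c) (v : ℝ) :
    ((max v 0 : ℝ) : ℂ) = 1 / (2 * π) * ∫ t : ℝ, 1 / (c + t * Complex.I : ℂ)^2 * Complex.exp ((c + t * Complex.I) * v) := by
  have key : ∀ s : ℂ, ∀ v ∈ Ioi (0:ℝ), Complex.exp (-(s * v)) * ((max v 0 : ℝ) : ℂ) = Complex.exp (-(s * v)) * (v:ℂ) := by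
    intro s v hv; rw [max_eq_left (le_of_lt hv)]
  refine st9_laplace_inv (F := fun v => ((max v 0 : ℝ) : ℂ)) (by fun_prop) (fun v hv => ?_) ?_ (fun t => ?_) (st9_integrable_line_sq hc) v
  · simp [max_eq_right hv]
  · exact (integrableOn_congr_fun (key c) measurableSet_Ioi).2 (st9_int_vexp (s := c) (by simpa using hc)).1
  · rw [setIntegral_congr_fun measurableSet_Ioi (key _)]
    exact (st9_int_vexp (by simpa using hc)).2

lemma st9_perron2 (v : ℝ) :
    ((if 0 ≤ v then Real.exp v - 1 - v else 0 : ℝ) : ℂ) = 1 / (2 * π) * ∫ t : ℝ, (1 / (2 + t * Complex.I : ℂ)^2 * (1 / (2 + t * Complex.I - 1))) * Complex.exp ((2 + t * Complex.I) * v) := by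
  have key : ∀ s : ℂ, ∀ v ∈ Ioi (0:ℝ), Complex.exp (-(s * v)) * ((if 0 ≤ v then Real.exp v - 1 - v else 0 : ℝ) : ℂ)
    = Complex.exp (-((s - 1) * v)) - Complex.exp (-(s * v)) - Complex.exp (-(s * v)) * (v:ℂ) := by
    intro s v hv; rw [if_pos (le_of_lt hv)]; push_cast
    rw [mul_sub, mul_sub, ← Complex.exp_add]; congr 2
    · ring_nf
    · ring
  have hcont : Continuous fun v : ℝ => ((if 0 ≤ v then Real.exp v - 1 - v else 0 : ℝ) : ℂ) := by
    refine Complex.continuous_ofReal.comp ?_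
    refine Continuous.if_le (by fun_prop) (by fun_prop) (by fun_prop) (by fun_prop) ?_
    intro x hx; simp [← hx]
  have h1 := fun (s : ℂ) (hs : 1 < s.re) => st9_int_exp (s := s - 1) (by simpa using hs)
  have h2 := fun (s : ℂ) (hs : 1 < s.re) => st9_int_exp (s := s) (by linarith)
  have h3 := fun (s : ℂ) (hs : 1 < s.re) => st9_int_vexp (s := s) (by linarith)
  have := st9_laplace_inv (F := fun v : ℝ => ((if 0 ≤ v then Real.exp v - 1 - v else 0 : ℝ) : ℂ)) (c := 2)
    (H := fun t => 1 / (2 + t * Complex.I : ℂ)^2 * (1 / (2 + t * Complex.I - 1))) hcont (fun v hv => ?_) ?_ (fun t => ?_) ?_ v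
  · simpa using this
  · rcases hv.lt_or_eq with h | h
    · simp [not_le.2 h]
    · simp [h]
  · refine (integrableOn_congr_fun (key _) measurableSet_Ioi).2 ?_
    have h : 1 < (((2:ℝ):ℂ)).re := by simp
    exact ((h1 _ h).1.sub (h2 _ h).1).sub (h3 _ h).1
  · rw [setIntegral_congr_fun measurableSet_Ioi (key _)]
    have h : 1 < (((2:ℝ):ℂ) + t * Complex.I).re := by simp
    rw [integral_sub, integral_sub, (h1 _ h).2, (h2 _ h).2, (h3 _ h).2]
    · have n1 : (2 + t * Complex.I : ℂ) ≠ 0 := by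
        intro h; have := congrArg Complex.re h; simp at this
      have n2 : (2 + t * Complex.I - 1 : ℂ) ≠ 0 := by
        intro h; have := congrArg Complex.re h; simp at this; norm_num at this
      push_cast
      field_simp
      ring
    · exact (h1 _ h).1
    · exact (h2 _ h).1
    · exact ((h1 _ h).1.sub (h2 _ h).1)
    · exact (h3 _ h).1
  · have hi := st9_integrable_line_sq (c := 2) (by norm_num)
    refine hi.mono ?_ (Eventually.of_forall fun t => ?_)
    · refine Continuous.aestronglyMeasurable ?_
      refine Continuous.mul (Continuous.div (by fun_prop) (by fun_prop) fun t => ?_) (Continuous.div (by fun_prop) (by fun_prop) fun t => ?_)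
      · refine pow_ne_zero 2 ?_
        intro h; have := congrArg Complex.re h; simp at this
      · intro h; have := congrArg Complex.re h; simp at this; norm_num at this
    · rw [norm_mul]
      have : ‖1 / (2 + t * Complex.I - 1 : ℂ)‖ ≤ 1 := by
        rw [norm_div, norm_one]
        have := Complex.abs_re_le_norm (2 + t * Complex.I - 1 : ℂ)
        refine div_le_one_of_le₀ ?_ (norm_nonneg _)
        refine le_trans ?_ this
        simp; norm_num
      calc _ ≤ ‖1 / (2 + t * Complex.I : ℂ)^2‖ * 1 := by gcongr
        _ = _ := by simp
end

section
open Real Filter Topology MeasureTheory Set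

lemma st9_LD_pow (hRH : RiemannHypothesis) {δ : ℝ} (hδ : 0 < δ) :
    ∃ C : ℝ, 0 < C ∧ ∀ s : ℂ, 1/2 + δ ≤ s.re → s.re ≤ 2 → ‖st9_LD s‖ ≤ C * (1 + |s.im|) ^ δ := by
  obtain ⟨C, hC, h⟩ := st9_LD_bound hRH hδ
  refine ⟨C * (3 ^ δ / δ), by positivity, fun s h1 h2 => (h s h1 h2).trans ?_⟩
  have h0 := abs_nonneg s.im
  rw [mul_assoc]
  gcongr
  calc Real.log (|s.im| + 3) ≤ (|s.im| + 3) ^ δ / δ := Real.log_le_rpow_div (by positivity) hδ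
    _ ≤ (3 * (1 + |s.im|)) ^ δ / δ := by gcongr; linarith
    _ = _ := by rw [Real.mul_rpow (by norm_num) (by positivity)]; ring

lemma st9_integrable_pow {r : ℝ} (hr : 1 < r) : Integrable (fun t : ℝ => (1 + |t|) ^ (-r)) := by
  simpa using integrable_one_add_norm (E := ℝ) (μ := volume) (r := r) (by simpa using hr)

lemma st9_line_integrable {g : ℂ → ℂ} {b c K r a : ℝ} (hr : 1 < r) (hba : b ≤ a) (hac : a ≤ c)
    (hg : ContinuousOn g {s | b ≤ s.re ∧ s.re ≤ c})
    (hK : ∀ s : ℂ, b ≤ s.re → s.re ≤ c → ‖g s‖ ≤ K * (1 + |s.im|) ^ (-r)) :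
    Integrable (fun t : ℝ => g (a + t * Complex.I)) := by
  refine ((st9_integrable_pow hr).const_mul K).mono' ?_ (Eventually.of_forall fun t => ?_)
  · refine Continuous.aestronglyMeasurable ?_
    exact hg.comp_continuous (by fun_prop) (fun t => by simp [hba, hac])
  · simpa using hK (a + t * Complex.I) (by simpa using hba) (by simpa using hac)

lemma st9_shift {g : ℂ → ℂ} {b c K r : ℝ} (hr : 1 < r) (hbc : b ≤ c)
    (hg : DifferentiableOn ℂ g {s | b ≤ s.re ∧ s.re ≤ c})
    (hK : ∀ s : ℂ, b ≤ s.re → s.re ≤ c → ‖g s‖ ≤ K * (1 + |s.im|) ^ (-r)) :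
    ∫ t : ℝ, g (b + t * Complex.I) = ∫ t : ℝ, g (c + t * Complex.I) := by
  have ib := st9_line_integrable hr le_rfl hbc hg.continuousOn hK
  have ic := st9_line_integrable hr hbc le_rfl hg.continuousOn hK
  have lb := intervalIntegral_tendsto_integral ib tendsto_neg_atTop_atBot tendsto_id
  have lc := intervalIntegral_tendsto_integral ic tendsto_neg_atTop_atBot tendsto_id
  have hrect : ∀ T : ℝ, (∫ x : ℝ in b..c, g (x + (-T : ℝ) * Complex.I)) - (∫ x : ℝ in b..c, g (x + T * Complex.I))
      + Complex.I • (∫ y : ℝ in (-T)..T, g (c + y * Complex.I)) - Complex.I • (∫ y : ℝ in (-T)..T, g (b + y * Complex.I)) = 0 := by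
    intro T
    have := Complex.integral_boundary_rect_eq_zero_of_differentiableOn g ⟨b, -T⟩ ⟨c, T⟩ (hg.mono ?_)
    · simpa using this
    · intro s hs
      rw [Complex.mem_reProdIm] at hs
      have := hs.1
      simp only [uIcc_of_le hbc] at this
      exact this
  have hor : ∀ T : ℝ, ‖∫ x : ℝ in b..c, g (x + T * Complex.I)‖ ≤ K * (1 + |T|) ^ (-r) * |c - b| := by
    intro T
    refine intervalIntegral.norm_integral_le_of_norm_le_const fun x hx => ?_
    rw [uIoc_of_le hbc] at hx
    simpa using hK (x + T * Complex.I) (by simpa using hx.1.le) (by simpa using hx.2)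
  have hz : Tendsto (fun T : ℝ => K * (1 + |T|) ^ (-r) * |c - b|) atTop (𝓝 0) := by
    have h1 : Tendsto (fun T : ℝ => (1 + |T|)) atTop atTop :=
      tendsto_atTop_add_const_left _ _ tendsto_abs_atTop_atTop
    have h2 := (tendsto_rpow_neg_atTop (y := r) (by linarith)).comp h1
    have := (h2.const_mul K).mul_const |c - b|
    simpa using this
  have z1 : Tendsto (fun T : ℝ => ∫ x : ℝ in b..c, g (x + T * Complex.I)) atTop (𝓝 0) :=
    squeeze_zero_norm hor hz
  have z2 : Tendsto (fun T : ℝ => ∫ x : ℝ in b..c, g (x + (-T : ℝ) * Complex.I)) atTop (𝓝 0) :=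
    squeeze_zero_norm (fun T => by simpa using hor (-T)) hz
  have := ((z2.sub z1).add (lc.const_smul Complex.I)).sub (lb.const_smul Complex.I)
  have h0 := tendsto_nhds_unique (this.congr fun T => hrect T) tendsto_const_nhds
  simp only [sub_zero, zero_add, smul_eq_mul, ← mul_sub] at h0
  have := (mul_eq_zero.1 h0).resolve_left Complex.I_ne_zero
  exact (sub_eq_zero.1 this).symm

lemma st9_norm_line {s : ℂ} (hs : 1/2 ≤ s.re) : (1 + |s.im|) / 3 ≤ ‖s‖ := by
  have h1 := Complex.abs_re_le_norm s
  have h2 := Complex.abs_im_le_norm s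
  have h3 := le_abs_self s.re
  linarith

noncomputable def st9_psil (X : ℝ) : ℝ := ∑' n : ℕ, ArithmeticFunction.vonMangoldt n * max (X - Real.log n) 0

lemma st9_LD_two (t : ℝ) : LSeries (fun n => (ArithmeticFunction.vonMangoldt n : ℂ)) (2 + t * Complex.I)
    = 1 / (2 + t * Complex.I - 1) - st9_LD (2 + t * Complex.I) := by
  set s : ℂ := 2 + t * Complex.I with hs
  have hre : 1 < s.re := by simp [hs]
  have hs1 : s ≠ 1 := by intro h; rw [h] at hre; simp at hre
  have hz : riemannZeta s ≠ 0 := riemannZeta_ne_zero_of_one_lt_re hre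
  have hN : riemannZeta₁ s ≠ 0 := by
    rw [riemannZeta_eq_inv_sub_mul hs1] at hz
    exact right_ne_zero_of_mul hz
  rw [ArithmeticFunction.LSeries_vonMangoldt_eq_deriv_riemannZeta_div hre]
  have hd : HasDerivAt riemannZeta (-(1) / (s - 1)^2 * riemannZeta₁ s + (s - 1)⁻¹ * deriv riemannZeta₁ s) s := by
    have h1 := ((hasDerivAt_id s).sub_const 1).inv (sub_ne_zero.2 hs1)
    have h2 := h1.mul (differentiable_riemannZeta₁ s).hasDerivAt
    refine h2.congr_of_eventuallyEq ?_
    filter_upwards [isOpen_ne.mem_nhds hs1] with z hz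
    rw [riemannZeta_eq_inv_sub_mul hz]; rfl
  rw [hd.deriv, riemannZeta_eq_inv_sub_mul hs1]
  unfold st9_LD
  have := sub_ne_zero.2 hs1
  field_simp
  ring

lemma st9_explicit (X : ℝ) (hX : 0 ≤ X) :
    ((st9_psil X - (Real.exp X - 1 - X) : ℝ) : ℂ) = -(1 / (2 * π) * ∫ t : ℝ, st9_LD (2 + t * Complex.I) / (2 + t * Complex.I)^2 * Complex.exp ((2 + t * Complex.I) * X)) := by
  have hsl : ∀ t : ℝ, 1 < (2 + t * Complex.I : ℂ).re := by intro t; simp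
  set F : ℕ → ℝ → ℂ := fun n t => (ArithmeticFunction.vonMangoldt n : ℂ) *
    (1 / (2 + t * Complex.I : ℂ)^2 * Complex.exp ((2 + t * Complex.I) * (X - Real.log n : ℝ))) with hF
  have hi := st9_integrable_line_sq (c := 2) (by norm_num)
  push_cast at hi
  have hn0 : ∀ n : ℕ, ArithmeticFunction.vonMangoldt n ≠ 0 → 0 < n := by
    intro n h; rcases Nat.eq_zero_or_pos n with rfl | h'
    · simp at h
    · exact h'
  have hFn : ∀ n t, ‖F n t‖ = (Real.exp (2 * X) * (ArithmeticFunction.vonMangoldt n / (n:ℝ)^2)) * ‖1 / (2 + t * Complex.I : ℂ)^2‖ := by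
    intro n t
    by_cases h : ArithmeticFunction.vonMangoldt n = 0
    · simp [hF, h]
    have hn : (0:ℝ) < n := Nat.cast_pos.2 (hn0 n h)
    simp only [hF, norm_mul, Complex.norm_real, Real.norm_eq_abs, abs_of_nonneg ArithmeticFunction.vonMangoldt_nonneg]
    rw [Complex.norm_exp]
    have : ((2 + t * Complex.I) * ((X - Real.log n : ℝ):ℂ)).re = 2 * X - Real.log n - Real.log n := by
      rw [Complex.re_mul_ofReal]; simp; ring
    rw [this, Real.exp_sub, Real.exp_sub, Real.exp_log hn]
    field_simp
  have hFi : ∀ n, Integrable (F n) := by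
    intro n
    refine (hi.norm.const_mul (Real.exp (2 * X) * (ArithmeticFunction.vonMangoldt n / (n:ℝ)^2))).mono' ?_ (Eventually.of_forall fun t => (hFn n t).le)
    exact (hi.aestronglyMeasurable.mul (Continuous.aestronglyMeasurable (by fun_prop))).const_mul _
  have hsumΛ : Summable (fun n : ℕ => ArithmeticFunction.vonMangoldt n / (n:ℝ)^2) := by
    have h := ArithmeticFunction.LSeriesSummable_vonMangoldt (s := 2) (by simp)
    refine h.norm.congr fun n => ?_
    rw [LSeries.norm_term_eq]
    by_cases h0 : n = 0
    · simp [h0]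
    · simp [h0, abs_of_nonneg ArithmeticFunction.vonMangoldt_nonneg]
  have hFs : Summable fun n => ∫ t, ‖F n t‖ := by
    simp_rw [hFn, integral_const_mul]
    exact (hsumΛ.mul_left _).mul_right _
  have h1 := integral_tsum_of_summable_integral_norm hFi hFs
  have h2 : ∀ n, ∫ t, F n t = (2 * π) * ((ArithmeticFunction.vonMangoldt n * max (X - Real.log n) 0 : ℝ) : ℂ) := by
    intro n
    have := st9_perron (c := 2) (by norm_num) (X - Real.log n)
    simp only [hF]
    rw [integral_const_mul, Complex.ofReal_mul, this]
    have : (π:ℂ) ≠ 0 := by exact_mod_cast Real.pi_ne_zero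
    rw [Complex.ofReal_ofNat, mul_left_comm (2 * (π:ℂ)), ← mul_assoc (2 * (π:ℂ)), mul_one_div_cancel (by simpa using this), one_mul]
  have h3 : ∀ t : ℝ, ∑' n, F n t = (1 / (2 + t * Complex.I : ℂ)^2 * Complex.exp ((2 + t * Complex.I) * X)) *
      (1 / (2 + t * Complex.I - 1) - st9_LD (2 + t * Complex.I)) := by
    intro t
    rw [← st9_LD_two, LSeries, ← tsum_mul_left]
    congr 1; ext n
    by_cases h : n = 0
    · simp [hF, h]
    have hn : (n:ℂ) ≠ 0 := Nat.cast_ne_zero.2 h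
    rw [LSeries.term_of_ne_zero h, Complex.cpow_def_of_ne_zero hn, div_eq_mul_inv (_ : ℂ) (Complex.exp _), ← Complex.exp_neg]
    simp only [hF]
    have : (2 + t * Complex.I) * ((X - Real.log n : ℝ):ℂ) = (2 + t * Complex.I) * X + -(Complex.log n * (2 + t * Complex.I)) := by
      push_cast
      rw [← Complex.ofReal_natCast, ← Complex.ofReal_log n.cast_nonneg]
      ring
    rw [this, Complex.exp_add]; ring
  simp_rw [h2, h3] at h1
  rw [tsum_mul_left, ← Complex.ofReal_tsum] at h1
  have h4 := st9_perron2 X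
  rw [if_pos hX] at h4
  rw [Complex.ofReal_sub, h4]
  have hpi : (π:ℂ) ≠ 0 := by exact_mod_cast Real.pi_ne_zero
  have h5 : ((st9_psil X : ℝ) : ℂ) = 1 / (2 * π) * (2 * π * ((∑' n : ℕ, ArithmeticFunction.vonMangoldt n * max (X - Real.log n) 0 : ℝ):ℂ)) := by
    unfold st9_psil; field_simp
  rw [h5, h1, ← mul_sub, ← mul_neg]
  congr 1
  have i1 : Integrable fun t : ℝ => 1 / (2 + t * Complex.I : ℂ)^2 * Complex.exp ((2 + t * Complex.I) * X) *
      (1 / (2 + t * Complex.I - 1) - st9_LD (2 + t * Complex.I)) := by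
    refine (hi.norm.const_mul (∑' n : ℕ, Real.exp (2 * X) * (ArithmeticFunction.vonMangoldt n / (n:ℝ)^2))).mono' ?_ (Eventually.of_forall fun t => ?_)
    · have hm : AEStronglyMeasurable (fun t => ∑' n, F n t) volume := by
        refine AEMeasurable.aestronglyMeasurable ?_
        refine (aestronglyMeasurable_of_tendsto_ae (u := atTop) (f := fun N t => ∑ n ∈ Finset.range N, F n t)
           (fun N => Finset.aestronglyMeasurable_fun_sum _ fun n _ => (hFi n).aestronglyMeasurable) (Eventually.of_forall fun t => ?_)).aemeasurable
        refine Summable.tendsto_sum_tsum_nat ?_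
        refine Summable.of_norm ?_
        simp_rw [hFn]
        exact (hsumΛ.mul_left _).mul_right _
      simpa only [h3] using hm
    · rw [← h3]
      refine (norm_tsum_le_tsum_norm ?_).trans ?_
      · simp_rw [hFn]
        exact (hsumΛ.mul_left _).mul_right _
      · simp_rw [hFn]; rw [tsum_mul_right]
  have i2 : Integrable fun t : ℝ => (1 / (2 + t * Complex.I : ℂ)^2 * (1 / (2 + t * Complex.I - 1))) * Complex.exp ((2 + t * Complex.I) * X) := by
    refine (hi.norm.const_mul (Real.exp (2 * X))).mono' ?_ (Eventually.of_forall fun t => ?_)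
    · refine (hi.aestronglyMeasurable.mul ?_).mul (Continuous.aestronglyMeasurable (by fun_prop))
      refine Continuous.aestronglyMeasurable (Continuous.div (by fun_prop) (by fun_prop) fun t => ?_)
      intro h; have := congrArg Complex.re h; simp at this; norm_num at this
    · rw [norm_mul, norm_mul, Complex.norm_exp]
      have h7 : ‖1 / (2 + t * Complex.I - 1 : ℂ)‖ ≤ 1 := by
        rw [norm_div, norm_one]
        have := Complex.abs_re_le_norm (2 + t * Complex.I - 1 : ℂ)
        refine div_le_one_of_le₀ ?_ (norm_nonneg _)
        refine le_trans ?_ this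
        simp; norm_num
      have h8 : ((2 + t * Complex.I) * (X:ℂ)).re = 2 * X := by simp
      rw [h8]
      calc _ ≤ ‖1 / (2 + t * Complex.I : ℂ)^2‖ * 1 * Real.exp (2 * X) := by gcongr
        _ = _ := by ring
  rw [← integral_sub i1 i2, ← integral_neg]
  congr 1; ext t
  ring
end

section
open Real Filter Topology MeasureTheory Set

lemma st9_exp_sub_one {z : ℂ} {κ : ℝ} (hκ0 : 0 ≤ κ) (hκ : κ ≤ 1) (hz : z.re ≤ 2) :
    ‖Complex.exp z - 1‖ ≤ 10 * ‖z‖ ^ κ := by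
  rcases le_total ‖z‖ 1 with h | h
  · have h1 := Complex.norm_exp_sub_one_le h
    have h2 : ‖z‖ ≤ ‖z‖ ^ κ := by
      rcases (norm_nonneg z).eq_or_lt with h0 | h0
      · rw [← h0]; positivity
      · conv_lhs => rw [← Real.rpow_one ‖z‖]
        exact Real.rpow_le_rpow_of_exponent_ge h0 h hκ
    linarith [norm_nonneg z]
  · have h1 : ‖Complex.exp z - 1‖ ≤ 10 := by
      refine (norm_sub_le _ _).trans ?_
      rw [Complex.norm_exp, norm_one]
      have : Real.exp z.re ≤ Real.exp 2 := Real.exp_le_exp.2 hz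
      have h3 : Real.exp 2 = Real.exp 1 * Real.exp 1 := by rw [← Real.exp_add]; norm_num
      have := Real.exp_one_lt_d9; have := Real.exp_pos 1
      nlinarith
    have := Real.one_le_rpow h hκ0
    linarith

lemma st9_inc (hRH : RiemannHypothesis) {δ : ℝ} (hδ : 0 < δ) (hδ2 : δ < 1/2) :
    ∃ C : ℝ, 0 < C ∧ ∀ X h : ℝ, 0 ≤ X → 0 < h → h ≤ 1 →
    |(st9_psil (X + h) - (Real.exp (X + h) - 1 - (X + h))) - (st9_psil X - (Real.exp X - 1 - X))|
      ≤ C * Real.exp ((1/2 + δ) * X) * h ^ (1 - 2 * δ) := by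
  obtain ⟨C, hC, hLD⟩ := st9_LD_pow hRH hδ
  set b : ℝ := 1/2 + δ with hb
  set g : ℝ → ℂ → ℂ := fun X s => st9_LD s / s^2 * Complex.exp (s * X) with hg
  have hs0 : ∀ s : ℂ, b ≤ s.re → s ≠ 0 := by
    intro s hs h; rw [h] at hs; simp at hs; linarith
  have hdiff : ∀ X, DifferentiableOn ℂ (g X) {s | b ≤ s.re ∧ s.re ≤ (2:ℝ)} := by
    intro X s hs
    refine DifferentiableAt.differentiableWithinAt ?_
    refine DifferentiableAt.mul (DifferentiableAt.div (st9_LD_diff hRH (by have := hs.1; linarith)) (by fun_prop) (pow_ne_zero 2 (hs0 s hs.1))) (by fun_prop)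
  have hbd0 : ∀ s : ℂ, b ≤ s.re → s.re ≤ 2 → ‖st9_LD s / s^2‖ ≤ 9 * C * (1 + |s.im|) ^ (δ - 2) := by
    intro s h1 h2
    have hp : 0 < 1 + |s.im| := by positivity
    have h3 := st9_norm_line (s := s) (by linarith)
    rw [norm_div, norm_pow, Real.rpow_sub hp, Real.rpow_two]
    have h4 := hLD s h1 h2
    calc ‖st9_LD s‖ / ‖s‖^2 ≤ (C * (1 + |s.im|)^δ) / ((1 + |s.im|)/3)^2 := by gcongr
      _ = _ := by field_simp; ring
  have hbd : ∀ X : ℝ, 0 ≤ X → ∀ s : ℂ, b ≤ s.re → s.re ≤ 2 → ‖g X s‖ ≤ (9 * C * Real.exp (2 * X)) * (1 + |s.im|) ^ (-(2 - δ)) := by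
    intro X hX s h1 h2
    simp only [hg]
    rw [norm_mul, Complex.norm_exp, Complex.re_mul_ofReal]
    have h3 : Real.exp (s.re * X) ≤ Real.exp (2 * X) := Real.exp_le_exp.2 (by nlinarith)
    have h4 := hbd0 s h1 h2
    calc _ ≤ (9 * C * (1 + |s.im|) ^ (δ - 2)) * Real.exp (2 * X) := by gcongr
      _ = _ := by rw [neg_sub]; ring
  have hR : ∀ X : ℝ, 0 ≤ X → ((st9_psil X - (Real.exp X - 1 - X) : ℝ) : ℂ) = -(1 / (2 * π) * ∫ t : ℝ, g X (b + t * Complex.I)) := by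
    intro X hX
    rw [st9_explicit X hX, st9_shift (r := 2 - δ) (b := b) (c := 2) (by linarith) (by linarith) (hdiff X) (hbd X hX)]
    simp [hg]
  have hint : ∀ X : ℝ, 0 ≤ X → Integrable fun t : ℝ => g X (b + t * Complex.I) := fun X hX =>
    st9_line_integrable (r := 2 - δ) (b := b) (c := 2) (by linarith) le_rfl (by linarith) (hdiff X).continuousOn (hbd X hX)
  set A := ∫ t : ℝ, (1 + |t|) ^ (-(1 + δ)) with hA
  have hA0 : 0 ≤ A := integral_nonneg fun t => by positivity
  have hAi := st9_integrable_pow (r := 1 + δ) (by linarith)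
  refine ⟨1 / (2 * π) * (90 * C * A * 2 ^ (1 - 2 * δ)) + 1, by positivity, fun X h hX hh hh1 => ?_⟩
  have hnorm : |(st9_psil (X + h) - (Real.exp (X + h) - 1 - (X + h))) - (st9_psil X - (Real.exp X - 1 - X))|
      = ‖(((st9_psil (X + h) - (Real.exp (X + h) - 1 - (X + h)) : ℝ) : ℂ)) - ((st9_psil X - (Real.exp X - 1 - X) : ℝ) : ℂ)‖ := by
    rw [← Complex.ofReal_sub, Complex.norm_real, Real.norm_eq_abs]
  rw [hnorm, hR X hX, hR (X+h) (by linarith), ← neg_sub', norm_neg, ← mul_sub, ← integral_sub (hint _ (by linarith)) (hint _ hX), norm_mul]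
  have hpi : ‖(1 / (2 * π) : ℂ)‖ = 1 / (2 * π) := by
    rw [norm_div, norm_one, norm_mul, Complex.norm_real, Real.norm_eq_abs, abs_of_pos Real.pi_pos]; simp
  rw [hpi]
  have hmain : ‖∫ t : ℝ, (g (X + h) (b + t * Complex.I) - g X (b + t * Complex.I))‖ ≤
      ∫ t : ℝ, (90 * C * 2 ^ (1 - 2 * δ) * Real.exp (b * X) * h ^ (1 - 2 * δ)) * (1 + |t|) ^ (-(1 + δ)) := by
    refine norm_integral_le_of_norm_le (hAi.const_mul _) (Eventually.of_forall fun t => ?_)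
    have him : (b + t * Complex.I : ℂ).im = t := by simp
    have hre : (b + t * Complex.I : ℂ).re = b := by simp
    set s : ℂ := b + t * Complex.I with hs
    have e1 : g (X + h) s - g X s = st9_LD s / s^2 * Complex.exp (s * X) * (Complex.exp (s * h) - 1) := by
      simp only [hg]; push_cast; rw [mul_add, Complex.exp_add]; ring
    rw [e1, norm_mul, norm_mul, Complex.norm_exp, Complex.re_mul_ofReal, hre]
    have h1 := hbd0 s hre.ge (by rw [hre]; linarith)
    have h2 := st9_exp_sub_one (z := s * h) (κ := 1 - 2 * δ) (by linarith) (by linarith) (by rw [Complex.re_mul_ofReal, hre]; nlinarith)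
    have hp : 0 < 1 + |t| := by positivity
    have h3 : ‖s * h‖ ≤ 2 * (1 + |t|) * h := by
      rw [norm_mul, Complex.norm_real, Real.norm_eq_abs, abs_of_pos hh]
      gcongr
      refine (norm_add_le _ _).trans ?_
      rw [norm_mul, Complex.norm_I, Complex.norm_real, Complex.norm_real, Real.norm_eq_abs, Real.norm_eq_abs, abs_of_pos (by linarith)]
      linarith [abs_nonneg t]
    have h4 : ‖s * h‖ ^ (1 - 2 * δ) ≤ 2 ^ (1 - 2 * δ) * (1 + |t|) ^ (1 - 2 * δ) * h ^ (1 - 2 * δ) := by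
      rw [← Real.mul_rpow (by positivity) hp.le, ← Real.mul_rpow (by positivity) hh.le]
      exact Real.rpow_le_rpow (norm_nonneg _) h3 (by linarith)
    rw [him] at h1
    have h5 : (1 + |t|) ^ (-(1 + δ)) = (1 + |t|) ^ (δ - 2) * (1 + |t|) ^ (1 - 2 * δ) := by
      rw [← Real.rpow_add hp]; congr 1; ring
    calc _ ≤ (9 * C * (1 + |t|) ^ (δ - 2)) * Real.exp (b * X) * (10 * (2 ^ (1 - 2 * δ) * (1 + |t|) ^ (1 - 2 * δ) * h ^ (1 - 2 * δ))) := by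
          gcongr
          exact h2.trans (by gcongr)
      _ = _ := by rw [h5]; ring
  rw [integral_const_mul, ← hA] at hmain
  calc _ ≤ 1 / (2 * π) * (90 * C * 2 ^ (1 - 2 * δ) * Real.exp (b * X) * h ^ (1 - 2 * δ) * A) := by gcongr
    _ = 1 / (2 * π) * (90 * C * A * 2 ^ (1 - 2 * δ)) * Real.exp (b * X) * h ^ (1 - 2 * δ) := by ring
    _ ≤ _ := by gcongr; linarith

lemma st9_psil_eq {X : ℝ} {N : ℕ} (hN : ⌊Real.exp X⌋₊ ≤ N) :
    st9_psil X = ∑ n ∈ Finset.Ioc 0 N, ArithmeticFunction.vonMangoldt n * max (X - Real.log n) 0 := by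
  unfold st9_psil
  refine tsum_eq_sum fun n hn => ?_
  rw [Finset.mem_Ioc, not_and_or] at hn
  rcases hn with hn | hn
  · have : n = 0 := by omega
    simp [this]
  · have h1 : ⌊Real.exp X⌋₊ < n := by omega
    have h2 := (Nat.floor_lt (Real.exp_pos X).le).1 h1
    have : X < Real.log n := (Real.lt_log_iff_exp_lt (by linarith [Real.exp_pos X])).2 h2
    rw [max_eq_right (by linarith), mul_zero]

lemma st9_psi_le {X h : ℝ} (hh : 0 < h) :
    h * Chebyshev.psi (Real.exp X) ≤ st9_psil (X + h) - st9_psil X ∧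
    st9_psil (X + h) - st9_psil X ≤ h * Chebyshev.psi (Real.exp (X + h)) := by
  have hmono : ⌊Real.exp X⌋₊ ≤ ⌊Real.exp (X + h)⌋₊ := Nat.floor_le_floor (Real.exp_le_exp.2 (by linarith))
  rw [st9_psil_eq (X := X + h) le_rfl, st9_psil_eq (X := X) hmono, ← Finset.sum_sub_distrib]
  have hl : ∀ n : ℕ, 0 < n → n ≤ ⌊Real.exp X⌋₊ → Real.log n ≤ X := by
    intro n h0 h1
    have := (Nat.le_floor_iff (Real.exp_pos X).le).1 h1
    exact (Real.log_le_iff_le_exp (by exact_mod_cast h0)).2 this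
  constructor
  · rw [Chebyshev.psi, Finset.mul_sum]
    calc _ ≤ ∑ n ∈ Finset.Ioc 0 ⌊Real.exp X⌋₊, (ArithmeticFunction.vonMangoldt n * max (X + h - Real.log n) 0 - ArithmeticFunction.vonMangoldt n * max (X - Real.log n) 0) := by
          refine Finset.sum_le_sum fun n hn => ?_
          rw [Finset.mem_Ioc] at hn
          have := hl n hn.1 hn.2
          rw [max_eq_left (by linarith), max_eq_left (by linarith)]
          apply le_of_eq; ring
      _ ≤ _ := by
          refine Finset.sum_le_sum_of_subset_of_nonneg (Finset.Ioc_subset_Ioc_right hmono) fun n _ _ => ?_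
          rw [← mul_sub]
          refine mul_nonneg ArithmeticFunction.vonMangoldt_nonneg ?_
          have : max (X - Real.log n) 0 ≤ max (X + h - Real.log n) 0 := max_le_max (by linarith) le_rfl
          linarith
  · rw [Chebyshev.psi, Finset.mul_sum]
    refine Finset.sum_le_sum fun n hn => ?_
    rw [← mul_sub, mul_comm h]
    refine mul_le_mul_of_nonneg_left ?_ ArithmeticFunction.vonMangoldt_nonneg
    have h1 := le_max_left (X - Real.log n) 0
    have h2 := le_max_right (X - Real.log n) 0
    have : max (X + h - Real.log n) 0 ≤ max (X - Real.log n) 0 + h := max_le (by linarith) (by linarith)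
    linarith

lemma st9_psi_RH (hRH : RiemannHypothesis) {δ : ℝ} (hδ : 0 < δ) (hδ2 : δ < 1/2) :
    ∃ K : ℝ, 0 < K ∧ ∀ X : ℝ, 1 ≤ X → |Chebyshev.psi (Real.exp X) - Real.exp X| ≤ K * Real.exp ((1/2 + 2 * δ) * X) := by
  obtain ⟨C, hC, hinc⟩ := st9_inc hRH hδ hδ2
  refine ⟨C + 2, by positivity, fun X hX => ?_⟩
  set h := Real.exp (-X/2) with hh
  have h0 : 0 < h := Real.exp_pos _
  have h1 : h ≤ 1 := by rw [hh, ← Real.exp_zero]; exact Real.exp_le_exp.2 (by linarith)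
  have a1 := hinc X h (by linarith) h0 h1
  have a2 := hinc (X - h) h (by linarith) h0 h1
  have b1 := (st9_psi_le (X := X) h0).1
  have b2 := (st9_psi_le (X := X - h) h0).2
  rw [sub_add_cancel] at a2 b2
  have e1 : Real.exp (X + h) ≤ Real.exp X + Real.exp X * h + Real.exp X * h^2 := by
    rw [Real.exp_add]
    have := Real.abs_exp_sub_one_sub_id_le (x := h) (by rw [abs_of_pos h0]; exact h1)
    have := (abs_le.1 this).2
    nlinarith [Real.exp_pos X]
  have e2 : Real.exp (X - h) ≤ Real.exp X - Real.exp X * h + Real.exp X * h^2 := by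
    rw [sub_eq_add_neg, Real.exp_add]
    have := Real.abs_exp_sub_one_sub_id_le (x := -h) (by rw [abs_neg, abs_of_pos h0]; exact h1)
    have := (abs_le.1 this).2
    nlinarith [Real.exp_pos X]
  have e3 : Real.exp ((1/2 + δ) * (X - h)) ≤ Real.exp ((1/2 + δ) * X) := Real.exp_le_exp.2 (by nlinarith)
  have hpow : h ^ (1 - 2 * δ) = h * Real.exp (δ * X) := by
    rw [hh, ← Real.exp_mul, ← Real.exp_add]; congr 1; ring
  have hE : Real.exp ((1/2 + δ) * X) * Real.exp (δ * X) = Real.exp ((1/2 + 2 * δ) * X) := by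
    rw [← Real.exp_add]; congr 1; ring
  set E := Real.exp ((1/2 + 2 * δ) * X) with hEd
  have hXh : Real.exp X * h ≤ E := by
    rw [hh, ← Real.exp_add]; exact Real.exp_le_exp.2 (by nlinarith)
  have hE1 : 1 ≤ E := Real.one_le_exp (by nlinarith)
  rw [hpow] at a1 a2
  have a1' : C * Real.exp ((1/2 + δ) * X) * (h * Real.exp (δ * X)) = h * (C * E) := by rw [← hE]; ring
  have a2' : C * Real.exp ((1/2 + δ) * (X - h)) * (h * Real.exp (δ * X)) ≤ h * (C * E) := by
    rw [← a1']; gcongr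
  rw [a1'] at a1
  have a1u := (abs_le.1 a1).2
  have a2l := (abs_le.1 (a2.trans a2')).1
  have hup : h * (Chebyshev.psi (Real.exp X) - Real.exp X) ≤ h * ((C + 2) * E) := by
    nlinarith
  have hlo : h * (-((C + 2) * E)) ≤ h * (Chebyshev.psi (Real.exp X) - Real.exp X) := by
    nlinarith
  rw [abs_le]
  exact ⟨le_of_mul_le_mul_left hlo h0, le_of_mul_le_mul_left hup h0⟩

lemma st9_theta_RH (hRH : RiemannHypothesis) {δ : ℝ} (hδ : 0 < δ) (hδ2 : δ < 1/2) :
    ∃ K : ℝ, 0 < K ∧ ∀ v : ℝ, 1 ≤ v → |Chebyshev.theta v - v| ≤ K * v ^ (1/2 + δ) := by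
  obtain ⟨K, hK, h⟩ := st9_psi_RH hRH (δ := δ / 2) (by linarith) (by linarith)
  refine ⟨K + 2 / δ + 9, by positivity, fun v hv => ?_⟩
  have hv0 : 0 < v := by linarith
  have hp1 : 1 ≤ v ^ (1/2 + δ) := Real.one_le_rpow hv (by linarith)
  rcases le_total 3 v with h3 | h3
  · have hlog : 1 ≤ Real.log v := by
      rw [Real.le_log_iff_exp_le hv0]; have := Real.exp_one_lt_d9; linarith
    have a := h (Real.log v) hlog
    rw [Real.exp_log hv0] at a
    have e : Real.exp ((1/2 + 2 * (δ/2)) * Real.log v) = v ^ (1/2 + δ) := by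
      rw [Real.rpow_def_of_pos hv0]; congr 1; ring
    rw [e] at a
    have b := Chebyshev.abs_psi_sub_theta_le_sqrt_mul_log hv
    have c : Real.log v ≤ v ^ δ / δ := Real.log_le_rpow_div hv0.le hδ
    have d : 2 * √v * Real.log v ≤ 2 / δ * v ^ (1/2 + δ) := by
      rw [Real.rpow_add hv0, ← Real.sqrt_eq_rpow]
      calc _ ≤ 2 * √v * (v ^ δ / δ) := by gcongr
        _ = _ := by ring
    have : Chebyshev.theta v - v = (Chebyshev.psi v - v) - (Chebyshev.psi v - Chebyshev.theta v) := by ring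
    rw [this]
    refine (abs_sub _ _).trans ?_
    nlinarith
  · have a := Chebyshev.theta_le_log4_mul_x hv0.le
    have b := Chebyshev.theta_nonneg v
    have c : Real.log 4 ≤ 3 := by have := Real.log_le_sub_one_of_pos (x := 4) (by norm_num); linarith
    have d : 0 < 2 / δ := by positivity
    rw [abs_le]; constructor <;> nlinarith
end

section
open Real Filter Topology MeasureTheory Set

lemma st9_exp_taylor2 (w : ℂ) : ‖Complex.exp w - 1 - w‖ ≤ ‖w‖^2 * max 1 (Real.exp w.re) := by
  -- via integral-free argument: use convexity bound on derivative
  have h1 : ∀ z : ℂ, ∀ R : ℝ, 1 ≤ R → z.re ≤ Real.log R → ‖Complex.exp z - 1‖ ≤ R * ‖z‖ := by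
    intro z R hR hz
    have hs : Convex ℝ {x : ℂ | x.re ≤ Real.log R} := convex_halfSpace_re_le _
    have := hs.norm_image_sub_le_of_norm_hasDerivWithin_le (f := Complex.exp) (f' := Complex.exp) (C := R)
      (fun x _ => (Complex.hasDerivAt_exp x).hasDerivWithinAt) (fun x hx => ?_) (x := 0) (y := z) (by simpa using Real.log_nonneg hR) hz
    · simpa using this
    · rw [Complex.norm_exp]
      calc Real.exp x.re ≤ Real.exp (Real.log R) := Real.exp_le_exp.2 hx
        _ = R := Real.exp_log (by linarith)
  set R := max 1 (Real.exp w.re) with hR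
  have hR1 : 1 ≤ R := le_max_left _ _
  have hwR : w.re ≤ Real.log R := by
    rw [Real.le_log_iff_exp_le (by linarith)]; exact le_max_right _ _
  have hseg : Convex ℝ ({x : ℂ | x.re ≤ Real.log R} ∩ Metric.closedBall 0 ‖w‖) :=
    (convex_halfSpace_re_le _).inter (convex_closedBall _ _)
  have := hseg.norm_image_sub_le_of_norm_hasDerivWithin_le (f := fun z => Complex.exp z - 1 - z)
      (f' := fun z => Complex.exp z - 1) (C := R * ‖w‖)
      (fun x _ => (((Complex.hasDerivAt_exp x).sub_const 1).sub (hasDerivAt_id x)).hasDerivWithinAt) (fun x hx => ?_) (x := 0) (y := w)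
      ⟨by simpa using Real.log_nonneg hR1, by simp⟩ ⟨hwR, by simp⟩
  · simp only [Complex.exp_zero, sub_self, sub_zero] at this
    calc _ ≤ _ := this
      _ = _ := by ring
  · refine (h1 x R hR1 hx.1).trans ?_
    have : ‖x‖ ≤ ‖w‖ := by simpa using hx.2
    gcongr

lemma st9_pow_exp (k : ℕ) {c x : ℝ} (hc : 0 < c) (hx : 0 ≤ x) :
    x ^ k * Real.exp (-(c * x)) ≤ ((2 / c) ^ k * k.factorial) * Real.exp (-(c / 2 * x)) := by
  have h := Real.pow_div_factorial_le_exp (c / 2 * x) (by positivity) k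
  have h2 : Real.exp (-(c * x)) = Real.exp (-(c / 2 * x)) * Real.exp (-(c / 2 * x)) := by
    rw [← Real.exp_add]; congr 1; ring
  have h3 : Real.exp (-(c / 2 * x)) * Real.exp (c / 2 * x) = 1 := by rw [← Real.exp_add]; simp
  have h4 : x ^ k ≤ ((2 / c) ^ k * k.factorial) * Real.exp (c / 2 * x) := by
    rw [div_le_iff₀ (by positivity), mul_pow] at h
    calc x ^ k = (2 / c)^k * ((c/2)^k * x^k) := by
          rw [← mul_assoc, ← mul_pow, show 2 / c * (c / 2) = 1 by field_simp, one_pow, one_mul]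
      _ ≤ (2 / c)^k * (Real.exp (c/2*x) * k.factorial) := by gcongr
      _ = _ := by ring
  calc _ ≤ ((2 / c) ^ k * k.factorial) * Real.exp (c / 2 * x) * Real.exp (-(c * x)) := by gcongr
    _ = ((2 / c) ^ k * k.factorial) * Real.exp (-(c / 2 * x)) * (Real.exp (-(c / 2 * x)) * Real.exp (c / 2 * x)) := by rw [h2]; ring
    _ = _ := by rw [h3]; ring

lemma st9_central_pt {C c : ℝ} (hC : 1 ≤ C) (hc : 0 < c) (hc2 : c ≤ 1/2) :
    ∃ C' : ℝ, 0 < C' ∧ ∀ (a h b d τ : ℝ) (Φ m : ℂ), 1 ≤ a → 0 ≤ h → |b| ≤ C * a → |d| ≤ C → |τ| ≤ 1 →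
      ‖Φ + (a * τ^2/2 : ℝ) - Complex.I * (b * τ^3 : ℝ)‖ ≤ C * a * τ^4 → Φ.re ≤ -(c * (a * τ^2)) →
      ‖m - 1 - Complex.I * (d * τ : ℝ)‖ ≤ C * (τ^2 + h) →
      ‖Complex.exp Φ * m - Real.exp (-(a * τ^2/2)) * (1 + Complex.I * (b * τ^3 + d * τ : ℝ))‖ ≤ C' * (1/a + h) * Real.exp (-(c / 2 * (a * τ^2))) := by
  set K : ℕ → ℝ := fun k => (2 / c) ^ k * k.factorial with hK
  have hK0 : ∀ k, 0 < K k := fun k => by simp only [hK]; positivity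
  refine ⟨C * (K 1 + 1) + (4 * C^2 * K 3 + C * K 2) * (1 + C) + C^2 * K 2, by have := hK0 1; have := hK0 2; have := hK0 3; positivity, ?_⟩
  intro a h b d τ Φ m ha hh hb hd hτ h1 h2 h3
  set x := a * τ^2 with hx
  have hx0 : 0 ≤ x := by positivity
  set E := Real.exp (-(c * x)) with hE
  set E2 := Real.exp (-(c / 2 * x)) with hE2
  have hp : ∀ k, x ^ k * E ≤ K k * E2 := fun k => st9_pow_exp k hc hx0
  have ht2 : τ^2 ≤ 1 := by rw [sq_le_one_iff_abs_le_one]; exact hτ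
  have hE0 : 0 < E := Real.exp_pos _
  have hE20 : 0 < E2 := Real.exp_pos _
  have hEE2 : E ≤ E2 := Real.exp_le_exp.2 (by nlinarith)
  have hg : Real.exp (-(x/2)) ≤ E := Real.exp_le_exp.2 (by nlinarith)
  set w := Φ + (x/2 : ℝ) with hw
  have hnb : ‖Complex.I * (b * τ^3 : ℝ)‖ ≤ C * a * |τ|^3 := by
    rw [norm_mul, Complex.norm_I, Complex.norm_real, Real.norm_eq_abs, abs_mul, abs_pow, one_mul]
    gcongr
  have hnd : ‖Complex.I * (d * τ : ℝ)‖ ≤ C * |τ| := by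
    rw [norm_mul, Complex.norm_I, Complex.norm_real, Real.norm_eq_abs, abs_mul, one_mul]
    gcongr
  have habs4 : τ^4 ≤ |τ|^3 := by
    have : τ^4 = |τ|^3 * |τ| := by rw [← pow_succ]; exact (Even.pow_abs (by decide) τ).symm
    rw [this]; nlinarith [pow_nonneg (abs_nonneg τ) 3]
  have hwn : ‖w‖ ≤ 2 * C * a * |τ|^3 := by
    have e : w = (w - Complex.I * (b * τ^3 : ℝ)) + Complex.I * (b * τ^3 : ℝ) := by ring
    rw [e]
    refine (norm_add_le _ _).trans ?_
    have : C * a * τ^4 ≤ C * a * |τ|^3 := by gcongr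
    linarith
  have hw2 : ‖w‖^2 ≤ 4 * C^2 * (x^3 / a) := by
    have : (2 * C * a * |τ|^3)^2 = 4 * C^2 * (x^3 / a) := by
      have : (|τ|^3)^2 = (τ^2)^3 := by rw [← sq_abs τ]; ring
      rw [mul_pow, this, hx]; field_simp; ring
    rw [← this]; gcongr
  have hT := st9_exp_taylor2 w
  have heΦ : Complex.exp Φ = Real.exp (-(x/2)) * Complex.exp w := by
    rw [Complex.ofReal_exp, ← Complex.exp_add, hw]; congr 1; push_cast; ring
  have hmax : Real.exp (-(x/2)) * max 1 (Real.exp w.re) ≤ E := by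
    rw [mul_max_of_nonneg _ _ (Real.exp_pos _).le, mul_one, ← Real.exp_add]
    refine max_le hg (Real.exp_le_exp.2 ?_)
    have : w.re = Φ.re + x/2 := by simp [hw]
    rw [this]; linarith
  have hA : ‖Complex.exp Φ - Real.exp (-(x/2)) * (1 + Complex.I * (b * τ^3 : ℝ))‖ ≤ (4 * C^2 * K 3 + C * K 2) / a * E2 := by
    have e : Complex.exp Φ - Real.exp (-(x/2)) * (1 + Complex.I * (b * τ^3 : ℝ)) =
        Real.exp (-(x/2)) * (Complex.exp w - 1 - w) + Real.exp (-(x/2)) * (w - Complex.I * (b * τ^3 : ℝ)) := by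
      rw [heΦ]; ring
    rw [e]
    refine (norm_add_le _ _).trans ?_
    rw [norm_mul, norm_mul, Complex.norm_real, Real.norm_eq_abs, abs_of_pos (Real.exp_pos _)]
    have t1 : Real.exp (-(x/2)) * ‖Complex.exp w - 1 - w‖ ≤ 4 * C^2 * K 3 / a * E2 := by
      calc _ ≤ Real.exp (-(x/2)) * (‖w‖^2 * max 1 (Real.exp w.re)) := by gcongr
        _ = ‖w‖^2 * (Real.exp (-(x/2)) * max 1 (Real.exp w.re)) := by ring
        _ ≤ 4 * C^2 * (x^3 / a) * E := by gcongr
        _ = 4 * C^2 / a * (x^3 * E) := by ring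
        _ ≤ 4 * C^2 / a * (K 3 * E2) := mul_le_mul_of_nonneg_left (hp 3) (by positivity)
        _ = _ := by ring
    have t2 : Real.exp (-(x/2)) * ‖w - Complex.I * (b * τ^3 : ℝ)‖ ≤ C * K 2 / a * E2 := by
      calc _ ≤ E * (C * a * τ^4) := by gcongr
        _ = C / a * (x^2 * E) := by rw [hx]; field_simp
        _ ≤ C / a * (K 2 * E2) := mul_le_mul_of_nonneg_left (hp 2) (by positivity)
        _ = _ := by ring
    calc _ ≤ _ := add_le_add t1 t2
      _ = _ := by ring
  have e : Complex.exp Φ * m - Real.exp (-(x/2)) * (1 + Complex.I * (b * τ^3 + d * τ : ℝ)) =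
      Complex.exp Φ * (m - 1 - Complex.I * (d * τ : ℝ))
      + (Complex.exp Φ - Real.exp (-(x/2)) * (1 + Complex.I * (b * τ^3 : ℝ))) * (1 + Complex.I * (d * τ : ℝ))
      + Real.exp (-(x/2)) * (Complex.I * (b * τ^3 : ℝ) * (Complex.I * (d * τ : ℝ))) := by push_cast; ring
  rw [e]
  have s1 : ‖Complex.exp Φ * (m - 1 - Complex.I * (d * τ : ℝ))‖ ≤ C * (K 1 + 1) * (1/a + h) * E2 := by
    rw [norm_mul, Complex.norm_exp]
    have hb0 : Real.exp Φ.re ≤ E := Real.exp_le_exp.2 h2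
    have k1 : τ^2 * E ≤ K 1 * (1/a) * E2 := by
      have := hp 1
      rw [pow_one] at this
      have h5 : τ^2 * E = (1/a) * (x * E) := by rw [hx]; field_simp
      rw [h5]
      calc _ ≤ 1/a * (K 1 * E2) := by gcongr
        _ = _ := by ring
    have k2 : h * E ≤ h * E2 := by gcongr
    have := hK0 1
    have hp1 : 0 ≤ K 1 * h * E2 := by positivity
    have hp2 : 0 ≤ 1/a * E2 := by positivity
    calc _ ≤ E * (C * (τ^2 + h)) := by gcongr
      _ = C * (τ^2 * E + h * E) := by ring
      _ ≤ C * (K 1 * (1/a) * E2 + h * E2) := by gcongr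
      _ ≤ C * ((K 1 + 1) * (1/a + h) * E2) := by gcongr; nlinarith
      _ = _ := by ring
  have s2 : ‖(Complex.exp Φ - Real.exp (-(x/2)) * (1 + Complex.I * (b * τ^3 : ℝ))) * (1 + Complex.I * (d * τ : ℝ))‖ ≤
      (4 * C^2 * K 3 + C * K 2) * (1 + C) * (1/a) * E2 := by
    rw [norm_mul]
    have : ‖1 + Complex.I * (d * τ : ℝ)‖ ≤ 1 + C := by
      refine (norm_add_le _ _).trans ?_
      rw [norm_one]
      nlinarith
    calc _ ≤ ((4 * C^2 * K 3 + C * K 2) / a * E2) * (1 + C) := by gcongr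
      _ = _ := by ring
  have s3 : ‖Real.exp (-(x/2)) * (Complex.I * (b * τ^3 : ℝ) * (Complex.I * (d * τ : ℝ)))‖ ≤ C^2 * K 2 * (1/a) * E2 := by
    rw [norm_mul, norm_mul, Complex.norm_real, Real.norm_eq_abs, abs_of_pos (Real.exp_pos _)]
    have h4 : |τ|^3 * |τ| = (τ^2)^2 := by rw [← sq_abs τ]; ring
    calc _ ≤ E * ((C * a * |τ|^3) * (C * |τ|)) := by gcongr
      _ = E * (C^2 * a * (|τ|^3 * |τ|)) := by ring
      _ = C^2 / a * (x^2 * E) := by rw [h4, hx]; field_simp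
      _ ≤ C^2 / a * (K 2 * E2) := mul_le_mul_of_nonneg_left (hp 2) (by positivity)
      _ = _ := by ring
  refine (norm_add_le _ _).trans ?_
  refine (add_le_add_left (norm_add_le _ _) _).trans ?_
  have p2 : (4 * C^2 * K 3 + C * K 2) * (1 + C) * (1/a) * E2 ≤ (4 * C^2 * K 3 + C * K 2) * (1 + C) * (1/a + h) * E2 := by
    have := hK0 3; have := hK0 2
    gcongr; linarith
  have p3 : C^2 * K 2 * (1/a) * E2 ≤ C^2 * K 2 * (1/a + h) * E2 := by
    have := hK0 2
    gcongr; linarith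
  calc _ ≤ _ := add_le_add (add_le_add s1 (s2.trans p2)) (s3.trans p3)
    _ = _ := by ring

lemma st9_central {C c : ℝ} (hC : 1 ≤ C) (hc : 0 < c) (hc2 : c ≤ 1/2) :
    ∃ C' : ℝ, 0 < C' ∧ ∀ (a h b d : ℝ) (Φ m : ℝ → ℂ), 1 ≤ a → 0 ≤ h → |b| ≤ C * a → |d| ≤ C →
      ContinuousOn (fun τ => Complex.exp (Φ τ) * m τ) (Icc (-1) 1) →
      (∀ τ : ℝ, |τ| ≤ 1 → ‖Φ τ + (a * τ^2/2 : ℝ) - Complex.I * (b * τ^3 : ℝ)‖ ≤ C * a * τ^4) →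
      (∀ τ : ℝ, |τ| ≤ 1 → (Φ τ).re ≤ -(c * (a * τ^2))) →
      (∀ τ : ℝ, |τ| ≤ 1 → ‖m τ - 1 - Complex.I * (d * τ : ℝ)‖ ≤ C * (τ^2 + h)) →
      ‖(∫ τ in (-1:ℝ)..1, Complex.exp (Φ τ) * m τ) - (√(2 * π / a) : ℝ)‖ ≤ C' * (1/a + h) * √(2 * π / a) := by
  obtain ⟨C1, hC1, hpt⟩ := st9_central_pt hC hc hc2
  refine ⟨(C1 + 4) * √(1/c), by positivity, ?_⟩
  intro a h b d Φ m ha hh hb hd hcont h1 h2 h3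
  set G : ℝ → ℂ := fun τ => Real.exp (-(a * τ^2/2)) * (1 + Complex.I * (b * τ^3 + d * τ : ℝ)) with hG
  have hGi : IntervalIntegrable G volume (-1) 1 := by
    refine Continuous.intervalIntegrable ?_ _ _
    simp only [hG]; fun_prop
  have hFi : IntervalIntegrable (fun τ => Complex.exp (Φ τ) * m τ) volume (-1) 1 := by
    refine ContinuousOn.intervalIntegrable ?_
    rwa [uIcc_of_le (by norm_num)]
  -- gaussian integral facts
  have ga : ∀ β : ℝ, 0 < β → Integrable (fun τ : ℝ => Real.exp (-(β * τ^2))) ∧ ∫ τ : ℝ, Real.exp (-(β * τ^2)) = √(π / β) := by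
    intro β hβ
    have e1 := integrable_exp_neg_mul_sq hβ
    have e2 := integral_gaussian β
    simp only [neg_mul] at e1 e2
    exact ⟨e1, e2⟩
  have hβ : 0 < c / 2 * a := by positivity
  have hβs : √(π / (c/2 * a)) = √(1/c) * √(2 * π / a) := by
    rw [← Real.sqrt_mul (by positivity)]; congr 1; field_simp
  have hdiff : ‖∫ τ in (-1:ℝ)..1, (Complex.exp (Φ τ) * m τ - G τ)‖ ≤ C1 * (1/a + h) * (√(1/c) * √(2 * π / a)) := by
    calc _ ≤ ∫ τ in (-1:ℝ)..1, C1 * (1/a + h) * Real.exp (-(c/2 * a * τ^2)) := by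
          refine intervalIntegral.norm_integral_le_of_norm_le (by norm_num) (Eventually.of_forall fun τ hτ => ?_) ?_
          · have ht : |τ| ≤ 1 := abs_le.2 ⟨hτ.1.le, hτ.2⟩
            have := hpt a h b d τ (Φ τ) (m τ) ha hh hb hd ht (h1 τ ht) (h2 τ ht) (h3 τ ht)
            rw [← mul_assoc] at this
            exact this
          · exact Continuous.intervalIntegrable (by fun_prop) _ _
      _ = C1 * (1/a + h) * ∫ τ in (-1:ℝ)..1, Real.exp (-(c/2 * a * τ^2)) := by
          rw [intervalIntegral.integral_const_mul]
      _ ≤ C1 * (1/a + h) * ∫ τ : ℝ, Real.exp (-(c/2 * a * τ^2)) := by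
          gcongr
          rw [intervalIntegral.integral_of_le (by norm_num)]
          exact setIntegral_le_integral (ga _ hβ).1 (Eventually.of_forall fun τ => (Real.exp_pos _).le)
      _ = _ := by rw [(ga _ hβ).2, hβs]
  have hGint : ∫ τ in (-1:ℝ)..1, G τ = ((∫ τ in (-1:ℝ)..1, Real.exp (-(a * τ^2/2)) : ℝ) : ℂ) := by
    have e : ∀ τ, G τ = ((Real.exp (-(a * τ^2/2)) : ℝ) : ℂ) + Complex.I * ((Real.exp (-(a * τ^2/2)) * (b * τ^3 + d * τ) : ℝ) : ℂ) := by
      intro τ; simp only [hG]; push_cast; ring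
    simp_rw [e]
    rw [intervalIntegral.integral_add, intervalIntegral.integral_const_mul, intervalIntegral.integral_ofReal, intervalIntegral.integral_ofReal]
    · have hodd : ∫ τ in (-1:ℝ)..1, Real.exp (-(a * τ^2/2)) * (b * τ^3 + d * τ) = 0 := by
        have := intervalIntegral.integral_comp_neg (fun τ : ℝ => Real.exp (-(a * τ^2/2)) * (b * τ^3 + d * τ)) (a := -1) (b := 1)
        have e2 : ∀ τ : ℝ, Real.exp (-(a * (-τ)^2/2)) * (b * (-τ)^3 + d * (-τ)) = -(Real.exp (-(a * τ^2/2)) * (b * τ^3 + d * τ)) := by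
          intro τ; rw [neg_sq]; ring
        simp_rw [e2] at this
        rw [intervalIntegral.integral_neg] at this
        simp only [neg_neg] at this
        linarith
      rw [hodd]; simp
    · exact Continuous.intervalIntegrable (by fun_prop) _ _
    · exact Continuous.intervalIntegrable (by fun_prop) _ _
  have htail : |(∫ τ in (-1:ℝ)..1, Real.exp (-(a * τ^2/2))) - √(2 * π / a)| ≤ 4 * (1/a + h) * (√(1/c) * √(2 * π / a)) := by
    have hb2 : 0 < a / 2 := by positivity
    have e1 : ∀ τ : ℝ, Real.exp (-(a * τ^2/2)) = Real.exp (-(a/2 * τ^2)) := by intro τ; congr 1; ring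
    simp_rw [e1]
    have e2 : √(2 * π / a) = ∫ τ : ℝ, Real.exp (-(a/2 * τ^2)) := by
      rw [(ga _ hb2).2]; congr 1; field_simp
    have e3 : (∫ τ in (-1:ℝ)..1, Real.exp (-(a/2 * τ^2))) - √(2 * π / a) = -∫ τ in (Ioc (-1:ℝ) 1)ᶜ, Real.exp (-(a/2 * τ^2)) := by
      rw [e2, intervalIntegral.integral_of_le (by norm_num), ← integral_add_compl (measurableSet_Ioc (a := (-1:ℝ)) (b := 1)) (ga _ hb2).1]; ring
    rw [e3, abs_neg, abs_of_nonneg (integral_nonneg fun τ => (Real.exp_pos _).le)]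
    have hb4 : 0 < c/2 * a := by positivity
    have hc4 : 4 * (1/a) * Real.exp (0) ≥ 0 := by positivity
    calc _ ≤ ∫ τ in (Ioc (-1:ℝ) 1)ᶜ, 4 * (1/a) * Real.exp (-(c/2 * a * τ^2)) := by
          refine setIntegral_mono_on (ga _ hb2).1.integrableOn (((ga _ hb4).1.const_mul _).integrableOn) measurableSet_Ioc.compl fun τ hτ => ?_
          have ht : 1 ≤ τ^2 := by
            rw [mem_compl_iff, mem_Ioc, not_and_or, not_lt, not_le] at hτ
            rcases hτ with h | h <;> nlinarith
          have hx : 0 ≤ a * τ^2 := by positivity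
          have := st9_pow_exp 1 (c := 1/2) (x := a * τ^2) (by norm_num) hx
          simp only [pow_one, Nat.factorial_one, Nat.cast_one, mul_one] at this
          have h6 : Real.exp (-(1/2/2 * (a * τ^2))) ≤ Real.exp (-(c/2*a*τ^2)) := Real.exp_le_exp.2 (by nlinarith)
          have h7 : Real.exp (-(a/2*τ^2)) = Real.exp (-(1/2 * (a * τ^2))) := by congr 1; ring
          rw [h7, show 4 * (1/a) * Real.exp (-(c/2*a*τ^2)) = 4 * Real.exp (-(c/2*a*τ^2)) / a by ring]
          rw [le_div_iff₀ (by linarith)]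
          have h8 : Real.exp (-(1/2 * (a * τ^2))) * a ≤ a * τ^2 * Real.exp (-(1/2 * (a * τ^2))) := by
            have := Real.exp_pos (-(1/2 * (a * τ^2)))
            have h9 : 0 ≤ a * (τ^2 - 1) := mul_nonneg (by linarith) (by linarith)
            nlinarith
          rw [show (2:ℝ) / (1/2) = 4 by norm_num] at this
          linarith
      _ ≤ ∫ τ : ℝ, 4 * (1/a) * Real.exp (-(c/2 * a * τ^2)) :=
          setIntegral_le_integral ((ga _ hb4).1.const_mul _) (Eventually.of_forall fun τ => by positivity)
      _ = 4 * (1/a) * (√(1/c) * √(2 * π / a)) := by rw [integral_const_mul, (ga _ hb4).2, hβs]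
      _ ≤ _ := by gcongr; linarith
  have efin : (∫ τ in (-1:ℝ)..1, Complex.exp (Φ τ) * m τ) - (√(2 * π / a) : ℝ) =
      (∫ τ in (-1:ℝ)..1, (Complex.exp (Φ τ) * m τ - G τ)) + (((∫ τ in (-1:ℝ)..1, Real.exp (-(a * τ^2/2))) - √(2 * π / a) : ℝ) : ℂ) := by
    rw [intervalIntegral.integral_sub hFi hGi, hGint]; push_cast; ring
  rw [efin]
  refine (norm_add_le _ _).trans ?_
  rw [Complex.norm_real, Real.norm_eq_abs]
  calc _ ≤ _ := add_le_add hdiff htail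
    _ = _ := by ring
end

section
open Real Filter Topology MeasureTheory Set

structure st9_Dk (ρ : ℝ → ℝ) : Prop where
  cont : ContinuousOn ρ (Set.Ici 0)
  one : ∀ t ∈ Set.Icc (0 : ℝ) 1, ρ t = 1
  eq : ∀ t ≥ (1 : ℝ), ρ t = 1 - ∫ v in (1 : ℝ)..t, ρ (v - 1) / v

lemma st9_q_cont {ρ : ℝ → ℝ} (h : st9_Dk ρ) : Continuous fun v => ρ (max v 0) := by
  have : ContinuousOn (fun v : ℝ => ρ (max v 0)) univ :=
    h.cont.comp (Continuous.continuousOn (by fun_prop)) (fun v _ => mem_Ici.2 (le_max_right _ _))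
  exact continuousOn_univ.1 this

lemma st9_g_cont {ρ : ℝ → ℝ} (h : st9_Dk ρ) : Continuous fun v => ρ (max (v-1) 0) / max v 1 := by
  refine ((st9_q_cont h).comp (continuous_id.sub continuous_const)).div (by fun_prop) ?_
  intro x; have := le_max_right x 1; linarith

lemma st9_q_eq {ρ : ℝ → ℝ} (h : st9_Dk ρ) {t : ℝ} (ht : 1 ≤ t) :
    ρ t = 1 - ∫ v in (1:ℝ)..t, ρ (max (v-1) 0) / max v 1 := by
  rw [h.eq t ht]
  congr 1
  apply intervalIntegral.integral_congr
  intro v hv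
  rw [uIcc_of_le ht] at hv
  simp only
  rw [max_eq_left (by linarith [hv.1]), max_eq_left hv.1]

lemma st9_rho_deriv {ρ : ℝ → ℝ} (h : st9_Dk ρ) {t : ℝ} (ht : 1 < t) :
    HasDerivAt ρ (-(ρ (t-1)/t)) t := by
  have h1 := ((st9_g_cont h).integral_hasStrictDerivAt 1 t).hasDerivAt.const_sub 1
  rw [max_eq_left (by linarith), max_eq_left ht.le] at h1
  refine h1.congr_of_eventuallyEq ?_
  filter_upwards [lt_mem_nhds ht] with s hs using st9_q_eq h hs.le

lemma st9_rho_derivW {ρ : ℝ → ℝ} (h : st9_Dk ρ) {t : ℝ} (ht : 1 ≤ t) :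
    HasDerivWithinAt (fun v => ρ (max v 0)) (-(ρ (t-1)/t)) (Ici t) t := by
  have h1 := ((st9_g_cont h).integral_hasStrictDerivAt 1 t).hasDerivAt.const_sub 1
  rw [max_eq_left (by linarith), max_eq_left ht] at h1
  refine h1.hasDerivWithinAt.congr ?_ ?_
  · intro s hs
    rw [max_eq_left (by linarith [hs.out]), st9_q_eq h (ht.trans hs)]
  · rw [max_eq_left (by linarith), st9_q_eq h ht]

lemma st9_rho_conv {ρ : ℝ → ℝ} (h : st9_Dk ρ) {t : ℝ} (ht : 1 ≤ t) :
    t * ρ t = ∫ v in (t-1)..t, ρ (max v 0) := by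
  have hq := st9_q_cont h
  have hI : ∀ x : ℝ, HasDerivAt (fun t : ℝ => ∫ v in (t-1)..t, ρ (max v 0)) (ρ (max x 0) - ρ (max (x-1) 0)) x := by
    intro x
    have e : (fun t : ℝ => ∫ v in (t-1)..t, ρ (max v 0)) = fun t => (∫ v in (0:ℝ)..t, ρ (max v 0)) - ∫ v in (0:ℝ)..(t-1), ρ (max v 0) := by
      ext t
      rw [intervalIntegral.integral_interval_sub_left] <;> exact hq.intervalIntegrable _ _
    rw [e]
    refine (hq.integral_hasStrictDerivAt 0 x).hasDerivAt.sub ?_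
    have := (hq.integral_hasStrictDerivAt 0 (x-1)).hasDerivAt.comp x ((hasDerivAt_id x).sub_const 1)
    simp only [mul_one, Function.comp_def, id] at this
    exact this
  have key := constant_of_has_deriv_right_zero (a := 1) (b := t)
    (f := fun t => t * ρ (max t 0) - ∫ v in (t-1)..t, ρ (max v 0)) ?_ ?_ t ⟨ht, le_rfl⟩
  · rw [max_eq_left (by linarith)] at key
    have e : ∫ v in (1-1:ℝ)..1, ρ (max v 0) = 1 := by
      rw [intervalIntegral.integral_congr (g := fun _ => (1:ℝ))]
      · simp
      · intro v hv
        simp at hv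
        simp only
        rw [max_eq_left hv.1, h.one v hv]
    rw [e, max_eq_left (by norm_num), h.one 1 (by norm_num)] at key
    linarith
  · exact ((continuous_id.mul hq).sub (continuous_iff_continuousAt.2 fun x => (hI x).continuousAt)).continuousOn
  · intro x hx
    have h1 := ((hasDerivWithinAt_id x (Ici x)).mul (st9_rho_derivW h hx.1)).sub (hI x).hasDerivWithinAt
    have hx0 : x ≠ 0 := by linarith [hx.1]
    refine h1.congr_deriv ?_
    rw [max_eq_left (a := x) (by linarith [hx.1]), max_eq_left (a := x-1) (by linarith [hx.1])]
    simp; field_simp; ring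

lemma st9_rho_pos {ρ : ℝ → ℝ} (h : st9_Dk ρ) {t : ℝ} (ht : 0 ≤ t) : 0 < ρ t := by
  by_contra hc
  push Not at hc
  have hq := st9_q_cont h
  set S := {v : ℝ | 0 ≤ v ∧ ρ (max v 0) ≤ 0} with hS
  have hcl : IsClosed S := (isClosed_le continuous_const continuous_id).inter (isClosed_le hq continuous_const)
  have hne : S.Nonempty := ⟨t, ht, by rwa [max_eq_left ht]⟩
  have hbd : BddBelow S := ⟨0, fun v hv => hv.1⟩
  obtain ⟨h0, h1⟩ := hcl.csInf_mem hne hbd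
  set z := sInf S with hz
  rw [max_eq_left h0] at h1
  have hz1 : 1 < z := by
    by_contra hc
    rw [h.one z ⟨h0, not_lt.1 hc⟩] at h1; linarith
  have h2 := st9_rho_conv h hz1.le
  have h3 : 0 < ∫ v in (z-1)..z, ρ (max v 0) := by
    refine intervalIntegral.intervalIntegral_pos_of_pos_on (hq.intervalIntegrable _ _) ?_ (by linarith)
    intro v hv
    by_contra hc
    have : z ≤ v := csInf_le hbd ⟨by linarith [hv.1], not_lt.1 hc⟩
    linarith [hv.2]
  nlinarith

lemma st9_rho_anti {ρ : ℝ → ℝ} (h : st9_Dk ρ) {s t : ℝ} (hs : 0 ≤ s) (hst : s ≤ t) : ρ t ≤ ρ s := by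
  have h1 : AntitoneOn ρ (Ici 1) := by
    refine antitoneOn_of_deriv_nonpos (convex_Ici 1) (h.cont.mono (Ici_subset_Ici.2 zero_le_one)) ?_ ?_
    · intro x hx
      rw [interior_Ici] at hx
      exact (st9_rho_deriv h hx).differentiableAt.differentiableWithinAt
    · intro x hx
      rw [interior_Ici] at hx
      rw [(st9_rho_deriv h hx).deriv]
      have hx : 1 < x := hx
      have := st9_rho_pos h (t := x - 1) (by linarith)
      have : 0 ≤ ρ (x-1)/x := by positivity
      linarith
  rcases le_total t 1 with h2 | h2
  · rw [h.one t ⟨by linarith, h2⟩, h.one s ⟨hs, by linarith⟩]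
  · rcases le_total s 1 with h3 | h3
    · rw [h.one s ⟨hs, h3⟩, ← h.one 1 (by norm_num)]
      exact h1 self_mem_Ici h2 h2
    · exact h1 h3 h2 hst

lemma st9_rho_le_one {ρ : ℝ → ℝ} (h : st9_Dk ρ) {t : ℝ} (ht : 0 ≤ t) : ρ t ≤ 1 := by
  rw [← h.one 0 (by norm_num)]; exact st9_rho_anti h le_rfl ht

lemma st9_rho_decay {ρ : ℝ → ℝ} (h : st9_Dk ρ) {A : ℝ} (hA : 0 ≤ A) :
    ∃ C : ℝ, 0 < C ∧ ∀ t, 0 ≤ t → ρ t ≤ C * exp (-(A*t)) := by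
  set K := exp A with hK
  have hK1 : 1 ≤ K := Real.one_le_exp hA
  refine ⟨exp (A*K), exp_pos _, ?_⟩
  have key : ∀ n : ℕ, ∀ t, 0 ≤ t → t ≤ K + n → ρ t ≤ exp (A*K) * exp (-(A*t)) := by
    intro n
    induction n with
    | zero =>
      intro t ht htK
      rw [← Real.exp_add]
      refine (st9_rho_le_one h ht).trans (Real.one_le_exp ?_)
      simp at htK
      nlinarith
    | succ n ih =>
      intro t ht htK
      rcases le_total t K with h1 | h1
      · rw [← Real.exp_add]
        exact (st9_rho_le_one h ht).trans (Real.one_le_exp (by nlinarith))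
      have ht1 : 1 ≤ t := hK1.trans h1
      have h2 := ih (t-1) (by linarith) (by push_cast at htK; linarith)
      have h3 : t * ρ t ≤ ρ (t-1) := by
        rw [st9_rho_conv h ht1]
        calc ∫ v in (t-1)..t, ρ (max v 0) ≤ ∫ v in (t-1)..t, ρ (t-1) := by
              refine intervalIntegral.integral_mono_on (by linarith) ((st9_q_cont h).intervalIntegrable _ _) (by simp) ?_
              intro v hv
              exact st9_rho_anti h (by linarith) (le_max_of_le_left hv.1)
          _ = ρ (t-1) := by simp
      have h4 : K * ρ t ≤ t * ρ t := mul_le_mul_of_nonneg_right h1 (st9_rho_pos h ht).le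
      have h5 : exp (-(A*(t-1))) = K * exp (-(A*t)) := by rw [hK, ← Real.exp_add]; congr 1; ring
      rw [h5] at h2
      have : K * ρ t ≤ K * (exp (A*K) * exp (-(A*t))) := by linarith
      exact le_of_mul_le_mul_left this (exp_pos _)
  intro t ht
  obtain ⟨n, hn⟩ := exists_nat_ge (t - K)
  exact key n t ht (by linarith)
end

section
open Real Filter Topology MeasureTheory Set

noncomputable def st9_M (ρ : ℝ → ℝ) (s : ℂ) : ℂ := ∫ v in Ioi (0:ℝ), (ρ v : ℂ) * Complex.exp (-(s * v))
noncomputable def st9_k (s : ℂ) : ℂ := ∫ w in (0:ℝ)..1, Complex.exp (-(s * w))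

lemma st9_rho_meas {ρ : ℝ → ℝ} (h : st9_Dk ρ) : AEStronglyMeasurable (fun v => (ρ v : ℂ)) (volume.restrict (Ioi 0)) :=
  Complex.continuous_ofReal.comp_aestronglyMeasurable
    ((h.cont.mono Ioi_subset_Ici_self).aestronglyMeasurable measurableSet_Ioi)

lemma st9_norm_exp_le (s : ℂ) {A v : ℝ} (hA : |s.re| ≤ A) (hv : 0 ≤ v) : ‖Complex.exp (-(s*v))‖ ≤ exp (A*v) := by
  rw [Complex.norm_exp]
  apply Real.exp_le_exp.2
  simp
  nlinarith [neg_abs_le s.re, mul_le_mul_of_nonneg_right hA hv, mul_le_mul_of_nonneg_right (neg_abs_le s.re) hv]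

lemma st9_rho_dom {ρ : ℝ → ℝ} (h : st9_Dk ρ) (A : ℝ) : IntegrableOn (fun v => (1+v) * ρ v * exp (A*v)) (Ioi 0) := by
  obtain ⟨C, hC, hb⟩ := st9_rho_decay h (A := |A|+2) (by positivity)
  have h1 : IntegrableOn (fun v : ℝ => C * exp (-1 * v)) (Ioi 0) := (exp_neg_integrableOn_Ioi 0 one_pos).const_mul C
  refine Integrable.mono' h1 ?_ ?_
  · refine ContinuousOn.aestronglyMeasurable ?_ measurableSet_Ioi
    exact (((continuous_const.add continuous_id).continuousOn).mul (h.cont.mono Ioi_subset_Ici_self)).mul (Continuous.continuousOn (by fun_prop))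
  · filter_upwards [ae_restrict_mem measurableSet_Ioi] with v hv
    have hv : 0 < v := hv
    have hp := st9_rho_pos h hv.le
    rw [Real.norm_of_nonneg (by positivity)]
    have e1 : 1 + v ≤ exp v := by linarith [Real.add_one_le_exp v]
    calc (1+v) * ρ v * exp (A*v) ≤ exp v * (C * exp (-((|A|+2)*v))) * exp (|A| * v) := by
          gcongr
          · exact hb v hv.le
          · exact le_abs_self A
      _ = C * (exp v * exp (-((|A|+2)*v)) * exp (|A| * v)) := by ring
      _ = C * exp (-1*v) := by rw [← Real.exp_add, ← Real.exp_add]; congr 2; ring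

lemma st9_M_int {ρ : ℝ → ℝ} (h : st9_Dk ρ) (s : ℂ) : IntegrableOn (fun v : ℝ => (ρ v : ℂ) * Complex.exp (-(s * v))) (Ioi 0) := by
  refine Integrable.mono' (st9_rho_dom h |s.re|) ((st9_rho_meas h).mul (Continuous.aestronglyMeasurable (by fun_prop))) ?_
  filter_upwards [ae_restrict_mem measurableSet_Ioi] with v hv
  have hv : 0 < v := hv
  have hp := st9_rho_pos h hv.le
  rw [norm_mul, Complex.norm_real, Real.norm_of_nonneg hp.le]
  have := st9_norm_exp_le s le_rfl hv.le
  calc _ ≤ 1 * ρ v * exp (|s.re| * v) := by rw [one_mul]; gcongr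
    _ ≤ _ := by gcongr; linarith

lemma st9_M_deriv0 {ρ : ℝ → ℝ} (h : st9_Dk ρ) (s : ℂ) :
    HasDerivAt (st9_M ρ) (∫ v in Ioi (0:ℝ), (ρ v : ℂ) * (Complex.exp (-(s * v)) * (-v))) s := by
  refine (hasDerivAt_integral_of_dominated_loc_of_deriv_le (μ := volume.restrict (Ioi 0)) (s := Metric.ball s 1)
    (F' := fun s v => (ρ v : ℂ) * (Complex.exp (-(s * v)) * (-v)))
    (F := fun s v => (ρ v : ℂ) * Complex.exp (-(s * v)))
    (bound := fun v => (1+v) * ρ v * exp ((|s.re|+1)*v)) (Metric.ball_mem_nhds s one_pos) ?_ (st9_M_int h s) ?_ ?_ (st9_rho_dom h _) ?_).2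
  · exact Eventually.of_forall fun z => (st9_rho_meas h).mul (Continuous.aestronglyMeasurable (by fun_prop))
  · exact (st9_rho_meas h).mul (Continuous.aestronglyMeasurable (by fun_prop))
  · filter_upwards [ae_restrict_mem measurableSet_Ioi] with v hv z hz
    have hv : 0 < v := hv
    have hp := st9_rho_pos h hv.le
    have hz1 : |z.re| ≤ |s.re| + 1 := by
      have h1 : |(z-s).re| ≤ 1 := (Complex.abs_re_le_norm _).trans (by simpa [dist_eq_norm] using (Metric.mem_ball.1 hz).le)
      have : z.re = s.re + (z-s).re := by simp
      rw [this]; exact (abs_add_le _ _).trans (by linarith)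
    rw [norm_mul, norm_mul, Complex.norm_real, Real.norm_of_nonneg hp.le, norm_neg, Complex.norm_real, Real.norm_of_nonneg hv.le]
    have := st9_norm_exp_le z hz1 hv.le
    calc _ ≤ ρ v * (exp ((|s.re|+1)*v) * (1+v)) := by gcongr; linarith
      _ = _ := by ring
  · refine Eventually.of_forall fun v z _ => ?_
    refine HasDerivAt.const_mul _ ?_
    have := ((hasDerivAt_mul_const (v:ℂ) (x := z)).neg).cexp
    simpa using this

lemma st9_conv_pt {ρ : ℝ → ℝ} (h : st9_Dk ρ) (s : ℂ) (v : ℝ) :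
    (∫ t, (Ioi (0:ℝ)).indicator (fun v : ℝ => (ρ v : ℂ) * Complex.exp (-(s * v))) t *
      (Ioc (0:ℝ) 1).indicator (fun w : ℝ => Complex.exp (-(s * w))) (v - t))
    = (Ioi (0:ℝ)).indicator (fun v : ℝ => (v * ρ v : ℂ) * Complex.exp (-(s * v))) v := by
  have e : ∀ t, (Ioi (0:ℝ)).indicator (fun v : ℝ => (ρ v : ℂ) * Complex.exp (-(s * v))) t *
      (Ioc (0:ℝ) 1).indicator (fun w : ℝ => Complex.exp (-(s * w))) (v - t)
      = (Ioi 0 ∩ Ico (v-1) v).indicator (fun t => (ρ t : ℂ) * Complex.exp (-(s*v))) t := by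
    intro t
    by_cases h1 : 0 < t
    · by_cases h2 : v - 1 ≤ t ∧ t < v
      · rw [indicator_of_mem (mem_Ioi.2 h1), indicator_of_mem (by constructor <;> linarith), indicator_of_mem (by exact ⟨h1, h2⟩), mul_assoc, ← Complex.exp_add]
        congr 2; push_cast; ring
      · rw [indicator_of_notMem (a := v - t) (fun hh => h2 (by constructor <;> linarith [hh.1, hh.2])),
          indicator_of_notMem (a := t) (s := Ioi 0 ∩ Ico (v-1) v) (fun hh => h2 hh.2), mul_zero]
    · rw [indicator_of_notMem (a := t) (s := Ioi 0) (by simpa using h1),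
        indicator_of_notMem (s := Ioi 0 ∩ Ico (v-1) v) (fun hh => h1 hh.1), zero_mul]
  simp_rw [e]
  rw [integral_indicator (measurableSet_Ioi.inter measurableSet_Ico), integral_mul_const]
  by_cases hv : 0 < v
  swap
  · rw [indicator_of_notMem (by simpa using hv)]
    have : Ioi 0 ∩ Ico (v-1) v = ∅ := by
      ext t; simp; intro h1 h2; push Not at hv; linarith
    rw [this]; simp
  rw [indicator_of_mem (mem_Ioi.2 hv)]
  congr 1
  rw [integral_complex_ofReal, ← Complex.ofReal_mul]
  congr 1
  rcases le_or_gt v 1 with h1 | h1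
  · have : Ioi 0 ∩ Ico (v-1) v = Ioo 0 v := by
      ext t; simp; intro h2 _; linarith
    rw [this, ← integral_Ioc_eq_integral_Ioo, setIntegral_congr_fun (g := fun _ => (1:ℝ)) measurableSet_Ioc]
    · simp [h.one v ⟨hv.le, h1⟩, hv.le]
    · intro t ht; exact h.one t ⟨ht.1.le, ht.2.trans h1⟩
  · have : Ioi 0 ∩ Ico (v-1) v = Ico (v-1) v := by
      apply inter_eq_right.2
      intro t ht; have := ht.1; simp; linarith
    rw [this, st9_rho_conv h h1.le, intervalIntegral.integral_of_le (by linarith), integral_Ico_eq_integral_Ioo, integral_Ioc_eq_integral_Ioo]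
    refine setIntegral_congr_fun measurableSet_Ioo fun t ht => ?_
    rw [max_eq_left (by linarith [ht.1])]

lemma st9_M_conv {ρ : ℝ → ℝ} (h : st9_Dk ρ) (s : ℂ) :
    ∫ v in Ioi (0:ℝ), (v * ρ v : ℂ) * Complex.exp (-(s * v)) = st9_M ρ s * st9_k s := by
  have hk : Integrable ((Ioc (0:ℝ) 1).indicator (fun w : ℝ => Complex.exp (-(s * w)))) := by
    rw [integrable_indicator_iff measurableSet_Ioc]
    exact (Continuous.integrableOn_Icc (by fun_prop)).mono_set Ioc_subset_Icc_self
  have hM : Integrable ((Ioi (0:ℝ)).indicator (fun v : ℝ => (ρ v : ℂ) * Complex.exp (-(s * v)))) := by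
    rw [integrable_indicator_iff measurableSet_Ioi]; exact st9_M_int h s
  have := integral_convolution (ContinuousLinearMap.mul ℝ ℂ) (μ := volume) (ν := volume) hM hk
  simp only [convolution_def, ContinuousLinearMap.mul_apply'] at this
  simp_rw [st9_conv_pt h s] at this
  rw [integral_indicator measurableSet_Ioi, integral_indicator measurableSet_Ioi, integral_indicator measurableSet_Ioc, ← intervalIntegral.integral_of_le zero_le_one] at this
  exact this

lemma st9_M_deriv {ρ : ℝ → ℝ} (h : st9_Dk ρ) (s : ℂ) : HasDerivAt (st9_M ρ) (-(st9_M ρ s * st9_k s)) s := by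
  refine (st9_M_deriv0 h s).congr_deriv ?_
  rw [← st9_M_conv h s, ← integral_neg]
  congr 1; ext v; ring

lemma st9_rhoHat_eq (ρ : ℝ → ℝ) (s : ℝ) : st9_M ρ s = (rhoHat ρ s : ℂ) := by
  rw [st9_M, rhoHat, ← integral_complex_ofReal]
  congr 1; ext v; push_cast; ring_nf

lemma st9_k_real (s : ℝ) : st9_k s = ((∫ w in (0:ℝ)..1, exp (-(s*w)) : ℝ) : ℂ) := by
  rw [st9_k, ← intervalIntegral.integral_ofReal]
  congr 1; ext v; push_cast; ring_nf

lemma st9_rhoHat_deriv {ρ : ℝ → ℝ} (h : st9_Dk ρ) (s : ℝ) :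
    HasDerivAt (rhoHat ρ) (-(rhoHat ρ s * ∫ w in (0:ℝ)..1, exp (-(s*w)))) s := by
  have := (st9_M_deriv h s).real_of_complex
  simp only [st9_rhoHat_eq, st9_k_real] at this
  rw [← Complex.ofReal_mul, ← Complex.ofReal_neg] at this
  simpa using this

lemma st9_rhoHat_ge {ρ : ℝ → ℝ} (h : st9_Dk ρ) {s : ℝ} (hs : s ≤ 0) : 1 ≤ rhoHat ρ s := by
  have hi : IntegrableOn (fun v => exp (-s*v) * ρ v) (Ioi 0) := by
    refine ((st9_M_int h s).re).congr (Eventually.of_forall fun v => ?_)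
    have : (ρ v : ℂ) * Complex.exp (-(s * v)) = ((exp (-s*v) * ρ v : ℝ) : ℂ) := by
      push_cast; rw [mul_comm]; ring_nf
    simp only [this]; exact Complex.ofReal_re _
  calc (1:ℝ) = ∫ v in Ioc (0:ℝ) 1, (1:ℝ) := by simp
    _ ≤ ∫ v in Ioc (0:ℝ) 1, exp (-s*v) * ρ v := by
        refine setIntegral_mono_on (by simp) (hi.mono_set Ioc_subset_Ioi_self) measurableSet_Ioc fun v hv => ?_
        rw [h.one v ⟨hv.1.le, hv.2⟩, mul_one]
        exact Real.one_le_exp (by nlinarith [hv.1])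
    _ ≤ _ := by
        refine setIntegral_mono_set hi ?_ Ioc_subset_Ioi_self.eventuallyLE
        filter_upwards [ae_restrict_mem measurableSet_Ioi] with v hv
        exact mul_nonneg (exp_pos _).le (st9_rho_pos h (le_of_lt hv)).le
end

section
open Real Filter Topology MeasureTheory Set

lemma st9_k_cont : Continuous st9_k := by
  unfold st9_k
  exact intervalIntegral.continuous_parametric_intervalIntegral_of_continuous' (by fun_prop) 0 1

lemma st9_k_eq {s : ℂ} (hs : s ≠ 0) : st9_k s = (1 - Complex.exp (-s)) / s := by
  have : ∀ w : ℝ, -(s*(w:ℂ)) = (-s) * w := fun w => by ring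
  simp_rw [st9_k, this]
  rw [integral_exp_mul_complex (neg_ne_zero.2 hs)]
  simp
  field_simp
  ring

lemma st9_line_im {ξ τ : ℝ} (hτ : τ ≠ 0) : (-(ξ:ℂ) + τ * Complex.I) ≠ 0 ∧ |τ| ≤ ‖(-(ξ:ℂ) + τ * Complex.I)‖ := by
  have h1 : (-(ξ:ℂ) + τ * Complex.I).im = τ := by simp
  refine ⟨fun h => hτ ?_, ?_⟩
  · rw [← h1, h]; simp
  · have := Complex.abs_im_le_norm (-(ξ:ℂ) + τ * Complex.I)
    rwa [h1] at this

lemma st9_k_tail {ξ τ : ℝ} (hτ : τ ≠ 0) : ‖st9_k (-(ξ:ℂ) + τ * Complex.I)‖ ≤ (1 + exp ξ) / |τ| := by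
  obtain ⟨h0, h1⟩ := st9_line_im (ξ := ξ) hτ
  rw [st9_k_eq h0, norm_div]
  have : ‖1 - Complex.exp (-(-(ξ:ℂ) + τ * Complex.I))‖ ≤ 1 + exp ξ := by
    refine (norm_sub_le _ _).trans ?_
    rw [Complex.norm_exp]; simp
  have := abs_pos.2 hτ
  gcongr

lemma st9_k_le (ξ τ : ℝ) : ‖st9_k (-(ξ:ℂ) + τ * Complex.I)‖ ≤ ∫ w in (0:ℝ)..1, exp (ξ*w) := by
  refine (intervalIntegral.norm_integral_le_integral_norm zero_le_one).trans (le_of_eq ?_)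
  congr 1; ext w; rw [Complex.norm_exp]; simp

lemma st9_M_le (ρ : ℝ → ℝ) (h : st9_Dk ρ) (ξ τ : ℝ) : ‖st9_M ρ (-(ξ:ℂ) + τ * Complex.I)‖ ≤ rhoHat ρ (-ξ) := by
  refine (norm_integral_le_integral_norm _).trans (le_of_eq ?_)
  rw [rhoHat]
  refine setIntegral_congr_fun measurableSet_Ioi fun v hv => ?_
  rw [norm_mul, Complex.norm_exp, Complex.norm_real, Real.norm_of_nonneg (st9_rho_pos h (le_of_lt hv)).le, mul_comm]
  simp

lemma st9_M_tail {ρ : ℝ → ℝ} (h : st9_Dk ρ) {ξ τ : ℝ} (hξ : 0 ≤ ξ) (hτ : τ ≠ 0) :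
    ‖st9_M ρ (-(ξ:ℂ) + τ * Complex.I)‖ ≤ (1 + exp ξ) * rhoHat ρ (-ξ) / |τ| := by
  obtain ⟨h0, h1⟩ := st9_line_im (ξ := ξ) hτ
  set s := (-(ξ:ℂ) + τ * Complex.I) with hs
  have hre : s.re = -ξ := by simp [hs]
  have hne : ∀ v : ℝ, ‖Complex.exp (-(s*v))‖ = exp (ξ*v) := by
    intro v; rw [Complex.norm_exp]; simp [hre]
  have hint := st9_M_int h s
  -- shifted integrand
  have hR : IntegrableOn (fun v : ℝ => exp (ξ*v) * ρ v) (Ioi 0) := by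
    have := (st9_M_int h s).norm
    refine this.congr ?_
    filter_upwards [ae_restrict_mem measurableSet_Ioi] with v hv
    rw [norm_mul, hne, Complex.norm_real, Real.norm_of_nonneg (st9_rho_pos h (le_of_lt hv)).le, mul_comm]
  have hR1 : IntegrableOn (fun v : ℝ => exp (ξ*(v-1)) * ρ (v-1)) (Ioi 1) := by
    have := ((measurePreserving_sub_right volume (1:ℝ)).integrableOn_comp_preimage (measurableEmbedding_subRight 1)).2 hR
    rw [preimage_sub_const_Ioi, zero_add] at this
    exact this
  have hJle : ∀ v ∈ Ioi (1:ℝ), ‖((ρ (v-1) / v : ℝ) : ℂ) * Complex.exp (-(s*v))‖ ≤ exp ξ * (exp (ξ*(v-1)) * ρ (v-1)) := by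
    intro v hv
    have hv : 1 < v := hv
    have hp := st9_rho_pos h (t := v-1) (by linarith)
    rw [norm_mul, hne, Complex.norm_real, Real.norm_of_nonneg (by positivity), ← mul_assoc, ← Real.exp_add]
    have : ρ (v-1)/v ≤ ρ (v-1) := div_le_self hp.le hv.le
    calc _ ≤ ρ (v-1) * exp (ξ*v) := by gcongr
      _ = _ := by rw [mul_comm]; congr 2; ring
  have hJ : IntegrableOn (fun v : ℝ => ((ρ (v-1) / v : ℝ) : ℂ) * Complex.exp (-(s*v))) (Ioi 1) := by
    refine Integrable.mono' (hR1.const_mul (exp ξ)) ?_ ?_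
    · refine AEStronglyMeasurable.mul ?_ (Continuous.aestronglyMeasurable (by fun_prop))
      refine Complex.continuous_ofReal.comp_aestronglyMeasurable ?_
      refine AEStronglyMeasurable.congr (f := fun v => ρ (max (v-1) 0) / max v 1) (st9_g_cont h).aestronglyMeasurable ?_
      filter_upwards [ae_restrict_mem measurableSet_Ioi] with v hv
      have hv : 1 < v := hv
      rw [max_eq_left (by linarith), max_eq_left hv.le]
    · filter_upwards [ae_restrict_mem measurableSet_Ioi] with v hv using hJle v hv
  have hI1 := hint.mono_set (Ioi_subset_Ioi zero_le_one)
  have hfull : IntegrableOn (fun v : ℝ => -(((ρ (v-1) / v : ℝ) : ℂ) * Complex.exp (-(s*v))) - s * ((ρ v:ℂ) * Complex.exp (-(s*v)))) (Ioi 1) :=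
    hJ.neg.sub (hI1.const_mul s)
  have hlim : Tendsto (fun v : ℝ => (ρ v:ℂ) * Complex.exp (-(s*v))) atTop (𝓝 0) := by
    obtain ⟨C, hC, hb⟩ := st9_rho_decay h (A := ξ+1) (by positivity)
    have t1 : Tendsto (fun v : ℝ => C * exp (-v)) atTop (𝓝 0) := by
      simpa using (Real.tendsto_exp_neg_atTop_nhds_zero).const_mul C
    refine squeeze_zero_norm' ?_ t1
    filter_upwards [eventually_ge_atTop 0] with v hv
    rw [norm_mul, hne, Complex.norm_real, Real.norm_of_nonneg (st9_rho_pos h hv).le]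
    calc _ ≤ C * exp (-((ξ+1)*v)) * exp (ξ*v) := by gcongr; exact hb v hv
      _ = _ := by rw [mul_assoc, ← Real.exp_add]; congr 2; ring
  have key := integral_Ioi_of_hasDerivAt_of_tendsto (a := 1) (f := fun v : ℝ => (ρ v:ℂ) * Complex.exp (-(s*v)))
    (f' := fun v : ℝ => -(((ρ (v-1) / v : ℝ) : ℂ) * Complex.exp (-(s*v))) - s * ((ρ v:ℂ) * Complex.exp (-(s*v)))) ?_ ?_ hfull hlim
  · rw [integral_sub (f := fun v : ℝ => -(((ρ (v-1) / v : ℝ) : ℂ) * Complex.exp (-(s*v)))) hJ.neg (hI1.const_mul s), integral_const_mul] at key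
    have e1 : st9_M ρ s = st9_k s + ∫ v in Ioi (1:ℝ), (ρ v:ℂ) * Complex.exp (-(s*v)) := by
      rw [st9_M, st9_k, intervalIntegral.integral_of_le zero_le_one, ← Ioc_union_Ioi_eq_Ioi zero_le_one,
        setIntegral_union Ioc_disjoint_Ioi_same measurableSet_Ioi (hint.mono_set Ioc_subset_Ioi_self) hI1]
      congr 1
      refine setIntegral_congr_fun measurableSet_Ioc fun v hv => ?_
      simp [h.one v ⟨hv.1.le, hv.2⟩]
    rw [st9_k_eq h0] at e1
    have e2 : s * st9_M ρ s = 1 - ∫ v in Ioi (1:ℝ), ((ρ (v-1) / v : ℝ) : ℂ) * Complex.exp (-(s*v)) := by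
      rw [e1, mul_add, mul_div_cancel₀ _ h0]
      rw [h.one 1 (by norm_num), integral_neg] at key
      simp only [Complex.ofReal_one, mul_one, one_mul] at key
      linear_combination -key
    have e3 : ‖∫ v in Ioi (1:ℝ), ((ρ (v-1) / v : ℝ) : ℂ) * Complex.exp (-(s*v))‖ ≤ exp ξ * rhoHat ρ (-ξ) := by
      refine (norm_integral_le_of_norm_le (hR1.const_mul (exp ξ)) ?_).trans (le_of_eq ?_)
      · filter_upwards [ae_restrict_mem measurableSet_Ioi] with v hv using hJle v hv
      · rw [integral_const_mul, rhoHat]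
        congr 1
        have := (measurePreserving_sub_right volume (1:ℝ)).setIntegral_preimage_emb (measurableEmbedding_subRight 1)
          (fun v : ℝ => exp (ξ*v) * ρ v) (Ioi 0)
        rw [preimage_sub_const_Ioi, zero_add] at this
        rw [this]
        simp
    have hM1 := st9_rhoHat_ge h (s := -ξ) (by linarith)
    have e4 : ‖s‖ * ‖st9_M ρ s‖ ≤ (1 + exp ξ) * rhoHat ρ (-ξ) := by
      rw [← norm_mul, e2]
      refine (norm_sub_le _ _).trans ?_
      rw [norm_one]; nlinarith
    rw [le_div_iff₀ (abs_pos.2 hτ), mul_comm]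
    exact (mul_le_mul_of_nonneg_right h1 (norm_nonneg _)).trans e4
  · refine ContinuousWithinAt.mul ?_ (Continuous.continuousWithinAt (by fun_prop))
    exact Complex.continuous_ofReal.continuousAt.comp_continuousWithinAt ((h.cont 1 (by simp)).mono (Ici_subset_Ici.2 zero_le_one))
  · intro v hv
    have hd := (st9_rho_deriv h hv).ofReal_comp.mul ((((hasDerivAt_id (v:ℂ)).const_mul s).neg.cexp).comp_ofReal)
    refine hd.congr_deriv ?_
    simp; ring

lemma st9_rho_inv {ρ : ℝ → ℝ} (h : st9_Dk ρ) {ξ : ℝ} (hξ : 0 ≤ ξ) :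
    Integrable (fun τ : ℝ => st9_M ρ (-(ξ:ℂ) + τ * Complex.I) * st9_k (-(ξ:ℂ) + τ * Complex.I)) ∧
    ∀ u : ℝ, 0 ≤ u → ((u * ρ u * exp (ξ*u) : ℝ) : ℂ) = 1/(2*π) * ∫ τ : ℝ,
      st9_M ρ (-(ξ:ℂ) + τ * Complex.I) * st9_k (-(ξ:ℂ) + τ * Complex.I) * Complex.exp (τ * u * Complex.I) := by
  have hMc : Continuous (st9_M ρ) := continuous_iff_continuousAt.2 fun s => (st9_M_deriv h s).continuousAt
  have hgi : Integrable (fun τ : ℝ => st9_M ρ (-(ξ:ℂ) + τ * Complex.I) * st9_k (-(ξ:ℂ) + τ * Complex.I)) := by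
    set U := ∫ w in (0:ℝ)..1, exp (ξ*w)
    refine Integrable.mono' (integrable_inv_one_add_sq.const_mul (rhoHat ρ (-ξ) * U + (1+exp ξ)^2 * rhoHat ρ (-ξ))) ?_ ?_
    · exact ((hMc.comp (by fun_prop)).mul (st9_k_cont.comp (by fun_prop))).aestronglyMeasurable
    · refine Eventually.of_forall fun τ => ?_
      rw [norm_mul, ← div_eq_mul_inv, le_div_iff₀ (by positivity)]
      have a1 := st9_M_le ρ h ξ τ
      have a2 := st9_k_le ξ τ
      have a0 : 0 ≤ rhoHat ρ (-ξ) := by linarith [st9_rhoHat_ge h (s := -ξ) (by linarith)]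
      have a3 : ‖st9_M ρ (-(ξ:ℂ) + τ * Complex.I)‖ * ‖st9_k (-(ξ:ℂ) + τ * Complex.I)‖ * τ^2 ≤ (1+exp ξ)^2 * rhoHat ρ (-ξ) := by
        by_cases hτ : τ = 0
        · rw [hτ]; simp; positivity
        calc _ ≤ ((1 + exp ξ) * rhoHat ρ (-ξ) / |τ|) * ((1 + exp ξ) / |τ|) * τ^2 := by
              gcongr
              · exact st9_M_tail h hξ hτ
              · exact st9_k_tail hτ
          _ = _ := by
              rw [← sq_abs τ]; have := abs_pos.2 hτ; field_simp
      have a4 := mul_le_mul a1 a2 (norm_nonneg _) a0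
      nlinarith
  refine ⟨hgi, fun u hu => ?_⟩
  have hfi : Integrable (fun v : ℝ => ((max v 0 * ρ (max v 0) * exp (ξ*v) : ℝ) : ℂ)) := by
    refine Integrable.ofReal ?_
    have h1 : IntegrableOn (fun v => max v 0 * ρ (max v 0) * exp (ξ*v)) (Ioi 0) := by
      refine Integrable.mono' (st9_rho_dom h ξ) (Continuous.aestronglyMeasurable ?_) ?_
      · exact (((by fun_prop : Continuous fun v : ℝ => max v 0)).mul (st9_q_cont h)).mul (by fun_prop)
      · filter_upwards [ae_restrict_mem measurableSet_Ioi] with v hv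
        have hv : 0 < v := hv
        have hp := st9_rho_pos h hv.le
        rw [max_eq_left hv.le, Real.norm_of_nonneg (by positivity)]
        gcongr; linarith
    refine (integrableOn_iff_integrable_of_support_subset ?_).1 h1
    intro v hv
    by_contra hc
    apply hv
    have : max v 0 = 0 := max_eq_right (not_lt.1 hc)
    change max v 0 * ρ (max v 0) * exp (ξ*v) = 0
    simp [this]
  have key := st9_fourier_inv (f := fun v : ℝ => ((max v 0 * ρ (max v 0) * exp (ξ*v) : ℝ) : ℂ)) ?_ hfi (g := fun τ : ℝ => st9_M ρ (-(ξ:ℂ) + τ * Complex.I) * st9_k (-(ξ:ℂ) + τ * Complex.I)) ?_ hgi u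
  · simp only [max_eq_left hu] at key
    exact key
  · exact Complex.continuous_ofReal.comp ((((by fun_prop : Continuous fun v : ℝ => max v 0)).mul (st9_q_cont h)).mul (by fun_prop))
  · intro t
    rw [← st9_M_conv h, ← setIntegral_eq_integral_of_forall_compl_eq_zero (s := Ioi 0)]
    · refine setIntegral_congr_fun measurableSet_Ioi fun v hv => ?_
      rw [max_eq_left (le_of_lt hv)]
      push_cast
      rw [mul_assoc (v * ρ v : ℂ), ← Complex.exp_add]
      congr 2; ring
    · intro v hv
      have : max v 0 = 0 := max_eq_right (not_lt.1 hv)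
      simp [this]
end

section
open Real Filter Topology MeasureTheory Set

lemma st9_exp4 (θ : ℝ) : ‖Complex.exp (-(θ * Complex.I)) - 1 + θ * Complex.I + ((θ^2/2 : ℝ) : ℂ) - Complex.I * ((θ^3/6 : ℝ) : ℂ)‖ ≤ 4 * θ^4 := by
  have hI3 : Complex.I^3 = -Complex.I := by rw [pow_succ, Complex.I_sq]; ring
  rcases le_total |θ| 1 with h | h
  · have hx : ‖(-(θ * Complex.I) : ℂ)‖ = |θ| := by simp
    have := Complex.exp_bound (x := -(θ * Complex.I)) (by rwa [hx]) (n := 4) (by norm_num)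
    simp only [Finset.sum_range_succ, Finset.sum_range_zero, hx] at this
    have e : Complex.exp (-(θ * Complex.I)) - 1 + θ * Complex.I + ((θ^2/2 : ℝ) : ℂ) - Complex.I * ((θ^3/6 : ℝ) : ℂ) =
        Complex.exp (-(θ * Complex.I)) - (0 + (-(θ * Complex.I))^0/(Nat.factorial 0 : ℕ) + (-(θ * Complex.I))^1/(Nat.factorial 1 : ℕ) + (-(θ * Complex.I))^2/(Nat.factorial 2 : ℕ) + (-(θ * Complex.I))^3/(Nat.factorial 3 : ℕ)) := by
      have p2 : (-(θ * Complex.I) : ℂ)^2 = -θ^2 := by rw [neg_sq, mul_pow, Complex.I_sq]; ring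
      have p3 : (-(θ * Complex.I) : ℂ)^3 = θ^3 * Complex.I := by rw [Odd.neg_pow (by decide), mul_pow, hI3]; ring
      rw [p2, p3]
      simp [Nat.factorial]
      ring
    rw [e]
    refine this.trans ?_
    have h4 : |θ|^4 = θ^4 := by rw [← abs_pow]; exact abs_of_nonneg (by positivity)
    rw [h4, mul_comm]
    have : 0 ≤ θ^4 := by positivity
    norm_num [Nat.factorial]; nlinarith
  · have n1 : ‖Complex.exp (-(θ * Complex.I))‖ = 1 := by rw [Complex.norm_exp]; simp
    have n2 : ‖(θ * Complex.I : ℂ)‖ = |θ| := by simp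
    have n3 : ‖((θ^2/2 : ℝ) : ℂ)‖ = |θ|^2/2 := by rw [Complex.norm_real]; simp
    have n4 : ‖Complex.I * ((θ^3/6 : ℝ) : ℂ)‖ = |θ|^3/6 := by rw [norm_mul, Complex.norm_real]; simp
    have h4 : θ^4 = |θ|^4 := by rw [← abs_pow]; exact (abs_of_nonneg (by positivity)).symm
    have t1 := norm_sub_le (Complex.exp (-(θ * Complex.I)) - 1 + θ * Complex.I + ((θ^2/2 : ℝ) : ℂ)) (Complex.I * ((θ^3/6 : ℝ) : ℂ))
    have t2 := norm_add_le (Complex.exp (-(θ * Complex.I)) - 1 + θ * Complex.I) ((θ^2/2 : ℝ) : ℂ)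
    have t3 := norm_add_le (Complex.exp (-(θ * Complex.I)) - 1) (θ * Complex.I)
    have t4 := norm_sub_le (Complex.exp (-(θ * Complex.I))) 1
    rw [n1, norm_one] at t4
    rw [n2] at t3; rw [n3] at t2; rw [n4] at t1
    rw [h4]
    have m4 : 1 ≤ |θ|^4 := one_le_pow₀ h
    have m3 : |θ|^3 ≤ |θ|^4 := pow_le_pow_right₀ h (by norm_num)
    have m2 : |θ|^2 ≤ |θ|^4 := pow_le_pow_right₀ h (by norm_num)
    have m1 : |θ| ≤ |θ|^4 := le_self_pow₀ h (by norm_num)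
    linarith

noncomputable def st9_P (ξ τ : ℝ) : ℂ := ∫ w in (0:ℝ)..1, ((exp (ξ*w)/w : ℝ) : ℂ) * (Complex.exp (-(((τ*w : ℝ) : ℂ) * Complex.I)) - 1)

lemma st9_e1_le (θ : ℝ) : ‖Complex.exp (-((θ:ℂ) * Complex.I)) - 1‖ ≤ |θ| := by
  have := Real.norm_exp_I_mul_ofReal_sub_one_le (x := -θ)
  simpa [mul_comm] using this

lemma st9_P_intg (ξ τ : ℝ) : IntervalIntegrable (fun w : ℝ => ((exp (ξ*w)/w : ℝ) : ℂ) * (Complex.exp (-(((τ*w : ℝ) : ℂ) * Complex.I)) - 1)) volume 0 1 := by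
  refine IntervalIntegrable.mono_fun' (g := fun w => exp (ξ*w) * |τ|) (Continuous.intervalIntegrable (by fun_prop) _ _) ?_ ?_
  · exact (Measurable.aestronglyMeasurable (by fun_prop))
  · filter_upwards [ae_restrict_mem measurableSet_uIoc] with w hw
    rw [uIoc_of_le zero_le_one] at hw
    have hw0 := hw.1
    rw [norm_mul, Complex.norm_real, Real.norm_of_nonneg (by positivity)]
    calc _ ≤ exp (ξ*w)/w * |τ*w| := by gcongr; exact st9_e1_le _
      _ = _ := by rw [abs_mul, abs_of_pos hw0]; field_simp

lemma st9_P_deriv (ξ τ : ℝ) : HasDerivAt (st9_P ξ) (-(Complex.I * st9_k (-(ξ:ℂ) + τ * Complex.I))) τ := by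
  have := (intervalIntegral.hasDerivAt_integral_of_dominated_loc_of_deriv_le (μ := volume) (a := 0) (b := 1) (s := univ) (x₀ := τ)
    (F := fun τ w : ℝ => ((exp (ξ*w)/w : ℝ) : ℂ) * (Complex.exp (-(((τ*w : ℝ) : ℂ) * Complex.I)) - 1))
    (F' := fun τ w : ℝ => ((exp (ξ*w)/w : ℝ) : ℂ) * (Complex.exp (-(((τ*w : ℝ) : ℂ) * Complex.I)) * (-((w:ℂ)* Complex.I))))
    (bound := fun w => exp (ξ*w)) univ_mem ?_ (st9_P_intg ξ τ) ?_ ?_ (Continuous.intervalIntegrable (by fun_prop) _ _) ?_).2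
  · refine this.congr_deriv ?_
    rw [st9_k, ← intervalIntegral.integral_const_mul, ← intervalIntegral.integral_neg]
    refine intervalIntegral.integral_congr_ae ?_
    refine Eventually.of_forall fun w hw => ?_
    rw [uIoc_of_le zero_le_one] at hw
    have hw0 : (w:ℂ) ≠ 0 := by exact_mod_cast hw.1.ne'
    have : Complex.exp (-((-(ξ:ℂ) + τ * Complex.I) * w)) = Complex.exp (ξ*w) * Complex.exp (-(((τ*w : ℝ) : ℂ) * Complex.I)) := by
      rw [← Complex.exp_add]; congr 1; push_cast; ring
    rw [this]; push_cast; field_simp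
  · exact Eventually.of_forall fun z => (Measurable.aestronglyMeasurable (by fun_prop))
  · exact (Measurable.aestronglyMeasurable (by fun_prop))
  · refine Eventually.of_forall fun w hw z _ => ?_
    rw [uIoc_of_le zero_le_one] at hw
    have hw0 := hw.1
    rw [norm_mul, norm_mul, Complex.norm_exp, Complex.norm_real, Real.norm_of_nonneg (by positivity)]
    simp [abs_of_pos hw0]
    exact le_of_eq (by field_simp)
  · refine Eventually.of_forall fun w _ z _ => ?_
    refine HasDerivAt.const_mul _ (HasDerivAt.sub_const _ ?_)
    have h1 : HasDerivAt (fun z : ℝ => -(((z*w : ℝ) : ℂ) * Complex.I)) (-((w:ℂ)*Complex.I)) z := by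
      have := ((hasDerivAt_mul_const w (x := z)).ofReal_comp.mul_const Complex.I).neg
      exact this
    exact h1.cexp

lemma st9_M_exp {ρ : ℝ → ℝ} (h : st9_Dk ρ) (ξ τ : ℝ) :
    st9_M ρ (-(ξ:ℂ) + τ * Complex.I) = (rhoHat ρ (-ξ) : ℂ) * Complex.exp (st9_P ξ τ) := by
  have hd : ∀ t : ℝ, HasDerivAt (fun t : ℝ => st9_M ρ (-(ξ:ℂ) + t * Complex.I) * Complex.exp (-(st9_P ξ t))) 0 t := by
    intro t
    have h1 : HasDerivAt (fun t : ℝ => (-(ξ:ℂ) + t * Complex.I)) Complex.I t := by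
      simpa using ((hasDerivAt_id (t:ℂ)).comp_ofReal.mul_const Complex.I).const_add (-(ξ:ℂ))
    have h2 := (st9_M_deriv h (-(ξ:ℂ) + t * Complex.I)).comp t h1
    refine (h2.mul (st9_P_deriv ξ t).neg.cexp).congr_deriv ?_
    simp only [Function.comp_def]; ring
  have := is_const_of_deriv_eq_zero (fun t => (hd t).differentiableAt) (fun t => (hd t).deriv) τ 0
  have h0 : st9_P ξ 0 = 0 := by simp [st9_P]
  rw [h0] at this
  simp at this
  have e := st9_rhoHat_eq ρ (-ξ)
  push_cast at e
  rw [← e, ← this, mul_assoc, ← Complex.exp_add]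
  simp

lemma st9_P_taylor (ξ : ℝ) {τ : ℝ} :
    ‖st9_P ξ τ + τ * ((∫ w in (0:ℝ)..1, exp (ξ*w) : ℝ):ℂ) * Complex.I + (((∫ w in (0:ℝ)..1, w * exp (ξ*w)) * τ^2/2 : ℝ) : ℂ)
      - Complex.I * ((((∫ w in (0:ℝ)..1, w^2 * exp (ξ*w))/6) * τ^3 : ℝ) : ℂ)‖ ≤ 4 * (∫ w in (0:ℝ)..1, w * exp (ξ*w)) * τ^4 := by
  have e : st9_P ξ τ + τ * ((∫ w in (0:ℝ)..1, exp (ξ*w) : ℝ):ℂ) * Complex.I + (((∫ w in (0:ℝ)..1, w * exp (ξ*w)) * τ^2/2 : ℝ) : ℂ)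
      - Complex.I * ((((∫ w in (0:ℝ)..1, w^2 * exp (ξ*w))/6) * τ^3 : ℝ) : ℂ) = ∫ w in (0:ℝ)..1,
      (((exp (ξ*w)/w : ℝ) : ℂ) * (Complex.exp (-(((τ*w : ℝ) : ℂ) * Complex.I)) - 1) + τ * ((exp (ξ*w) : ℝ):ℂ) * Complex.I
        + (((w*exp (ξ*w)) * τ^2/2 : ℝ) : ℂ) - Complex.I * ((((w^2 * exp (ξ*w))/6) * τ^3 : ℝ) : ℂ)) := by
    rw [intervalIntegral.integral_sub, intervalIntegral.integral_add, intervalIntegral.integral_add, st9_P]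
    · congr 1
      · congr 1
        · congr 1
          rw [intervalIntegral.integral_mul_const, intervalIntegral.integral_const_mul, intervalIntegral.integral_ofReal]
        · rw [intervalIntegral.integral_ofReal]; congr 1
          rw [intervalIntegral.integral_div, intervalIntegral.integral_mul_const]
      · rw [intervalIntegral.integral_const_mul, intervalIntegral.integral_ofReal]; congr 2
        rw [intervalIntegral.integral_mul_const, intervalIntegral.integral_div]
    · exact st9_P_intg ξ τ
    · exact Continuous.intervalIntegrable (by fun_prop) _ _
    · exact (st9_P_intg ξ τ).add (Continuous.intervalIntegrable (by fun_prop) _ _)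
    · exact Continuous.intervalIntegrable (by fun_prop) _ _
    · exact ((st9_P_intg ξ τ).add (Continuous.intervalIntegrable (by fun_prop) _ _)).add (Continuous.intervalIntegrable (by fun_prop) _ _)
    · exact Continuous.intervalIntegrable (by fun_prop) _ _
  rw [e]
  have hb : ∀ w ∈ Ioc (0:ℝ) 1, ‖((exp (ξ*w)/w : ℝ) : ℂ) * (Complex.exp (-(((τ*w : ℝ) : ℂ) * Complex.I)) - 1) + τ * ((exp (ξ*w) : ℝ):ℂ) * Complex.I
        + (((w*exp (ξ*w)) * τ^2/2 : ℝ) : ℂ) - Complex.I * ((((w^2 * exp (ξ*w))/6) * τ^3 : ℝ) : ℂ)‖ ≤ 4 * τ^4 * (w * exp (ξ*w)) := by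
    intro w hw
    have hw0 := hw.1
    have hwc : (w:ℂ) ≠ 0 := by exact_mod_cast hw0.ne'
    have := st9_exp4 (τ*w)
    have e2 : ((exp (ξ*w)/w : ℝ) : ℂ) * (Complex.exp (-(((τ*w : ℝ) : ℂ) * Complex.I)) - 1) + τ * ((exp (ξ*w) : ℝ):ℂ) * Complex.I
        + (((w*exp (ξ*w)) * τ^2/2 : ℝ) : ℂ) - Complex.I * ((((w^2 * exp (ξ*w))/6) * τ^3 : ℝ) : ℂ)
        = ((exp (ξ*w)/w : ℝ) : ℂ) * (Complex.exp (-(((τ*w : ℝ) : ℂ) * Complex.I)) - 1 + ((τ*w:ℝ):ℂ) * Complex.I + (((τ*w)^2/2 : ℝ) : ℂ) - Complex.I * (((τ*w)^3/6 : ℝ) : ℂ)) := by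
      push_cast; field_simp
    rw [e2, norm_mul, Complex.norm_real, Real.norm_of_nonneg (by positivity)]
    calc _ ≤ exp (ξ*w)/w * (4 * (τ*w)^4) := by gcongr
      _ = 4 * τ^4 * (w * exp (ξ*w)) * w^2 := by field_simp
      _ ≤ 4 * τ^4 * (w * exp (ξ*w)) * 1 := by gcongr; exact pow_le_one₀ hw0.le hw.2
      _ = _ := mul_one _
  refine (intervalIntegral.norm_integral_le_of_norm_le zero_le_one (Eventually.of_forall fun w hw => hb w hw) (Continuous.intervalIntegrable (by fun_prop) _ _)).trans (le_of_eq ?_)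
  rw [intervalIntegral.integral_const_mul]; ring

lemma st9_P_re (ξ τ : ℝ) : (st9_P ξ τ).re = ∫ w in (0:ℝ)..1, exp (ξ*w)/w * (cos (τ*w) - 1) := by
  have := Complex.reCLM.intervalIntegral_comp_comm (st9_P_intg ξ τ)
  simp only [Complex.reCLM_apply] at this
  rw [st9_P, ← this]
  congr 1; ext w
  rw [Complex.re_ofReal_mul]
  congr 1
  simp [Complex.exp_re]

lemma st9_P_re_intg (ξ τ : ℝ) : IntervalIntegrable (fun w => exp (ξ*w)/w * (cos (τ*w) - 1)) volume 0 1 := by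
  have : IntervalIntegrable (fun w => Complex.reCLM (((exp (ξ*w)/w : ℝ) : ℂ) * (Complex.exp (-(((τ*w : ℝ) : ℂ) * Complex.I)) - 1))) volume 0 1 :=
    ⟨Complex.reCLM.integrable_comp (st9_P_intg ξ τ).1, Complex.reCLM.integrable_comp (st9_P_intg ξ τ).2⟩
  refine this.congr ?_
  intro w _
  simp only [Complex.reCLM_apply]
  rw [Complex.re_ofReal_mul]
  simp [Complex.exp_re]

lemma st9_P_small (ξ : ℝ) {τ : ℝ} (hτ : |τ| ≤ 1) : (st9_P ξ τ).re ≤ -(1/6 * ((∫ w in (0:ℝ)..1, w * exp (ξ*w)) * τ^2)) := by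
  rw [st9_P_re]
  have : -(1/6 * ((∫ w in (0:ℝ)..1, w * exp (ξ*w)) * τ^2)) = ∫ w in (0:ℝ)..1, (-(1/6 * τ^2)) * (w * exp (ξ*w)) := by
    rw [intervalIntegral.integral_const_mul]; ring
  rw [this]
  refine intervalIntegral.integral_mono_on_of_le_Ioo zero_le_one (st9_P_re_intg ξ τ) (Continuous.intervalIntegrable (by fun_prop) _ _) fun w hw => ?_
  have hw0 := hw.1
  have h1 : |τ*w| ≤ π := by
    rw [abs_mul, abs_of_pos hw0]; nlinarith [Real.pi_gt_three, abs_nonneg τ, hw.2]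
  have h2 := Real.cos_le_one_sub_mul_cos_sq h1
  have h3 : cos (τ*w) - 1 ≤ -(1/6 * (τ*w)^2) := by
    have : 1/6 ≤ 2/π^2 := by
      rw [div_le_div_iff₀ (by norm_num) (by positivity)]; nlinarith [Real.pi_lt_d2, Real.pi_pos]
    nlinarith [sq_nonneg (τ*w)]
  calc exp (ξ*w)/w * (cos (τ*w) - 1) ≤ exp (ξ*w)/w * (-(1/6 * (τ*w)^2)) := by gcongr
    _ = _ := by field_simp

lemma st9_P_large (ξ τ : ℝ) : (st9_P ξ τ).re ≤ (st9_k (-(ξ:ℂ) + τ * Complex.I)).re - ∫ w in (0:ℝ)..1, exp (ξ*w) := by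
  have e : (st9_k (-(ξ:ℂ) + τ * Complex.I)).re = ∫ w in (0:ℝ)..1, exp (ξ*w) * cos (τ*w) := by
    have := Complex.reCLM.intervalIntegral_comp_comm (μ := volume) (a := 0) (b := 1) (f := fun w : ℝ => Complex.exp (-((-(ξ:ℂ) + τ * Complex.I) * w))) (Continuous.intervalIntegrable (by fun_prop) _ _)
    simp only [Complex.reCLM_apply] at this
    rw [st9_k, ← this]
    congr 1; ext w
    simp [Complex.exp_re]
  rw [e, st9_P_re, ← intervalIntegral.integral_sub (Continuous.intervalIntegrable (by fun_prop) _ _) (Continuous.intervalIntegrable (by fun_prop) _ _)]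
  refine intervalIntegral.integral_mono_on_of_le_Ioo zero_le_one (st9_P_re_intg ξ τ) (Continuous.intervalIntegrable (by fun_prop) _ _) fun w hw => ?_
  have h1 : exp (ξ*w) ≤ exp (ξ*w)/w := by rw [le_div_iff₀ hw.1]; nlinarith [exp_pos (ξ*w), hw.2]
  nlinarith [cos_le_one (τ*w)]

lemma st9_k_taylor (ξ τ : ℝ) : ‖st9_k (-(ξ:ℂ) + τ * Complex.I) - ((∫ w in (0:ℝ)..1, exp (ξ*w) : ℝ):ℂ) + Complex.I * ((τ * ∫ w in (0:ℝ)..1, w * exp (ξ*w) : ℝ):ℂ)‖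
    ≤ (∫ w in (0:ℝ)..1, exp (ξ*w)) * τ^2 := by
  have e : st9_k (-(ξ:ℂ) + τ * Complex.I) - ((∫ w in (0:ℝ)..1, exp (ξ*w) : ℝ):ℂ) + Complex.I * ((τ * ∫ w in (0:ℝ)..1, w * exp (ξ*w) : ℝ):ℂ)
      = ∫ w in (0:ℝ)..1, (Complex.exp (-((-(ξ:ℂ) + τ * Complex.I) * w)) - ((exp (ξ*w) : ℝ):ℂ) + Complex.I * ((τ * (w * exp (ξ*w)) : ℝ):ℂ)) := by
    rw [intervalIntegral.integral_add (Continuous.intervalIntegrable (by fun_prop) _ _) (Continuous.intervalIntegrable (by fun_prop) _ _),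
      intervalIntegral.integral_sub (Continuous.intervalIntegrable (by fun_prop) _ _) (Continuous.intervalIntegrable (by fun_prop) _ _), st9_k,
      intervalIntegral.integral_const_mul, intervalIntegral.integral_ofReal, intervalIntegral.integral_ofReal, intervalIntegral.integral_const_mul]
  rw [e]
  refine (intervalIntegral.norm_integral_le_of_norm_le zero_le_one (g := fun w => exp (ξ*w) * τ^2) (Eventually.of_forall fun w hw => ?_) (Continuous.intervalIntegrable (by fun_prop) _ _)).trans (le_of_eq ?_)
  · have h1 := st9_exp_taylor2 (-((τ*w:ℝ) * Complex.I))
    have e2 : Complex.exp (-((-(ξ:ℂ) + τ * Complex.I) * w)) - ((exp (ξ*w) : ℝ):ℂ) + Complex.I * ((τ * (w * exp (ξ*w)) : ℝ):ℂ)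
      = ((exp (ξ*w) : ℝ):ℂ) * (Complex.exp (-((τ*w:ℝ) * Complex.I)) - 1 - (-((τ*w:ℝ) * Complex.I))) := by
      have : Complex.exp (-((-(ξ:ℂ) + τ * Complex.I) * w)) = Complex.exp (ξ*w) * Complex.exp (-(((τ*w : ℝ) : ℂ) * Complex.I)) := by
        rw [← Complex.exp_add]; congr 1; push_cast; ring
      rw [this]; push_cast; ring
    have e3 : ‖(-((τ*w:ℝ) * Complex.I) : ℂ)‖^2 = τ^2*w^2 := by simp [mul_pow]
    have e4 : max 1 (exp (-((τ*w:ℝ) * Complex.I) : ℂ).re) = 1 := by simp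
    rw [e3, e4] at h1
    rw [e2, norm_mul, Complex.norm_real, Real.norm_of_nonneg (exp_pos _).le]
    have : w^2 ≤ 1 := pow_le_one₀ hw.1.le hw.2
    gcongr
    refine h1.trans ?_
    nlinarith [sq_nonneg τ]
  · rw [intervalIntegral.integral_mul_const]
end

section
open Real Filter Topology MeasureTheory Set

lemma st9_int_exp_xi {u ξ : ℝ} (hξ : 0 < ξ) (he : exp ξ = 1 + u*ξ) : ∫ w in (0:ℝ)..1, exp (ξ*w) = u := by
  rw [intervalIntegral.integral_comp_mul_left (fun x => exp x) hξ.ne']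
  simp [he]; field_simp

lemma st9_a_bounds (ξ : ℝ) (hξ : 0 ≤ ξ) : (∫ w in (0:ℝ)..1, exp (ξ*w))/2 ≤ ∫ w in (0:ℝ)..1, w * exp (ξ*w) ∧
    ∫ w in (0:ℝ)..1, w * exp (ξ*w) ≤ ∫ w in (0:ℝ)..1, exp (ξ*w) ∧
    ∫ w in (0:ℝ)..1, w^2 * exp (ξ*w) ≤ ∫ w in (0:ℝ)..1, w * exp (ξ*w) := by
  refine ⟨?_, ?_, ?_⟩
  · have h : ∫ w in (0:ℝ)..1, (w - 1/2) * exp (ξ/2) ≤ ∫ w in (0:ℝ)..1, (w * exp (ξ*w) - exp (ξ*w) * (1/2)) := by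
      refine intervalIntegral.integral_mono_on zero_le_one (Continuous.intervalIntegrable (by fun_prop) _ _) (Continuous.intervalIntegrable (by fun_prop) _ _) fun w hw => ?_
      rcases le_total w (1/2) with h | h
      · have : exp (ξ*w) ≤ exp (ξ/2) := Real.exp_le_exp.2 (by nlinarith)
        nlinarith
      · have : exp (ξ/2) ≤ exp (ξ*w) := Real.exp_le_exp.2 (by nlinarith)
        nlinarith
    rw [intervalIntegral.integral_sub (Continuous.intervalIntegrable (by fun_prop) _ _) (Continuous.intervalIntegrable (by fun_prop) _ _),
      intervalIntegral.integral_mul_const, intervalIntegral.integral_mul_const, intervalIntegral.integral_sub (Continuous.intervalIntegrable (by fun_prop) _ _) (Continuous.intervalIntegrable (by fun_prop) _ _), integral_id] at h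
    norm_num at h
    linarith
  · refine intervalIntegral.integral_mono_on zero_le_one (Continuous.intervalIntegrable (by fun_prop) _ _) (Continuous.intervalIntegrable (by fun_prop) _ _) fun w hw => ?_
    nlinarith [exp_pos (ξ*w), hw.2]
  · refine intervalIntegral.integral_mono_on zero_le_one (Continuous.intervalIntegrable (by fun_prop) _ _) (Continuous.intervalIntegrable (by fun_prop) _ _) fun w hw => ?_
    have : w^2 ≤ w := by nlinarith [hw.1, hw.2]
    gcongr

lemma st9_xi_bounds {u ξ : ℝ} (hu : 1 ≤ u) (hξ : 0 < ξ) (he : exp ξ = 1 + u*ξ) : exp ξ ≤ 3*u^2 ∧ ξ^2 ≤ 20*√u := by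
  have h1 := Real.quadratic_le_exp_of_nonneg hξ.le
  have h2 : ξ ≤ 2*u := by
    by_contra hc
    push Not at hc
    nlinarith
  have h3 : exp ξ ≤ 3*u^2 := by rw [he]; nlinarith
  refine ⟨h3, ?_⟩
  have h4 := Real.pow_div_factorial_le_exp ξ hξ.le 8
  have h5 : (ξ^2)^4 ≤ (20*√u)^4 := by
    have : (√u)^4 = u^2 := by rw [show (√u)^4 = ((√u)^2)^2 by ring, Real.sq_sqrt (by linarith)]
    rw [mul_pow, this]
    norm_num [Nat.factorial] at h4
    nlinarith
  exact le_of_pow_le_pow_left₀ (by norm_num) (by positivity) h5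

/-- tail integral of |τ|^(-3/2) -/
lemma st9_tail_int {f : ℝ → ℂ} (hf : Integrable f) {K : ℝ} (hK : ∀ τ, 1 ≤ |τ| → ‖f τ‖ ≤ K * |τ|^(-(3/2:ℝ))) :
    ‖(∫ τ, f τ) - ∫ τ in (-1:ℝ)..1, f τ‖ ≤ 4*K := by
  have hi : IntegrableOn (fun τ : ℝ => K * τ^(-(3/2:ℝ))) (Ioi 1) :=
    ((integrableOn_Ioi_rpow_iff one_pos).2 (by norm_num)).const_mul K
  have hv : ∫ τ in Ioi (1:ℝ), K * τ^(-(3/2:ℝ)) = 2*K := by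
    rw [integral_const_mul, integral_Ioi_rpow_of_lt (by norm_num) one_pos]; norm_num; ring
  have h1 : ‖∫ τ in Ioi (1:ℝ), f τ‖ ≤ 2*K := by
    rw [← hv]
    refine norm_integral_le_of_norm_le hi ?_
    filter_upwards [ae_restrict_mem measurableSet_Ioi] with τ hτ
    have hτ : 1 < τ := hτ
    have := hK τ (by rw [abs_of_pos (by linarith)]; exact hτ.le)
    rwa [abs_of_pos (by linarith)] at this
  have h2 : ‖∫ τ in Iic (-1:ℝ), f τ‖ ≤ 2*K := by
    have e : ∫ τ in Iic (-1:ℝ), f τ = ∫ τ in Ioi (1:ℝ), f (-τ) := by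
      rw [integral_comp_neg_Ioi]
    rw [e, ← hv]
    refine norm_integral_le_of_norm_le hi ?_
    filter_upwards [ae_restrict_mem measurableSet_Ioi] with τ hτ
    have hτ : 1 < τ := hτ
    have := hK (-τ) (by rw [abs_neg, abs_of_pos (by linarith)]; exact hτ.le)
    rwa [abs_neg, abs_of_pos (by linarith)] at this
  have e : (∫ τ, f τ) - ∫ τ in (-1:ℝ)..1, f τ = (∫ τ in Iic (-1:ℝ), f τ) + ∫ τ in Ioi (1:ℝ), f τ := by
    have a1 := intervalIntegral.integral_Iic_add_Ioi (b := (1:ℝ)) (μ := volume) (f := f) hf.integrableOn hf.integrableOn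
    have a2 := intervalIntegral.integral_Iic_sub_Iic (a := (-1:ℝ)) (b := (1:ℝ)) (μ := volume) (f := f) hf.integrableOn hf.integrableOn
    rw [← a1, ← a2]; ring
  rw [e]
  exact (norm_add_le _ _).trans (by linarith)

lemma st9_pow_exp' (k : ℕ) {c : ℝ} (hc : 0 < c) : ∃ K : ℝ, 0 < K ∧ ∀ x : ℝ, 0 ≤ x → x^k * exp (-(c*x)) ≤ K := by
  refine ⟨(2/c)^k * Nat.factorial k, by positivity, fun x hx => (st9_pow_exp k hc hx).trans ?_⟩
  have : exp (-(c/2*x)) ≤ 1 := Real.exp_le_one_iff.2 (by have : 0 ≤ c/2*x := by positivity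
                                                         linarith)
  calc _ ≤ (2/c)^k * Nat.factorial k * 1 := by gcongr
    _ = _ := mul_one _

set_option maxHeartbeats 1000000 in
lemma st9_rho_asymp {ρ : ℝ → ℝ} (h : st9_Dk ρ) : ∃ C : ℝ, 0 < C ∧ ∀ u ξ : ℝ, 2 ≤ u → 0 < ξ → exp ξ = 1 + u*ξ →
    |ρ u * √(2*π*∫ w in (0:ℝ)..1, w * exp (ξ*w)) * exp (ξ*u) / rhoHat ρ (-ξ) - 1| ≤ C/u := by
  obtain ⟨C', hC', hcen⟩ := st9_central (C := 4) (c := 1/6) (by norm_num) (by norm_num) (by norm_num)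
  obtain ⟨K0, hK0, hK0b⟩ := st9_pow_exp' 14 (c := 1/84) (by norm_num)
  refine ⟨2*C' + 4 * (exp 1 * 16 * K0), by positivity, fun u ξ hu hξ he => ?_⟩
  set a := ∫ w in (0:ℝ)..1, w * exp (ξ*w) with ha
  have hU := st9_int_exp_xi hξ he
  obtain ⟨ha1, ha2, hb⟩ := st9_a_bounds ξ hξ.le
  rw [hU] at ha1 ha2
  rw [← ha] at ha1 ha2 hb
  obtain ⟨hx1, hx2⟩ := st9_xi_bounds (by linarith) hξ he
  have hM1 := st9_rhoHat_ge h (s := -ξ) (by linarith)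
  set Mx := rhoHat ρ (-ξ) with hMx
  have hM0 : 0 < Mx := by linarith
  have hMc : (Mx:ℂ) ≠ 0 := by exact_mod_cast hM0.ne'
  have hu0 : 0 < u := by linarith
  have huc : (u:ℂ) ≠ 0 := by exact_mod_cast hu0.ne'
  have ha0 : 0 < a := by linarith
  set Φ : ℝ → ℂ := fun τ => st9_P ξ τ + τ * u * Complex.I with hΦ
  set m : ℝ → ℂ := fun τ => st9_k (-(ξ:ℂ) + τ * Complex.I) / u with hm
  have hPc : Continuous (st9_P ξ) := continuous_iff_continuousAt.2 fun s => (st9_P_deriv ξ s).continuousAt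
  have hmc : Continuous m := (st9_k_cont.comp (by fun_prop)).div_const _
  have hcont : Continuous fun τ => Complex.exp (Φ τ) * m τ :=
    (Complex.continuous_exp.comp (hPc.add (by fun_prop))).mul hmc
  have hre : ∀ τ, (Φ τ).re = (st9_P ξ τ).re := by intro τ; simp [hΦ]
  have main := hcen a 0 ((∫ w in (0:ℝ)..1, w^2 * exp (ξ*w))/6) (-a/u) Φ m (by linarith) le_rfl ?_ ?_ hcont.continuousOn ?_ ?_ ?_
  · obtain ⟨hint, hinv⟩ := st9_rho_inv h hξ.le
    have hG : ∀ τ : ℝ, st9_M ρ (-(ξ:ℂ) + τ * Complex.I) * st9_k (-(ξ:ℂ) + τ * Complex.I) * Complex.exp (τ * u * Complex.I)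
        = (Mx * u : ℂ) * (Complex.exp (Φ τ) * m τ) := by
      intro τ
      rw [st9_M_exp h, hΦ, hm]
      simp only
      rw [Complex.exp_add, ← hMx]; field_simp
    have hinv := hinv u hu0.le
    simp_rw [hG] at hinv
    rw [integral_const_mul] at hinv
    have hGn : ∀ τ : ℝ, ‖st9_M ρ (-(ξ:ℂ) + τ * Complex.I)‖ * ‖st9_k (-(ξ:ℂ) + τ * Complex.I)‖ = Mx * u * ‖Complex.exp (Φ τ) * m τ‖ := by
      intro τ
      have := congrArg norm (hG τ)
      rw [norm_mul, norm_mul, norm_mul (Mx * u : ℂ)] at this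
      have e1 : ‖Complex.exp (τ * u * Complex.I)‖ = 1 := by rw [Complex.norm_exp]; simp
      rw [e1, mul_one] at this
      rw [this, norm_mul, Complex.norm_real, Complex.norm_real, Real.norm_of_nonneg hM0.le, Real.norm_of_nonneg hu0.le]
    have hGi : Integrable fun τ => Complex.exp (Φ τ) * m τ := by
      have h1 := (hint.norm.const_mul (1/(Mx*u)))
      refine Integrable.mono' h1 hcont.aestronglyMeasurable (Eventually.of_forall fun τ => ?_)
      rw [norm_mul (st9_M _ _), hGn]; exact le_of_eq (by field_simp)
    set D := √u/42 - 2 with hD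
    have hPl : ∀ τ : ℝ, 1 ≤ |τ| → (st9_P ξ τ).re ≤ -D := by
      intro τ hτ
      refine (st9_P_large ξ τ).trans ?_
      rw [hU]
      have hτ0 : τ ≠ 0 := by rintro rfl; simp at hτ; linarith
      have k1 : ‖st9_k (-(ξ:ℂ) + τ * Complex.I)‖ ≤ (1 + exp ξ) / √(ξ^2+1) := by
        have h0 := (st9_line_im (ξ := ξ) hτ0).1
        rw [st9_k_eq h0, norm_div]
        have n1 : ‖1 - Complex.exp (-(-(ξ:ℂ) + τ * Complex.I))‖ ≤ 1 + exp ξ := by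
          refine (norm_sub_le _ _).trans ?_
          rw [Complex.norm_exp]; simp
        have n2 : √(ξ^2+1) ≤ ‖-(ξ:ℂ) + τ * Complex.I‖ := by
          apply Real.sqrt_le_iff.2 ⟨norm_nonneg _, ?_⟩
          have := @st9_norm_ge (-ξ) τ
          push_cast at this
          rw [← this]
          have : 1 ≤ τ^2 := by rw [← sq_abs]; exact one_le_pow₀ hτ
          nlinarith
        gcongr
      have k2 := (Complex.re_le_norm _).trans k1
      set r := √(ξ^2+1) with hr
      have hr2 : r^2 = ξ^2+1 := Real.sq_sqrt (by positivity)
      have hr1 : 1 ≤ r := by rw [hr]; apply Real.one_le_sqrt.2; nlinarith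
      have hr0 : 0 < r := by linarith
      have hrξ : ξ ≤ r := by nlinarith
      have k3 : (1 + exp ξ)/r ≤ u - u/(2*r^2) + 2 := by
        rw [he, div_le_iff₀ hr0]
        have e1 : (u - u/(2*r^2) + 2)*r = u*(r - 1/(2*r)) + 2*r := by field_simp
        have e2 : ξ ≤ r - 1/(2*r) := by
          have : 1/(2*r) ≤ r - ξ := by
            rw [div_le_iff₀ (by positivity)]; nlinarith
          linarith
        rw [e1]; nlinarith
      have k4 : √u/42 ≤ u/(2*r^2) := by
        rw [hr2, div_le_div_iff₀ (by norm_num) (by positivity)]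
        have hs1 : 1 ≤ √u := Real.one_le_sqrt.2 (by linarith)
        have hs2 : √u * √u = u := Real.mul_self_sqrt hu0.le
        nlinarith
      linarith
    have htail := st9_tail_int hGi (K := exp 1 * 16 * K0/u^2) ?_
    · have hS : 1/u ≤ √(2*π/a) := by
        apply Real.le_sqrt_of_sq_le
        rw [div_pow, one_pow, div_le_div_iff₀ (by positivity) ha0]
        nlinarith [Real.pi_gt_three]
      set S := √(2*π/a) with hSd
      have hS0 : 0 < S := lt_of_lt_of_le (by positivity) hS
      have hJ : ∫ τ, Complex.exp (Φ τ) * m τ = ((2*π*ρ u * exp (ξ*u)/Mx : ℝ) : ℂ) := by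
        have hpi : (π:ℂ) ≠ 0 := by exact_mod_cast Real.pi_ne_zero
        push_cast at hinv ⊢
        field_simp at hinv ⊢
        linear_combination -hinv
      rw [hJ] at htail
      have e1 : ‖((2*π*ρ u * exp (ξ*u)/Mx : ℝ) : ℂ) - (S:ℝ)‖ ≤ C'*(1/a+0)*S + 4*(exp 1 * 16 * K0/u^2) := by
        refine (norm_sub_le_norm_sub_add_norm_sub _ (∫ τ in (-1:ℝ)..1, Complex.exp (Φ τ) * m τ) _).trans ?_
        linarith
      rw [← Complex.ofReal_sub, Complex.norm_real, Real.norm_eq_abs] at e1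
      have e2 : ρ u * √(2*π*a) * exp (ξ*u) / Mx - 1 = (2*π*ρ u * exp (ξ*u)/Mx - S)/S := by
        have : √(2*π*a) = 2*π/S := by
          rw [eq_div_iff hS0.ne', hSd, ← Real.sqrt_mul (by positivity)]
          rw [show 2*π*a*(2*π/a) = (2*π)^2 by field_simp]
          exact Real.sqrt_sq (by positivity)
        rw [this]; field_simp
      rw [e2, abs_div, abs_of_pos hS0, div_le_iff₀ hS0]
      refine e1.trans ?_
      have e3 : 1/a ≤ 2/u := by rw [div_le_div_iff₀ ha0 hu0]; linarith
      have e4 : C'*(1/a+0)*S ≤ C'*(2/u)*S := by rw [add_zero]; gcongr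
      have e5 : exp 1 * 16 * K0/u^2 ≤ exp 1 * 16 * K0/u * S := by
        calc _ = exp 1 * 16 * K0/u * (1/u) := by field_simp
          _ ≤ _ := by gcongr
      calc _ ≤ C'*(2/u)*S + 4*(exp 1 * 16 * K0/u * S) := by linarith
        _ = _ := by field_simp
    · intro τ hτ
      have hτ0 : τ ≠ 0 := by rintro rfl; simp at hτ; linarith
      have hτp : 0 < |τ| := by linarith
      have b1 : ‖Complex.exp (Φ τ)‖ ≤ exp (-D) := by rw [Complex.norm_exp, hre]; exact Real.exp_le_exp.2 (hPl τ hτ)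
      have b2 : ‖Complex.exp (Φ τ)‖ ≤ (1+exp ξ)/|τ| := by
        have t1 := st9_M_tail h hξ.le hτ0
        rw [st9_M_exp h, norm_mul, Complex.norm_real, Real.norm_of_nonneg hM0.le, Complex.norm_exp] at t1
        rw [Complex.norm_exp, hre]
        rw [mul_comm (1 + exp ξ), mul_div_assoc] at t1
        exact le_of_mul_le_mul_left t1 hM0
      have b3 : ‖m τ‖ ≤ (1+exp ξ)/|τ| := by
        rw [hm]; simp only
        rw [norm_div, Complex.norm_real, Real.norm_of_nonneg hu0.le]
        exact (div_le_self (norm_nonneg _) (by linarith)).trans (st9_k_tail hτ0)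
      set q := 1 + exp ξ with hq
      have hq1 : 1 ≤ q := by linarith [exp_pos ξ]
      have hqu : q ≤ 4*u^2 := by nlinarith
      have b4 : ‖Complex.exp (Φ τ)‖ ≤ exp (-D/2) * q * |τ|^(-(1/2:ℝ)) := by
        have : ‖Complex.exp (Φ τ)‖^2 ≤ (exp (-D/2) * q * |τ|^(-(1/2:ℝ)))^2 := by
          have p1 : (exp (-D/2))^2 = exp (-D) := by rw [← Real.exp_nat_mul]; congr 1; push_cast; ring
          have p2 : (|τ|^(-(1/2:ℝ)))^2 = 1/|τ| := by
            rw [← Real.rpow_natCast, ← Real.rpow_mul hτp.le]; norm_num [Real.rpow_neg_one]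
          rw [mul_pow, mul_pow, p1, p2, sq]
          calc _ ≤ exp (-D) * (q/|τ|) := mul_le_mul b1 b2 (norm_nonneg _) (exp_pos _).le
            _ = exp (-D) * q * (1/|τ|) := by ring
            _ ≤ _ := by gcongr; nlinarith
        exact le_of_sq_le_sq this (by positivity)
      have b5 : exp (-D/2) * u^6 ≤ exp 1 * K0 := by
        have := hK0b √u (Real.sqrt_nonneg u)
        have p1 : exp (-D/2) = exp 1 * exp (-(1/84*√u)) := by rw [← Real.exp_add]; congr 1; rw [hD]; ring
        have p2 : u^6 ≤ (√u)^14 := by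
          rw [show (√u)^14 = ((√u)^2)^7 by ring, Real.sq_sqrt hu0.le]
          exact pow_le_pow_right₀ (by linarith) (by norm_num)
        rw [p1, mul_assoc]
        gcongr
        calc _ ≤ exp (-(1/84*√u)) * (√u)^14 := by gcongr
          _ = (√u)^14 * exp (-(1/84*√u)) := mul_comm _ _
          _ ≤ _ := this
      rw [norm_mul]
      calc _ ≤ (exp (-D/2) * q * |τ|^(-(1/2:ℝ))) * (q/|τ|) := mul_le_mul b4 b3 (norm_nonneg _) (by positivity)
        _ = exp (-D/2) * q^2 * (|τ|^(-(1/2:ℝ)) * |τ|^(-1:ℝ)) := by rw [Real.rpow_neg_one]; ring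
        _ = exp (-D/2) * q^2 * |τ|^(-(3/2:ℝ)) := by rw [← Real.rpow_add hτp]; norm_num
        _ ≤ exp 1 * 16 * K0/u^2 * |τ|^(-(3/2:ℝ)) := by
            gcongr
            rw [le_div_iff₀ (by positivity)]
            have : q^2 ≤ (4*u^2)^2 := by gcongr
            calc _ ≤ exp (-D/2) * (4*u^2)^2 * u^2 := by gcongr
              _ = 16 * (exp (-D/2) * u^6) := by ring
              _ ≤ 16 * (exp 1 * K0) := by gcongr
              _ = _ := by ring
  · have h0 : 0 ≤ ∫ w in (0:ℝ)..1, w^2 * exp (ξ*w) := intervalIntegral.integral_nonneg zero_le_one fun w _ => by positivity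
    rw [abs_of_nonneg (by positivity)]; linarith
  · rw [abs_div, abs_neg, abs_of_pos ha0, abs_of_pos hu0, div_le_iff₀ hu0]; linarith
  · intro τ _
    have := st9_P_taylor ξ (τ := τ)
    rw [hU, ← ha] at this
    exact this
  · intro τ hτ
    rw [hre]; exact st9_P_small ξ hτ
  · intro τ hτ
    have := st9_k_taylor ξ τ
    rw [hU, ← ha] at this
    have e : m τ - 1 - Complex.I * ((-a/u*τ : ℝ) : ℂ) = (st9_k (-(ξ:ℂ) + τ * Complex.I) - u + Complex.I * ((τ * a : ℝ):ℂ))/u := by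
      rw [hm]; push_cast; field_simp; ring
    rw [e, norm_div, Complex.norm_real, Real.norm_of_nonneg hu0.le, div_le_iff₀ hu0]
    nlinarith [sq_nonneg τ]
end

section
open Real Filter Topology MeasureTheory Set

noncomputable abbrev st9_Pr (y : ℝ) : Finset ℕ := Nat.primesBelow (⌊y⌋₊ + 1)

theorem st9_mem_Pr {y : ℝ} (hy : 0 ≤ y) {p : ℕ} : p ∈ st9_Pr y ↔ p.Prime ∧ (p:ℝ) ≤ y := by
  rw [Nat.mem_primesBelow, Nat.lt_succ_iff, Nat.le_floor_iff hy]; tauto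

theorem st9_Pr_ge {y : ℝ} {p : ℕ} (h : p ∈ st9_Pr y) : (2:ℝ) ≤ p := by
  exact_mod_cast (Nat.prime_of_mem_primesBelow h).two_le

theorem st9_abel {y K β s δ G : ℝ} {g g' : ℝ → ℝ} (hy : 1 ≤ y) (hK : 1 ≤ K)
    (hθ : ∀ v, 1 ≤ v → |Chebyshev.theta v - v| ≤ K * v ^ β) (hδ : 0 < δ) (hs : s ≤ β - δ)
    (hg : ∀ v ∈ Icc 1 y, HasDerivAt g (g' v) v) (hc : ContinuousOn g' (Icc 1 y))
    (hg' : ∀ v ∈ Icc 1 y, |g' v| ≤ G * v ^ (-s-1)) (hgy : |g y| ≤ G * y ^ (-s)) (hg1 : |g 1| ≤ G) :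
    |∑ p ∈ st9_Pr y, log p * g p - ∫ v in (1:ℝ)..y, g v| ≤ K * (2 + 1 / δ) * G * y ^ (β - s) := by
  have hG : 0 ≤ G := (abs_nonneg _).trans hg1
  have hd : ∀ t ∈ Icc 1 y, deriv g t = g' t := fun t ht => (hg t ht).deriv
  have hdc : ContinuousOn (deriv g) (Icc 1 y) := hc.congr hd
  have habel := sum_mul_eq_sub_integral_mul₀ (f := g) (fun n : ℕ => if n.Prime then log n else 0)
    (by simp) y (fun t ht => (hg t ht).differentiableAt) hdc.integrableOn_Icc
  have hth : ∀ t : ℝ, ∑ k ∈ Finset.Icc 0 ⌊t⌋₊, (if k.Prime then log (k:ℝ) else 0)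
      = Chebyshev.theta t := by
    intro t
    rw [Chebyshev.theta_eq_sum_Icc, Finset.sum_filter]
  have hS : ∑ k ∈ Finset.Icc 0 ⌊y⌋₊, g k * (if k.Prime then log (k:ℝ) else 0)
      = ∑ p ∈ st9_Pr y, log p * g p := by
    have : st9_Pr y = (Finset.Icc 0 ⌊y⌋₊).filter Nat.Prime := by
      ext p; simp [Nat.mem_primesBelow]
    rw [this, Finset.sum_filter]
    refine Finset.sum_congr rfl fun k _ => ?_
    split_ifs <;> ring
  rw [hS] at habel
  simp only [hth] at habel
  rw [← intervalIntegral.integral_of_le hy] at habel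
  have hcu : ContinuousOn g' (uIcc 1 y) := by rwa [uIcc_of_le hy]
  have hgi : IntervalIntegrable g' volume 1 y := hcu.intervalIntegrable
  have hparts := intervalIntegral.integral_mul_deriv_eq_deriv_mul (a := 1) (b := y)
    (u := fun v : ℝ => v) (v := g) (u' := fun _ => 1) (v' := g')
    (fun v _ => hasDerivAt_id v) (fun v hv => hg v (by rwa [uIcc_of_le hy] at hv))
    (by simp) hgi
  have hθi : IntervalIntegrable (fun v => g' v * Chebyshev.theta v) volume 1 y := by
    have h1 : IntervalIntegrable (fun v => Chebyshev.theta v) volume 1 y :=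
      (Chebyshev.theta_mono.monotoneOn _).intervalIntegrable
    exact h1.continuousOn_mul hcu
  have hvi : IntervalIntegrable (fun v => v * g' v) volume 1 y :=
    (continuousOn_id.mul hcu).intervalIntegrable
  have hI : ∫ t in (1:ℝ)..y, deriv g t * Chebyshev.theta t
      = ∫ t in (1:ℝ)..y, g' t * Chebyshev.theta t := by
    apply intervalIntegral.integral_congr
    intro t ht
    rw [uIcc_of_le hy] at ht
    simp only [hd t ht]
  rw [hI] at habel
  have hkey : ∑ p ∈ st9_Pr y, log p * g p - ∫ v in (1:ℝ)..y, g v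
      = (Chebyshev.theta y - y) * g y + g 1
        - ∫ v in (1:ℝ)..y, (g' v * Chebyshev.theta v - v * g' v) := by
    rw [intervalIntegral.integral_sub hθi hvi, habel, hparts]
    simp only [one_mul]; ring
  have hβ : 0 < β - s := by linarith
  have hy0 : 0 < y := by linarith
  have hY1 : 1 ≤ y ^ (β - s) := one_le_rpow hy hβ.le
  have hint : |∫ v in (1:ℝ)..y, (g' v * Chebyshev.theta v - v * g' v)|
      ≤ K * G * (y ^ (β - s) / δ) := by
    have h1 : ‖∫ v in (1:ℝ)..y, (g' v * Chebyshev.theta v - v * g' v)‖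
        ≤ ∫ v in (1:ℝ)..y, K * G * v ^ (β - s - 1) := by
      apply intervalIntegral.norm_integral_le_of_norm_le hy
      · refine Eventually.of_forall fun v hv => ?_
        have hv1 : 1 ≤ v := hv.1.le
        have hv0 : 0 < v := by linarith
        rw [show g' v * Chebyshev.theta v - v * g' v = g' v * (Chebyshev.theta v - v) by ring,
          Real.norm_eq_abs, abs_mul]
        calc _ ≤ (G * v ^ (-s-1)) * (K * v ^ β) :=
              mul_le_mul (hg' v ⟨hv1, hv.2⟩) (hθ v hv1) (abs_nonneg _) (by positivity)
          _ = _ := by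
              rw [show β - s - 1 = (-s-1) + β by ring, rpow_add hv0]; ring
      · apply ContinuousOn.intervalIntegrable
        rw [uIcc_of_le hy]
        exact continuousOn_const.mul (continuousOn_id.rpow_const
          fun v hv => Or.inl (by simp only [id]; linarith [hv.1]))
    rw [Real.norm_eq_abs] at h1
    refine h1.trans ?_
    rw [intervalIntegral.integral_const_mul, integral_rpow (Or.inl (by linarith))]
    simp only [sub_add_cancel, one_rpow]
    gcongr
    · linarith
    · linarith
  rw [hkey]
  have h2 : |(Chebyshev.theta y - y) * g y| ≤ K * G * y ^ (β - s) := by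
    rw [abs_mul]
    calc _ ≤ (K * y ^ β) * (G * y ^ (-s)) :=
          mul_le_mul (hθ y hy) hgy (abs_nonneg _) (by positivity)
      _ = _ := by rw [sub_eq_add_neg, rpow_add hy0]; ring
  have h3 : |g 1| ≤ K * G * y ^ (β - s) := by
    refine hg1.trans ?_
    have : 1 ≤ K * y ^ (β - s) := by nlinarith
    nlinarith
  calc _ ≤ |(Chebyshev.theta y - y) * g y| + |g 1| + |∫ v in (1:ℝ)..y, (g' v * Chebyshev.theta v - v * g' v)| := by
        refine (abs_sub _ _).trans ?_
        gcongr
        exact abs_add_le _ _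
    _ ≤ _ := by
        have : K * (2 + 1 / δ) * G * y ^ (β - s) = K * G * y ^ (β - s) + K * G * y ^ (β - s)
          + K * G * (y ^ (β - s) / δ) := by ring
        linarith

theorem st9_theta_triv (v : ℝ) (hv : 1 ≤ v) : |Chebyshev.theta v - v| ≤ 2 * v ^ (1:ℝ) := by
  have h1 := Chebyshev.theta_nonneg v
  have h2 := Chebyshev.theta_le_log4_mul_x (x := v) (by linarith)
  have h3 : log 4 < 1.4 := by
    rw [show (4:ℝ) = 2^2 by norm_num, log_pow]; have := log_two_lt_d9; push_cast; linarith
  rw [rpow_one, abs_le]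
  constructor <;> nlinarith

theorem st9_abel_pow {y K β s δ : ℝ} (hy : 1 ≤ y) (hK : 1 ≤ K)
    (hθ : ∀ v, 1 ≤ v → |Chebyshev.theta v - v| ≤ K * v ^ β) (hδ : 0 < δ) (hs : s ≤ β - δ)
    (hs0 : 0 ≤ s) (hs1 : s ≤ 1) :
    |∑ p ∈ st9_Pr y, log p * (p:ℝ) ^ (-s) - ∫ v in (1:ℝ)..y, v ^ (-s)|
      ≤ K * (2 + 1 / δ) * y ^ (β - s) := by
  have hy0 : 0 < y := by linarith
  have := st9_abel (g := fun v => v ^ (-s)) (g' := fun v => -s * v ^ (-s-1)) (G := 1) hy hK hθ hδ hs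
    (fun v hv => hasDerivAt_rpow_const (Or.inl (by linarith [hv.1])))
    (continuousOn_const.mul (continuousOn_id.rpow_const
          fun v hv => Or.inl (by simp only [id]; linarith [hv.1])))
    (fun v hv => by
      have : 0 < v := by linarith [hv.1]
      rw [abs_mul, abs_neg, abs_of_nonneg hs0, abs_of_nonneg (by positivity)]
      have : 0 ≤ v ^ (-s-1) := by positivity
      nlinarith)
    (by rw [abs_of_nonneg (by positivity), one_mul]) (by simp)
  simpa using this

theorem st9_abel_log {y K β s δ : ℝ} (hy : 1 ≤ y) (hK : 1 ≤ K)
    (hθ : ∀ v, 1 ≤ v → |Chebyshev.theta v - v| ≤ K * v ^ β) (hδ : 0 < δ) (hs : s ≤ β - δ)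
    (hs0 : 0 ≤ s) (hs1 : s ≤ 1) :
    |∑ p ∈ st9_Pr y, log p * (log p * (p:ℝ) ^ (-s)) - ∫ v in (1:ℝ)..y, log v * v ^ (-s)|
      ≤ K * (2 + 1 / δ) * (1 + log y) * y ^ (β - s) := by
  have hy0 : 0 < y := by linarith
  have hY := log_nonneg hy
  refine st9_abel (g := fun v => log v * v ^ (-s)) (g' := fun v => v⁻¹ * v ^ (-s) + log v * (-s * v ^ (-s-1)))
    hy hK hθ hδ hs ?_ ?_ ?_ ?_ ?_
  · intro v hv
    have hv0 : v ≠ 0 := by linarith [hv.1]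
    exact (hasDerivAt_log hv0).mul (hasDerivAt_rpow_const (Or.inl hv0))
  · have h0 : ∀ v ∈ Icc 1 y, v ≠ 0 := fun v hv => by linarith [hv.1]
    exact ((continuousOn_id.inv₀ h0).mul (continuousOn_id.rpow_const fun v hv => Or.inl (h0 v hv))).add
      ((continuousOn_id.log h0).mul (continuousOn_const.mul
        (continuousOn_id.rpow_const fun v hv => Or.inl (h0 v hv))))
  · intro v hv
    have hv0 : 0 < v := by linarith [hv.1]
    have e : v⁻¹ * v ^ (-s) = v ^ (-s-1) := by rw [rpow_sub_one hv0.ne']; field_simp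
    rw [e, show v ^ (-s-1) + log v * (-s * v ^ (-s-1)) = (1 - s * log v) * v ^ (-s-1) by ring,
      abs_mul, abs_of_nonneg (a := v ^ (-s-1)) (by positivity)]
    have h1 : 0 ≤ log v := log_nonneg hv.1
    have h2 : log v ≤ log y := log_le_log hv0 hv.2
    gcongr
    rw [abs_le]; constructor <;> nlinarith
  · rw [abs_of_nonneg (by positivity)]; gcongr; linarith
  · simp; linarith

theorem st9_abel_cos {y K β s δ : ℝ} (t : ℝ) (hy : 1 ≤ y) (hK : 1 ≤ K)
    (hθ : ∀ v, 1 ≤ v → |Chebyshev.theta v - v| ≤ K * v ^ β) (hδ : 0 < δ) (hs : s ≤ β - δ)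
    (hs0 : 0 ≤ s) (hs1 : s ≤ 1) :
    |∑ p ∈ st9_Pr y, log p * ((p:ℝ) ^ (-s) * (1 - cos (t * log p)))
        - ∫ v in (1:ℝ)..y, v ^ (-s) * (1 - cos (t * log v))|
      ≤ K * (2 + 1 / δ) * (2 + |t|) * y ^ (β - s) := by
  have hy0 : 0 < y := by linarith
  have hb : ∀ z : ℝ, |1 - cos z| ≤ 2 := fun z => by
    have := neg_one_le_cos z; have := cos_le_one z
    rw [abs_le]; constructor <;> linarith
  have h0 : ∀ v ∈ Icc 1 y, v ≠ 0 := fun v hv => by linarith [hv.1]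
  refine st9_abel (g := fun v => v ^ (-s) * (1 - cos (t * log v)))
    (g' := fun v => (-s * v ^ (-s-1)) * (1 - cos (t * log v))
      + v ^ (-s) * (sin (t * log v) * (t * v⁻¹)))
    hy hK hθ hδ hs ?_ ?_ ?_ ?_ ?_
  · intro v hv
    have hv0 : v ≠ 0 := h0 v hv
    have h1 := ((hasDerivAt_log hv0).const_mul t).cos.const_sub 1
    exact ((hasDerivAt_rpow_const (p := -s) (Or.inl hv0)).mul h1).congr_deriv (by ring)
  · have hl : ContinuousOn (fun v => log v) (Icc 1 y) := continuousOn_id.log h0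
    have hp : ∀ r : ℝ, ContinuousOn (fun v : ℝ => v ^ r) (Icc 1 y) := fun r =>
      continuousOn_id.rpow_const fun v hv => Or.inl (h0 v hv)
    have hi : ContinuousOn (fun v : ℝ => v⁻¹) (Icc 1 y) := continuousOn_id.inv₀ h0
    have := hp (-s-1)
    have := hp (-s)
    fun_prop
  · intro v hv
    have hv0 : 0 < v := by linarith [hv.1]
    have e : v ^ (-s) * (sin (t * log v) * (t * v⁻¹)) = (t * sin (t * log v)) * v ^ (-s-1) := by
      rw [rpow_sub_one hv0.ne']; field_simp
    rw [e, show (-s * v ^ (-s-1)) * (1 - cos (t * log v)) + (t * sin (t * log v)) * v ^ (-s-1)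
      = (t * sin (t * log v) - s * (1 - cos (t * log v))) * v ^ (-s-1) by ring,
      abs_mul, abs_of_nonneg (a := v ^ (-s-1)) (by positivity)]
    gcongr
    have h1 : |t * sin (t * log v)| ≤ |t| := by
      rw [abs_mul]; have := abs_sin_le_one (t * log v); nlinarith [abs_nonneg t]
    have h2 : |s * (1 - cos (t * log v))| ≤ 2 := by
      rw [abs_mul, abs_of_nonneg hs0]; have := hb (t * log v); nlinarith [abs_nonneg (1 - cos (t * log v))]
    refine (abs_sub _ _).trans ?_
    linarith
  · rw [abs_mul, abs_of_nonneg (a := y ^ (-s)) (by positivity), mul_comm]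
    gcongr
    linarith [hb (t * log y), abs_nonneg t]
  · simp; positivity
end

section
open Real Filter Topology MeasureTheory Set

noncomputable def st9_A (s y : ℝ) : ℝ := ∫ v in (1:ℝ)..y, v ^ (-s)
noncomputable def st9_B (s y : ℝ) : ℝ := ∫ v in (1:ℝ)..y, log v * v ^ (-s)

theorem st9_A_eq {s y : ℝ} (hs : s < 1) : st9_A s y = (y ^ (1 - s) - 1) / (1 - s) := by
  rw [st9_A, integral_rpow (Or.inl (by linarith)), one_rpow, show -s + 1 = 1 - s by ring]

theorem st9_subst {y : ℝ} (hy : 1 ≤ y) {g : ℝ → ℝ} (hg : ContinuousOn g (Icc 1 y)) :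
    ∫ v in (1:ℝ)..y, g v = ∫ w in (0:ℝ)..1, g (exp (log y * w)) * (exp (log y * w) * log y) := by
  have hy0 : 0 < y := by linarith
  have hY := log_nonneg hy
  have := intervalIntegral.integral_comp_mul_deriv'' (a := 0) (b := 1) (g := g)
    (f := fun w => exp (log y * w)) (f' := fun w => exp (log y * w) * log y) (by fun_prop)
    (fun w _ => by
      have := ((hasDerivAt_id w).const_mul (log y)).exp
      simp only [id, mul_one] at this
      exact this.hasDerivWithinAt) (by fun_prop)
    (hg.mono (by
      rintro _ ⟨w, hw, rfl⟩
      rw [uIcc_of_le zero_le_one] at hw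
      constructor
      · exact one_le_exp (mul_nonneg hY hw.1)
      · calc exp (log y * w) ≤ exp (log y) := by gcongr; nlinarith [hw.2]
          _ = y := exp_log hy0))
  simp only [Function.comp, mul_one, mul_zero, exp_zero, exp_log hy0] at this
  exact this.symm

theorem st9_A_w {s y : ℝ} (hy : 1 ≤ y) :
    st9_A s y = log y * ∫ w in (0:ℝ)..1, exp ((1 - s) * log y * w) := by
  rw [st9_A, st9_subst (g := fun v => v ^ (-s)) hy (continuousOn_id.rpow_const
    fun v hv => Or.inl (by simp only [id]; linarith [hv.1])), ← intervalIntegral.integral_const_mul]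
  congr 1; ext w
  rw [← exp_mul, ← mul_assoc, ← exp_add, mul_comm (log y)]
  ring_nf

theorem st9_B_w {s y : ℝ} (hy : 1 ≤ y) :
    st9_B s y = log y ^ 2 * ∫ w in (0:ℝ)..1, w * exp ((1 - s) * log y * w) := by
  have h0 : ∀ v ∈ Icc 1 y, v ≠ 0 := fun v hv => by linarith [hv.1]
  rw [st9_B, st9_subst (g := fun v => log v * v ^ (-s)) hy ((continuousOn_id.log h0).mul (continuousOn_id.rpow_const
    fun v hv => Or.inl (h0 v hv))), ← intervalIntegral.integral_const_mul]
  congr 1; ext w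
  rw [log_exp, ← exp_mul]
  rw [show (1 - s) * log y * w = log y * w * -s + log y * w by ring, exp_add]
  ring

theorem st9_AB {s y : ℝ} (hy : 1 ≤ y) (hs : s ≤ 1) :
    log y * st9_A s y / 2 ≤ st9_B s y ∧ st9_B s y ≤ log y * st9_A s y := by
  have hY := log_nonneg hy
  obtain ⟨h1, h2, _⟩ := st9_a_bounds ((1 - s) * log y) (mul_nonneg (by linarith) hY)
  rw [st9_A_w hy, st9_B_w hy]
  constructor
  · have := mul_le_mul_of_nonneg_left h1 (sq_nonneg (log y)); nlinarith
  · have := mul_le_mul_of_nonneg_left h2 (sq_nonneg (log y)); nlinarith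

theorem st9_A_bounds {s y : ℝ} (hy : 4 ≤ y) (hs0 : 0 ≤ s) (hs : s ≤ 1/2) :
    y ^ (1 - s) / 2 ≤ st9_A s y ∧ st9_A s y ≤ 2 * y ^ (1 - s) := by
  rw [st9_A_eq (by linarith)]
  have h2 : (2:ℝ) ≤ y ^ (1 - s) := by
    calc (2:ℝ) = 4 ^ (1/2:ℝ) := by
          rw [show (4:ℝ) = 2 ^ (2:ℝ) by norm_num, ← rpow_mul (by norm_num)]; norm_num
      _ ≤ y ^ (1/2:ℝ) := by gcongr
      _ ≤ _ := rpow_le_rpow_of_exponent_le (by linarith) (by linarith)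
  rw [le_div_iff₀ (by linarith), div_le_iff₀ (by linarith)]
  constructor <;> nlinarith

theorem st9_Q0 {δ : ℝ} (hδ : 0 < δ) (hδ1 : δ ≤ 1) : ∃ C, 0 < C ∧ ∀ y r : ℝ, 1 ≤ y → 0 ≤ r → r ≤ 1 - δ →
    ∑ p ∈ st9_Pr y, log p * (p:ℝ) ^ (-r) ≤ C * y ^ (1 - r) := by
  refine ⟨4 + 3 / δ, by positivity, fun y r hy hr hr1 => ?_⟩
  have h := (abs_le.1 (st9_abel_pow hy (by norm_num) st9_theta_triv hδ hr1 hr (by linarith))).2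
  have hA := st9_A_eq (y := y) (show r < 1 by linarith)
  rw [st9_A] at hA
  have h2 : (y ^ (1 - r) - 1) / (1 - r) ≤ y ^ (1 - r) / δ := by
    have : 0 < y ^ (1 - r) := by positivity
    apply div_le_div₀ <;> linarith
  have : (4 + 3 / δ) * y ^ (1 - r) = 2 * (2 + 1 / δ) * y ^ (1 - r) + y ^ (1 - r) / δ := by ring
  linarith

theorem st9_Q {δ : ℝ} (hδ : 0 < δ) (hδ1 : δ ≤ 1) : ∃ C, 0 < C ∧ ∀ y r : ℝ, 1 ≤ y → 0 ≤ r → r ≤ 1 - δ →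
    log y * ∑ p ∈ st9_Pr y, (p:ℝ) ^ (-r) ≤ C * y ^ (1 - r) := by
  obtain ⟨C, hC, hQ⟩ := st9_Q0 (δ := δ/2) (by linarith) (by linarith)
  refine ⟨(1 + 4/δ) * C, by positivity, fun y r hy hr hr1 => ?_⟩
  have hy0 : 0 < y := by linarith
  have h := hQ y (r + δ/2) hy (by linarith) (by linarith)
  have hpt : ∀ p ∈ st9_Pr y, log y * (p:ℝ) ^ (-r)
      ≤ (1 + 4/δ) * y ^ (δ/2) * (log p * (p:ℝ) ^ (-(r + δ/2))) := by
    intro p hp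
    have hp2 := st9_Pr_ge hp
    have hpy := ((st9_mem_Pr hy0.le).1 hp).2
    have hp0 : (0:ℝ) < p := by linarith
    have hl : 1/2 ≤ log (p:ℝ) := by
      have := log_le_log (by norm_num) hp2
      have := log_two_gt_d9; linarith
    have hly : log (p:ℝ) ≤ log y := log_le_log hp0 hpy
    have he : 1 + δ/2 * (log y - log p) ≤ y ^ (δ/2) * (p:ℝ) ^ (-(δ/2)) := by
      rw [rpow_def_of_pos hy0, rpow_def_of_pos hp0, ← exp_add]
      calc _ = (log y * (δ/2) + log p * -(δ/2)) + 1 := by ring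
        _ ≤ _ := add_one_le_exp _
    have h3 : log y ≤ (1 + 4/δ) * log p * (1 + δ/2 * (log y - log p)) := by
      have e : (1 + 4/δ) * log p * (1 + δ/2 * (log y - log p)) = log p + 4/δ * log p
        + δ/2 * (log y - log p) * log p + 2 * log p * (log y - log p) := by field_simp; ring
      have : 0 ≤ 4/δ * log p := by positivity
      have : 0 ≤ δ/2 * (log y - log p) * log p := mul_nonneg (mul_nonneg (by positivity) (by linarith)) (by linarith)
      nlinarith
    rw [show -(r + δ/2) = -(δ/2) + -r by ring, rpow_add hp0]
    calc _ ≤ ((1 + 4/δ) * log p * (y ^ (δ/2) * (p:ℝ) ^ (-(δ/2)))) * (p:ℝ)^(-r) := by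
          gcongr
          refine h3.trans ?_
          gcongr
      _ = _ := by ring
  rw [Finset.mul_sum]
  calc _ ≤ ∑ p ∈ st9_Pr y, (1 + 4/δ) * y ^ (δ/2) * (log p * (p:ℝ) ^ (-(r + δ/2))) :=
        Finset.sum_le_sum hpt
    _ ≤ (1 + 4/δ) * y ^ (δ/2) * (C * y ^ (1 - (r + δ/2))) := by
        rw [← Finset.mul_sum]; gcongr
    _ = _ := by
        rw [show 1 - r = δ/2 + (1 - (r + δ/2)) by ring, rpow_add hy0]; ring

theorem st9_lp {η y s : ℝ} (hη : 0 < η) (hy : 1 < y) (h : 1 + η ≤ y ^ s) {p : ℕ}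
    (hp : p ∈ st9_Pr y) : log p ≤ (1 + η) / η * log y * (1 - (p:ℝ) ^ (-s)) := by
  have hy0 : 0 < y := by linarith
  have hp2 := st9_Pr_ge hp
  have hpy := ((st9_mem_Pr hy0.le).1 hp).2
  have hp0 : (0:ℝ) < p := by linarith
  have hl : 0 < log (p:ℝ) := log_pos (by linarith)
  have hly : log (p:ℝ) ≤ log y := log_le_log hp0 hpy
  have hY : 0 < log y := log_pos hy
  have hc := convexOn_exp.2 (mem_univ (0:ℝ)) (mem_univ (log y * -s))
    (show 0 ≤ 1 - log p / log y by rw [sub_nonneg, div_le_one hY]; exact hly)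
    (show 0 ≤ log p / log y by positivity) (by ring)
  simp only [smul_eq_mul, mul_zero, zero_add, exp_zero, mul_one] at hc
  rw [show log p / log y * (log y * -s) = log p * -s by field_simp, ← rpow_def_of_pos hp0,
    ← rpow_def_of_pos hy0] at hc
  have hys : y ^ (-s) ≤ 1 / (1 + η) := by
    rw [rpow_neg hy0.le, ← one_div]; gcongr
  have h4 : log p / log y * (1 - y ^ (-s)) ≤ 1 - (p:ℝ) ^ (-s) := by linarith
  have h5 : log p / log y * (η / (1 + η)) ≤ 1 - (p:ℝ) ^ (-s) := by
    refine le_trans ?_ h4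
    gcongr
    have : η / (1 + η) = 1 - 1 / (1 + η) := by field_simp; ring
    linarith
  calc log p = (1 + η) / η * log y * (log p / log y * (η / (1 + η))) := by field_simp
    _ ≤ _ := by gcongr

noncomputable def st9_f1 (s y : ℝ) : ℝ := ∑ p ∈ st9_Pr y, log p / ((p:ℝ) ^ s - 1)
noncomputable def st9_f2 (s y : ℝ) : ℝ :=
  ∑ p ∈ st9_Pr y, log p ^ 2 * (p:ℝ) ^ (-s) / (1 - (p:ℝ) ^ (-s)) ^ 2

theorem st9_pw {p : ℝ} (hp : 2 ≤ p) {s : ℝ} (hs : 0 < s) : 0 < p ^ (-s) ∧ p ^ (-s) < 1 ∧ 1 < p ^ s ∧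
    p ^ s = (p ^ (-s))⁻¹ := by
  have h0 : 0 < p := by linarith
  refine ⟨by positivity, rpow_lt_one_of_one_lt_of_neg (by linarith) (by linarith),
    one_lt_rpow (by linarith) hs, ?_⟩
  rw [rpow_neg h0.le, inv_inv]

theorem st9_f1_deriv {s y : ℝ} (hs : 0 < s) :
    HasDerivAt (fun s => st9_f1 s y) (-(st9_f2 s y)) s := by
  unfold st9_f1 st9_f2
  rw [← Finset.sum_neg_distrib]
  apply HasDerivAt.fun_sum
  intro p hp
  have hp2 := st9_Pr_ge hp
  have hp0 : (0:ℝ) < p := by linarith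
  obtain ⟨h1, h2, h3, h4⟩ := st9_pw hp2 hs
  have hd : HasDerivAt (fun s => (p:ℝ) ^ s - 1) ((p:ℝ) ^ s * log p) s := by
    have := ((hasDerivAt_id s).const_rpow hp0)
    simpa [mul_comm] using this.sub_const 1
  refine ((hasDerivAt_const s (log (p:ℝ))).div hd (by linarith)).congr_deriv ?_
  rw [h4]
  have : 1 - (p:ℝ) ^ (-s) ≠ 0 := by linarith
  have : ((p:ℝ) ^ (-s))⁻¹ - 1 ≠ 0 := by rw [← h4]; linarith
  field_simp
  ring

theorem st9_f2_nonneg (s y : ℝ) : 0 ≤ st9_f2 s y := by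
  unfold st9_f2; positivity

/-- quadratic bounds from first derivative -/
theorem st9_quad {h h' : ℝ → ℝ} {a b m M : ℝ} (hab : a ≤ b)
    (hd : ∀ s ∈ Icc a b, HasDerivAt h (h' s) s)
    (hb : ∀ s ∈ Icc a b, m * (s - a) ≤ h' s ∧ h' s ≤ M * (s - a)) :
    m / 2 * (b - a) ^ 2 ≤ h b - h a ∧ h b - h a ≤ M / 2 * (b - a) ^ 2 := by
  have key : ∀ c : ℝ, ∀ s ∈ Icc a b, HasDerivAt (fun s => h s - c / 2 * (s - a) ^ 2)
      (h' s - c * (s - a)) s := by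
    intro c s hs
    have := (hd s hs).sub ((((hasDerivAt_id s).sub_const a).pow 2).const_mul (c/2))
    refine this.congr_deriv ?_
    simp; ring
  constructor
  · have : MonotoneOn (fun s => h s - m / 2 * (s - a) ^ 2) (Icc a b) := by
      apply monotoneOn_of_deriv_nonneg (convex_Icc a b)
      · exact fun s hs => (key m s hs).continuousAt.continuousWithinAt
      · exact fun s hs => (key m s (interior_subset hs)).differentiableAt.differentiableWithinAt
      · intro s hs
        rw [(key m s (interior_subset hs)).deriv]; linarith [(hb s (interior_subset hs)).1]
    have := this (left_mem_Icc.2 hab) (right_mem_Icc.2 hab) hab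
    simp at this; linarith
  · have : AntitoneOn (fun s => h s - M / 2 * (s - a) ^ 2) (Icc a b) := by
      apply antitoneOn_of_deriv_nonpos (convex_Icc a b)
      · exact fun s hs => (key M s hs).continuousAt.continuousWithinAt
      · exact fun s hs => (key M s (interior_subset hs)).differentiableAt.differentiableWithinAt
      · intro s hs
        rw [(key M s (interior_subset hs)).deriv]; linarith [(hb s (interior_subset hs)).2]
    have := this (left_mem_Icc.2 hab) (right_mem_Icc.2 hab) hab
    simp at this; linarith
end

section
open Real Filter Topology MeasureTheory Set

structure st9_good (η δ s y : ℝ) : Prop where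
  y4 : 4 ≤ y
  s0 : 0 < s
  s1 : s ≤ 1/2 - δ
  pw : 1 + η ≤ y ^ s

structure st9_th (δ K : ℝ) : Prop where
  K1 : 1 ≤ K
  th : ∀ v, 1 ≤ v → |Chebyshev.theta v - v| ≤ K * v ^ (1/2 + δ)

theorem st9_small {δ c : ℝ} (hδ : 0 < δ) (hc : 0 < c) : ∃ y0, 4 ≤ y0 ∧ ∀ y, y0 ≤ y → y ^ (-δ) ≤ c := by
  have := (tendsto_rpow_neg_atTop hδ).eventually (eventually_le_nhds hc)
  obtain ⟨y0, h⟩ := eventually_atTop.1 this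
  exact ⟨max 4 y0, le_max_left _ _, fun y hy => h y ((le_max_right _ _).trans hy)⟩

theorem st9_Y1 {y : ℝ} (hy : 4 ≤ y) : 1 ≤ log y := by
  rw [le_log_iff_exp_le (by linarith)]; linarith [exp_one_lt_d9]

theorem st9_f1_diff {η δ K : ℝ} (hη : 0 < η) (hδ : 0 < δ) (hδ1 : δ ≤ 1/4) (hK : st9_th δ K) :
    ∃ C, 0 < C ∧ ∀ y s, st9_good η δ s y → st9_f1 s y - st9_A s y ≤ C * y ^ (1 - 2 * s) := by
  obtain ⟨C, hC, hQ⟩ := st9_Q (δ := 2 * δ) (by linarith) (by linarith)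
  refine ⟨K * (2 + 1/δ) + (1 + η)/η * C, ?_, fun y s hg => ?_⟩
  · have := hK.K1; positivity
  have hy := hg.y4
  have hy0 : 0 < y := by linarith
  have hs0 := hg.s0
  have hs1 := hg.s1
  have hKK := hK.K1
  have h1 := (abs_le.1 (st9_abel_pow (y := y) (s := s) (by linarith) hK.K1 hK.th hδ (by linarith) hs0.le (by linarith))).2
  rw [← st9_A] at h1
  have h2 := hQ y (2 * s) (by linarith) (by linarith) (by linarith)
  have h3 : st9_f1 s y ≤ ∑ p ∈ st9_Pr y, (log p * (p:ℝ) ^ (-s)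
      + (1 + η)/η * log y * (p:ℝ) ^ (-(2*s))) := by
    apply Finset.sum_le_sum
    intro p hp
    have hp2 := st9_Pr_ge hp
    obtain ⟨e1, e2, e3, e4⟩ := st9_pw hp2 hs0
    have hl := st9_lp hη (by linarith) hg.pw hp
    rw [show -(2*s) = -s + -s by ring, rpow_add (by linarith), e4]
    set q := (p:ℝ) ^ (-s)
    rw [show log (p:ℝ) / (q⁻¹ - 1) = log p * q + log p * q ^ 2 / (1 - q) by
      have : 1 - q ≠ 0 := by linarith
      have : q⁻¹ - 1 ≠ 0 := by rw [← e4]; linarith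
      field_simp; ring]
    have : log p * q ^ 2 / (1 - q) ≤ (1 + η) / η * log y * (q * q) := by
      rw [div_le_iff₀ (by linarith)]
      have := mul_le_mul_of_nonneg_right hl (sq_nonneg q)
      nlinarith
    linarith
  rw [Finset.sum_add_distrib, ← Finset.mul_sum] at h3
  have h4 : y ^ (1/2 + δ - s) ≤ y ^ (1 - 2 * s) :=
    rpow_le_rpow_of_exponent_le (by linarith) (by linarith)
  have h5 : K * (2 + 1/δ) * y ^ (1/2 + δ - s) ≤ K * (2 + 1/δ) * y ^ (1 - 2 * s) := by gcongr
  have h6 : (1 + η)/η * (log y * ∑ p ∈ st9_Pr y, (p:ℝ) ^ (-(2*s))) ≤ (1 + η)/η * (C * y ^ (1 - 2 * s)) := by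
    gcongr
  linarith

theorem st9_f1_lower {η δ K : ℝ} (hη : 0 < η) (hδ : 0 < δ) (hδ1 : δ ≤ 1/4) (hK : st9_th δ K) :
    ∃ y0, ∀ y s, y0 ≤ y → st9_good η δ s y → s ≤ 1/2 - 2 * δ →
      y ^ (1 - 2 * s) / 4 ≤ st9_f1 s y - st9_A s y := by
  have hKK := hK.K1
  obtain ⟨y0, -, hy0⟩ := st9_small hδ (show 0 < 3/4 / (K * (3 + 1/δ)) by positivity)
  refine ⟨y0, fun y s hyy hg hs2 => ?_⟩
  have hy := hg.y4
  have hyp : 0 < y := by linarith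
  have hs0 := hg.s0
  have hs1 := hg.s1
  have h1 := (abs_le.1 (st9_abel_pow (y := y) (s := s) (by linarith) hK.K1 hK.th hδ (by linarith) hs0.le (by linarith))).1
  rw [← st9_A] at h1
  have h2 := (abs_le.1 (hK.th y (by linarith))).1
  have h3 : ∑ p ∈ st9_Pr y, log p * (p:ℝ) ^ (-s) + y ^ (-(2*s)) * Chebyshev.theta y ≤ st9_f1 s y := by
    rw [Chebyshev.theta_eq_sum_primesLE, Finset.mul_sum, st9_f1]
    change _ + ∑ p ∈ st9_Pr y, _ ≤ _
    rw [← Finset.sum_add_distrib]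
    apply Finset.sum_le_sum
    intro p hp
    have hp2 := st9_Pr_ge hp
    have hpy := ((st9_mem_Pr hyp.le).1 hp).2
    obtain ⟨e1, e2, e3, e4⟩ := st9_pw hp2 hs0
    have hq : y ^ (-(2*s)) ≤ (p:ℝ) ^ (-s) * (p:ℝ) ^ (-s) := by
      rw [← rpow_add (by linarith), show -s + -s = -(2*s) by ring]
      exact rpow_le_rpow_of_nonpos (by linarith) hpy (by linarith)
    have hl : 0 < log (p:ℝ) := log_pos (by linarith)
    rw [e4]
    set q := (p:ℝ) ^ (-s)
    rw [show log (p:ℝ) / (q⁻¹ - 1) = log p * q + log p * q ^ 2 / (1 - q) by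
      have : 1 - q ≠ 0 := by linarith
      have : q⁻¹ - 1 ≠ 0 := by rw [← e4]; linarith
      field_simp; ring]
    have : log p * q ^ 2 ≤ log p * q ^ 2 / (1 - q) := by
      rw [le_div_iff₀ (by linarith)]
      have : 0 < log p * q ^ 2 := by positivity
      nlinarith
    nlinarith
  have h4 : y ^ (1/2 + δ - s) ≤ y ^ (-δ) * y ^ (1 - 2 * s) := by
    rw [← rpow_add hyp]
    exact rpow_le_rpow_of_exponent_le (by linarith) (by linarith)
  have h5 : y ^ (-(2*s)) * y ^ (1/2 + δ) ≤ y ^ (-δ) * y ^ (1 - 2 * s) := by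
    rw [← rpow_add hyp, ← rpow_add hyp]
    exact rpow_le_rpow_of_exponent_le (by linarith) (by linarith)
  have h6 : y ^ (-(2*s)) * (y - K * y ^ (1/2 + δ)) ≤ y ^ (-(2*s)) * Chebyshev.theta y := by
    gcongr; linarith
  have h7 : y ^ (-(2*s)) * y = y ^ (1 - 2 * s) := by
    rw [← rpow_add_one hyp.ne']; ring_nf
  have h8 := hy0 y hyy
  rw [le_div_iff₀ (by positivity)] at h8
  have h9 : K * (3 + 1/δ) * (y ^ (-δ) * y ^ (1 - 2 * s)) ≤ 3/4 * y ^ (1 - 2 * s) := by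
    have := mul_le_mul_of_nonneg_right h8 (show 0 ≤ y ^ (1 - 2 * s) by positivity)
    linarith
  have h10 : K * (2 + 1/δ) * y ^ (1/2 + δ - s) ≤ K * (2 + 1/δ) * (y ^ (-δ) * y ^ (1 - 2 * s)) := by
    gcongr
  have h11 : K * (y ^ (-(2*s)) * y ^ (1/2 + δ)) ≤ K * (y ^ (-δ) * y ^ (1 - 2 * s)) := by gcongr
  nlinarith

theorem st9_f1_le {η δ K : ℝ} (hη : 0 < η) (hδ : 0 < δ) (hδ1 : δ ≤ 1/4) (hK : st9_th δ K) :
    ∃ C, 0 < C ∧ ∀ y s, st9_good η δ s y → st9_f1 s y ≤ C * y ^ (1 - s) := by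
  obtain ⟨C, hC, h⟩ := st9_f1_diff hη hδ hδ1 hK
  refine ⟨C + 2, by linarith, fun y s hg => ?_⟩
  have h1 := h y s hg
  have h2 := (st9_A_bounds hg.y4 hg.s0.le (by linarith [hg.s1])).2
  have h3 : y ^ (1 - 2 * s) ≤ y ^ (1 - s) :=
    rpow_le_rpow_of_exponent_le (by linarith [hg.y4]) (by linarith [hg.s0])
  nlinarith

theorem st9_f2_le {η δ : ℝ} (hη : 0 < η) (hδ : 0 < δ) (hδ1 : δ ≤ 1/4) :
    ∃ C, 0 < C ∧ ∀ y s, st9_good η δ s y → st9_f2 s y ≤ C * (log y * y ^ (1 - s)) := by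
  obtain ⟨C, hC, hQ⟩ := st9_Q (δ := δ) (by linarith) (by linarith)
  refine ⟨((1 + η)/η)^2 * C, by positivity, fun y s hg => ?_⟩
  have hy := hg.y4
  have hY := st9_Y1 hy
  have hs0 := hg.s0
  have hs1 := hg.s1
  have h2 := hQ y s (by linarith) (by linarith) (by linarith)
  have h3 : st9_f2 s y ≤ ∑ p ∈ st9_Pr y, ((1 + η)/η * log y)^2 * (p:ℝ) ^ (-s) := by
    apply Finset.sum_le_sum
    intro p hp
    have hp2 := st9_Pr_ge hp
    obtain ⟨e1, e2, e3, e4⟩ := st9_pw hp2 hs0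
    have hl := st9_lp hη (by linarith) hg.pw hp
    have hl0 : 0 < log (p:ℝ) := log_pos (by linarith)
    rw [div_le_iff₀ (by have : 0 < 1 - (p:ℝ)^(-s) := by linarith
                        positivity)]
    calc _ ≤ ((1 + η)/η * log y * (1 - (p:ℝ) ^ (-s))) ^ 2 * (p:ℝ)^(-s) := by gcongr
      _ = _ := by ring
  rw [← Finset.mul_sum] at h3
  refine h3.trans ?_
  calc _ = ((1 + η)/η)^2 * log y * (log y * ∑ p ∈ st9_Pr y, (p:ℝ) ^ (-s)) := by ring
    _ ≤ ((1 + η)/η)^2 * log y * (C * y ^ (1 - s)) := by gcongr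
    _ = _ := by ring

theorem st9_f2_ge_sum {y s : ℝ} (hs0 : 0 < s) :
    ∑ p ∈ st9_Pr y, log p * (log p * (p:ℝ) ^ (-s)) ≤ st9_f2 s y := by
  apply Finset.sum_le_sum
  intro p hp
  have hp2 := st9_Pr_ge hp
  obtain ⟨e1, e2, e3, e4⟩ := st9_pw hp2 hs0
  have hl0 : 0 < log (p:ℝ) := log_pos (by linarith)
  have h1 : 0 < 1 - (p:ℝ) ^ (-s) := by linarith
  rw [le_div_iff₀ (by positivity)]
  have h2 : (1 - (p:ℝ) ^ (-s)) ^ 2 ≤ 1 := by nlinarith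
  have : 0 < log p * (log p * (p:ℝ) ^ (-s)) := by positivity
  nlinarith

theorem st9_f2_B {η δ K : ℝ} (hη : 0 < η) (hδ : 0 < δ) (hδ1 : δ ≤ 1/4) (hK : st9_th δ K) :
    ∃ C, 0 < C ∧ ∀ y s, st9_good η δ s y → |st9_f2 s y - st9_B s y| ≤ C * (log y * y ^ (1 - 2 * s)) := by
  obtain ⟨C, hC, hQ⟩ := st9_Q (δ := 2 * δ) (by linarith) (by linarith)
  have hKK := hK.K1
  refine ⟨2 * K * (2 + 1/δ) + 2 * ((1 + η)/η)^2 * C, by positivity, fun y s hg => ?_⟩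
  have hy := hg.y4
  have hY := st9_Y1 hy
  have hs0 := hg.s0
  have hs1 := hg.s1
  have h1 := abs_le.1 (st9_abel_log (y := y) (s := s) (by linarith) hK.K1 hK.th hδ (by linarith) hs0.le (by linarith))
  rw [← st9_B] at h1
  have h2 := hQ y (2 * s) (by linarith) (by linarith) (by linarith)
  have h3 : st9_f2 s y ≤ ∑ p ∈ st9_Pr y, (log p * (log p * (p:ℝ) ^ (-s))
      + 2 * ((1 + η)/η * log y)^2 * (p:ℝ) ^ (-(2*s))) := by
    apply Finset.sum_le_sum
    intro p hp
    have hp2 := st9_Pr_ge hp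
    obtain ⟨e1, e2, e3, e4⟩ := st9_pw hp2 hs0
    have hl := st9_lp hη (by linarith) hg.pw hp
    have hl0 : 0 < log (p:ℝ) := log_pos (by linarith)
    rw [show -(2*s) = -s + -s by ring, rpow_add (by linarith)]
    set q := (p:ℝ) ^ (-s)
    have h1q : 0 < 1 - q := by linarith
    have hl2 : log (p:ℝ) ^ 2 ≤ ((1 + η)/η * log y)^2 * (1 - q) ^ 2 := by
      rw [← mul_pow]; gcongr
    rw [div_le_iff₀ (by positivity)]
    have h5 : log (p:ℝ) ^ 2 * (2 * q ^ 2) ≤ ((1 + η)/η * log y)^2 * (1 - q) ^ 2 * (2 * q ^ 2) := by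
      gcongr
    have h6 : 0 ≤ log (p:ℝ) ^ 2 * q ^ 3 := by positivity
    nlinarith
  rw [Finset.sum_add_distrib, ← Finset.mul_sum] at h3
  have h0 := st9_f2_ge_sum (y := y) hs0
  have h4 : y ^ (1/2 + δ - s) ≤ y ^ (1 - 2 * s) :=
    rpow_le_rpow_of_exponent_le (by linarith) (by linarith)
  have h5 : K * (2 + 1/δ) * (1 + log y) * y ^ (1/2 + δ - s)
      ≤ K * (2 + 1/δ) * (2 * log y) * y ^ (1 - 2 * s) := by
    gcongr; linarith
  have h6 : 2 * ((1 + η)/η)^2 * log y * (log y * ∑ p ∈ st9_Pr y, (p:ℝ) ^ (-(2*s)))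
      ≤ 2 * ((1 + η)/η)^2 * log y * (C * y ^ (1 - 2 * s)) := by gcongr
  have h7 : 0 ≤ 2 * ((1 + η)/η)^2 * C * (log y * y ^ (1 - 2 * s)) := by positivity
  rw [abs_le]
  constructor <;> linarith

theorem st9_sum2_ge {δ K : ℝ} (hδ : 0 < δ) (hδ1 : δ ≤ 1/4) (hK : st9_th δ K) :
    ∃ y0, ∀ y s, y0 ≤ y → 4 ≤ y → 0 < s → s ≤ 1/2 - δ →
      log y * y ^ (1 - s) / 8 ≤ ∑ p ∈ st9_Pr y, log p * (log p * (p:ℝ) ^ (-s)) := by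
  have hKK := hK.K1
  obtain ⟨y0, -, hy0⟩ := st9_small hδ (show 0 < 1/8 / (2 * K * (2 + 1/δ)) by positivity)
  refine ⟨y0, fun y s hyy hy hs0 hs1 => ?_⟩
  have hY := st9_Y1 hy
  have hyp : 0 < y := by linarith
  have h1 := abs_le.1 (st9_abel_log (y := y) (s := s) (by linarith) hK.K1 hK.th hδ (by linarith) hs0.le (by linarith))
  rw [← st9_B] at h1
  have h2 := (st9_AB (y := y) (s := s) (by linarith) (by linarith)).1
  have h3 := (st9_A_bounds hy hs0.le (by linarith)).1
  have h4 : y ^ (1/2 + δ - s) ≤ y ^ (-δ) * y ^ (1 - s) := by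
    rw [← rpow_add hyp]
    exact rpow_le_rpow_of_exponent_le (by linarith) (by linarith)
  have h5 : K * (2 + 1/δ) * (1 + log y) * y ^ (1/2 + δ - s)
      ≤ K * (2 + 1/δ) * (2 * log y) * (y ^ (-δ) * y ^ (1 - s)) := by
    gcongr; linarith
  have h8 := hy0 y hyy
  rw [le_div_iff₀ (by positivity)] at h8
  have h9 := mul_le_mul_of_nonneg_right h8 (show 0 ≤ log y * y ^ (1 - s) by positivity)
  have h10 := mul_le_mul_of_nonneg_left h3 (show 0 ≤ log y by linarith)
  linarith
end

section
open Real Filter Topology MeasureTheory Set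

theorem st9_f1_anti {s t y : ℝ} (hs : 0 < s) (hst : s ≤ t) : st9_f1 t y ≤ st9_f1 s y := by
  apply Finset.sum_le_sum
  intro p hp
  have hp2 := st9_Pr_ge hp
  have h1 := (st9_pw hp2 hs).2.2.1
  have hl0 : 0 < log (p:ℝ) := log_pos (by linarith)
  have h2 : (p:ℝ) ^ s ≤ (p:ℝ) ^ t := rpow_le_rpow_of_exponent_le (by linarith) hst
  apply div_le_div_of_nonneg_left hl0.le <;> linarith

theorem st9_f1_mv {a b y : ℝ} (ha : 0 < a) (hab : a < b) :
    ∃ c ∈ Ioo a b, st9_f1 a y - st9_f1 b y = st9_f2 c y * (b - a) := by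
  have hd : ∀ s, a ≤ s → HasDerivAt (fun s => st9_f1 s y) (-(st9_f2 s y)) s :=
    fun s hs => st9_f1_deriv (by linarith)
  obtain ⟨c, hc, h⟩ := exists_hasDerivAt_eq_slope (fun s => st9_f1 s y) (fun s => -(st9_f2 s y)) hab
    (fun s hs => (hd s hs.1).continuousAt.continuousWithinAt) (fun s hs => hd s hs.1.le)
  refine ⟨c, hc, ?_⟩
  rw [eq_div_iff (by linarith)] at h
  linarith

theorem st9_good_mono {η δ s t y : ℝ} (h : st9_good η δ s y) (hst : s ≤ t) (ht : t ≤ 1/2 - δ) :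
    st9_good η δ t y :=
  ⟨h.y4, h.s0.trans_le hst, ht, h.pw.trans (rpow_le_rpow_of_exponent_le (by linarith [h.y4]) hst)⟩

theorem st9_alpha {η δ K : ℝ} (hη : 0 < η) (hδ : 0 < δ) (hδ1 : δ ≤ 1/4) (hK : st9_th δ K) :
    ∃ y0 m M c C, 0 < m ∧ 0 < M ∧ 0 < c ∧ 0 < C ∧ ∀ y σ α, y0 ≤ y → st9_good η δ σ y → σ ≤ 1/2 - 2 * δ →
      0 < α → st9_f1 α y = st9_A σ y →
      σ < α ∧ st9_good η δ α y ∧ (∀ s ∈ Icc σ α, m * y ^ (1 - σ) ≤ y ^ (1 - s) ∧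
        m * (log y * y ^ (1 - σ)) ≤ st9_f2 s y ∧ st9_f2 s y ≤ M * (log y * y ^ (1 - σ))) ∧
      c * (y ^ (-σ) / log y) ≤ α - σ ∧ α - σ ≤ C * (y ^ (-σ) / log y) := by
  obtain ⟨y1, h1⟩ := st9_f1_lower hη hδ hδ1 hK
  obtain ⟨C1, hC1, h1'⟩ := st9_f1_diff hη hδ hδ1 hK
  obtain ⟨C2, hC2, h2⟩ := st9_f1_le hη hδ hδ1 hK
  obtain ⟨M, hM, h3⟩ := st9_f2_le hη hδ hδ1
  obtain ⟨y2, h4⟩ := st9_sum2_ge hδ hδ1 hK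
  obtain ⟨y3, -, h5⟩ := st9_small hδ (show 0 < 1 / (4 * C2) by positivity)
  refine ⟨max y1 (max y2 y3), min (1 / (2 * C2)) (1 / (16 * C2)), M, 1 / (4 * M), 16 * C2 * C1,
    by positivity, hM, by positivity, by positivity, ?_⟩
  intro y σ α hy hg hσ hα hL
  have hyy1 : y1 ≤ y := (le_max_left _ _).trans hy
  have hyy2 : y2 ≤ y := (le_max_left _ _).trans ((le_max_right _ _).trans hy)
  have hyy3 : y3 ≤ y := (le_max_right _ _).trans ((le_max_right _ _).trans hy)
  have hy4 := hg.y4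
  have hyp : 0 < y := by linarith
  have hY := st9_Y1 hy4
  have hs0 := hg.s0
  have hlow := h1 y σ hyy1 hg hσ
  have hup := h1' y σ hg
  have hpos : 0 < y ^ (1 - 2 * σ) := by positivity
  have hpos1 : 0 < y ^ (1 - σ) := by positivity
  have hA := (st9_A_bounds hy4 hs0.le (by linarith)).1
  have hlt : σ < α := by
    by_contra hc
    have := st9_f1_anti (y := y) hα (not_lt.1 hc)
    linarith
  have hα1 : α ≤ σ + δ := by
    by_contra hc
    have e1 := st9_f1_anti (y := y) (show 0 < σ + δ by linarith) (not_le.1 hc).le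
    have e2 := h2 y (σ + δ) (st9_good_mono hg (by linarith) (by linarith))
    have e3 : y ^ (1 - (σ + δ)) = y ^ (-δ) * y ^ (1 - σ) := by
      rw [← rpow_add hyp]; ring_nf
    have e4 := h5 y hyy3
    rw [le_div_iff₀ (by positivity)] at e4
    rw [e3] at e2
    nlinarith
  have hgα : st9_good η δ α y := st9_good_mono hg hlt.le (by linarith)
  have hK0 : y ^ (1 - σ) / (2 * C2) ≤ y ^ (1 - α) := by
    have := h2 y α hgα
    rw [div_le_iff₀ (by positivity)]; linarith
  have hs : ∀ s ∈ Icc σ α, y ^ (1 - σ) / (2 * C2) ≤ y ^ (1 - s) ∧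
        y ^ (1 - σ) * log y / (16 * C2) ≤ st9_f2 s y ∧ st9_f2 s y ≤ M * (log y * y ^ (1 - σ)) := by
    intro s hs
    have hgs := st9_good_mono hg hs.1 (by linarith [hs.2])
    have e1 : y ^ (1 - α) ≤ y ^ (1 - s) := rpow_le_rpow_of_exponent_le (by linarith) (by linarith [hs.2])
    have e2 : y ^ (1 - s) ≤ y ^ (1 - σ) := rpow_le_rpow_of_exponent_le (by linarith) (by linarith [hs.1])
    refine ⟨hK0.trans e1, ?_, (h3 y s hgs).trans (by gcongr)⟩
    have e3 := (h4 y s hyy2 hy4 hgs.s0 hgs.s1).trans (st9_f2_ge_sum hgs.s0)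
    refine le_trans ?_ e3
    have := mul_le_mul_of_nonneg_left (hK0.trans e1) (show 0 ≤ log y / 8 by linarith)
    calc _ = log y / 8 * (y ^ (1 - σ) / (2 * C2)) := by field_simp; ring
      _ ≤ _ := this
      _ = _ := by ring
  obtain ⟨s, hsm, hmv⟩ := st9_f1_mv (y := y) hs0 hlt
  obtain ⟨g1, g2, g3⟩ := hs s ⟨hsm.1.le, hsm.2.le⟩
  rw [hL] at hmv
  have hd : 0 < α - σ := by linarith
  have epow : y ^ (1 - 2 * σ) = y ^ (-σ) * y ^ (1 - σ) := by rw [← rpow_add hyp]; ring_nf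
  refine ⟨hlt, hgα, fun s hsm => ?_, ?_, ?_⟩
  · obtain ⟨g1, g2, g3⟩ := hs s hsm
    refine ⟨le_trans ?_ g1, le_trans ?_ g2, g3⟩
    · calc _ ≤ 1 / (2 * C2) * y ^ (1 - σ) := by gcongr; exact min_le_left _ _
        _ = _ := by ring
    · calc _ ≤ 1 / (16 * C2) * (log y * y ^ (1 - σ)) := by gcongr; exact min_le_right _ _
        _ = _ := by ring
  · rw [epow] at hlow
    have : y ^ (-σ) * y ^ (1 - σ) / 4 ≤ M * (log y * y ^ (1 - σ)) * (α - σ) := by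
      refine hlow.trans (hmv.le.trans ?_); gcongr
    have h6 : y ^ (-σ) / 4 ≤ M * log y * (α - σ) := by
      refine le_of_mul_le_mul_right ?_ hpos1; linarith
    calc _ = y ^ (-σ) / 4 / (M * log y) := by field_simp
      _ ≤ _ := by rw [div_le_iff₀ (by positivity)]; linarith
  · rw [epow] at hup
    have : y ^ (1 - σ) * log y / (16 * C2) * (α - σ) ≤ C1 * (y ^ (-σ) * y ^ (1 - σ)) := by
      refine le_trans ?_ (hmv.symm.le.trans hup); gcongr
    have h6 : log y / (16 * C2) * (α - σ) ≤ C1 * y ^ (-σ) := by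
      refine le_of_mul_le_mul_right ?_ hpos1
      calc _ = y ^ (1 - σ) * log y / (16 * C2) * (α - σ) := by ring
        _ ≤ _ := this
        _ = _ := by ring
    calc α - σ = 16 * C2 / log y * (log y / (16 * C2) * (α - σ)) := by field_simp
      _ ≤ 16 * C2 / log y * (C1 * y ^ (-σ)) := by gcongr
      _ = _ := by ring

theorem st9_logzeta_deriv {s y : ℝ} (hs : 0 < s) :
    0 < zetaP s y ∧ HasDerivAt (fun s => log (zetaP s y)) (-(st9_f1 s y)) s := by
  have hpos : ∀ t : ℝ, 0 < t → ∀ p ∈ st9_Pr y, 0 < (1 - (p:ℝ) ^ (-t))⁻¹ := fun t ht p hp => by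
    have := (st9_pw (st9_Pr_ge hp) ht).2.1
    rw [inv_pos]; linarith
  refine ⟨Finset.prod_pos (hpos s hs), ?_⟩
  have he : (fun s => log (zetaP s y)) =ᶠ[𝓝 s] fun s => ∑ p ∈ st9_Pr y, -log (1 - (p:ℝ) ^ (-s)) := by
    filter_upwards [lt_mem_nhds hs] with t ht
    rw [zetaP, log_prod (fun p hp => (hpos t ht p hp).ne')]
    refine Finset.sum_congr rfl fun p hp => log_inv _
  refine HasDerivAt.congr_of_eventuallyEq ?_ he
  rw [st9_f1, ← Finset.sum_neg_distrib]
  apply HasDerivAt.fun_sum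
  intro p hp
  have hp2 := st9_Pr_ge hp
  have hp0 : (0:ℝ) < p := by linarith
  obtain ⟨h1, h2, h3, h4⟩ := st9_pw hp2 hs
  have hd : HasDerivAt (fun s => 1 - (p:ℝ) ^ (-s)) (log p * (p:ℝ) ^ (-s)) s := by
    have := (((hasDerivAt_id s).neg).const_rpow hp0).const_sub 1
    simpa [mul_comm] using this
  refine (hd.log (by linarith)).neg.congr_deriv ?_
  rw [h4]
  have : 1 - (p:ℝ) ^ (-s) ≠ 0 := by linarith
  have : ((p:ℝ) ^ (-s))⁻¹ - 1 ≠ 0 := by rw [← h4]; linarith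
  field_simp

theorem st9_logM_deriv {ρ : ℝ → ℝ} (h : st9_Dk ρ) {s y : ℝ} (hs : s ≤ 1) (hy : 1 ≤ y) :
    0 < rhoHat ρ ((s - 1) * log y) ∧
    HasDerivAt (fun s => log (rhoHat ρ ((s - 1) * log y))) (-(st9_A s y)) s := by
  have hp := st9_rhoHat_ge h (s := (s - 1) * log y)
    (mul_nonpos_of_nonpos_of_nonneg (by linarith) (log_nonneg hy))
  refine ⟨by linarith, ?_⟩
  have hi : HasDerivAt (fun s => (s - 1) * log y) (log y) s := by
    simpa using ((hasDerivAt_id s).sub_const 1).mul_const (log y)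
  have := ((st9_rhoHat_deriv h ((s - 1) * log y)).comp s hi).log (by simp only [Function.comp]; linarith)
  refine this.congr_deriv ?_
  rw [st9_A_w hy]
  have e : ∀ w : ℝ, -((s - 1) * log y * w) = (1 - s) * log y * w := fun w => by ring
  simp only [e, Function.comp]
  field_simp

theorem st9_A_diff {y a b : ℝ} (hy : 1 ≤ y) (hab : a ≤ b) :
    (b - a) * st9_B b y ≤ st9_A a y - st9_A b y ∧ st9_A a y - st9_A b y ≤ (b - a) * st9_B a y := by
  have hpi : ∀ s : ℝ, IntervalIntegrable (fun v : ℝ => v ^ (-s)) volume 1 y := fun s => by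
    apply ContinuousOn.intervalIntegrable
    rw [uIcc_of_le hy]
    exact continuousOn_id.rpow_const fun v hv => Or.inl (by simp only [id]; linarith [hv.1])
  have hli : ∀ s : ℝ, IntervalIntegrable (fun v : ℝ => (b - a) * (log v * v ^ (-s))) volume 1 y := fun s => by
    refine ((hpi s).continuousOn_mul ?_).const_mul _
    rw [uIcc_of_le hy]
    exact continuousOn_id.log fun v hv => by simp only [id]; linarith [hv.1]
  have hpt : ∀ v ∈ Icc 1 y, (b - a) * (log v * v ^ (-b)) ≤ v ^ (-a) - v ^ (-b) ∧
      v ^ (-a) - v ^ (-b) ≤ (b - a) * (log v * v ^ (-a)) := by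
    intro v hv
    have hv0 : 0 < v := by linarith [hv.1]
    have e1 : v ^ (-a) = v ^ (-b) * v ^ (b - a) := by rw [← rpow_add hv0]; ring_nf
    have e2 : v ^ (-b) = v ^ (-a) * v ^ (a - b) := by rw [← rpow_add hv0]; ring_nf
    have h1 := add_one_le_exp (log v * (b - a))
    have h2 := add_one_le_exp (log v * (a - b))
    rw [← rpow_def_of_pos hv0] at h1 h2
    have hb : 0 < v ^ (-b) := by positivity
    have ha : 0 < v ^ (-a) := by positivity
    constructor
    · rw [e1]; nlinarith
    · nlinarith
  unfold st9_A st9_B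
  rw [← intervalIntegral.integral_sub (hpi a) (hpi b), ← intervalIntegral.integral_const_mul,
    ← intervalIntegral.integral_const_mul]
  exact ⟨intervalIntegral.integral_mono_on hy (hli b) ((hpi a).sub (hpi b)) fun v hv => (hpt v hv).1,
    intervalIntegral.integral_mono_on hy ((hpi a).sub (hpi b)) (hli a) fun v hv => (hpt v hv).2⟩

theorem st9_B_diff {y a b : ℝ} (hy : 1 ≤ y) (hab : a ≤ b) :
    0 ≤ st9_B a y - st9_B b y ∧ st9_B a y - st9_B b y ≤ (b - a) * (log y * st9_B a y) := by
  have h0 : ∀ v ∈ Icc 1 y, v ≠ 0 := fun v hv => by linarith [hv.1]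
  have hli : ∀ s : ℝ, IntervalIntegrable (fun v : ℝ => log v * v ^ (-s)) volume 1 y := fun s => by
    apply ContinuousOn.intervalIntegrable
    rw [uIcc_of_le hy]
    exact (continuousOn_id.log h0).mul (continuousOn_id.rpow_const fun v hv => Or.inl (h0 v hv))
  have hpt : ∀ v ∈ Icc 1 y, 0 ≤ log v * v ^ (-a) - log v * v ^ (-b) ∧
      log v * v ^ (-a) - log v * v ^ (-b) ≤ (b - a) * log y * (log v * v ^ (-a)) := by
    intro v hv
    have hv0 : 0 < v := by linarith [hv.1]
    have hl : 0 ≤ log v := log_nonneg hv.1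
    have hly : log v ≤ log y := log_le_log hv0 hv.2
    have e2 : v ^ (-b) = v ^ (-a) * v ^ (a - b) := by rw [← rpow_add hv0]; ring_nf
    have e3 : v ^ (-b) ≤ v ^ (-a) := rpow_le_rpow_of_exponent_le hv.1 (by linarith)
    have h2 := add_one_le_exp (log v * (a - b))
    rw [← rpow_def_of_pos hv0] at h2
    have ha : 0 < v ^ (-a) := by positivity
    refine ⟨by nlinarith, ?_⟩
    have h3 : 1 - v ^ (a - b) ≤ (b - a) * log y := by nlinarith
    calc _ = (log v * v ^ (-a)) * (1 - v ^ (a - b)) := by rw [e2]; ring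
      _ ≤ (log v * v ^ (-a)) * ((b - a) * log y) := by gcongr
      _ = _ := by ring
  have e : (b - a) * (log y * st9_B a y) = (b - a) * log y * st9_B a y := by ring
  rw [e]
  unfold st9_B
  rw [← intervalIntegral.integral_sub (hli a) (hli b), ← intervalIntegral.integral_const_mul]
  exact ⟨intervalIntegral.integral_nonneg hy fun v hv => (hpt v hv).1,
    intervalIntegral.integral_mono_on hy ((hli a).sub (hli b)) ((hli a).const_mul _) fun v hv => (hpt v hv).2⟩
end

section
open Real Filter Topology MeasureTheory Set

set_option maxHeartbeats 1000000 in
theorem st9_Dbounds {ρ : ℝ → ℝ} (hρ : st9_Dk ρ) {η δ K : ℝ} (hη : 0 < η) (hδ : 0 < δ)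
    (hδ1 : δ ≤ 1/4) (hK : st9_th δ K) :
    ∃ y0 c C C' : ℝ, 0 < c ∧ 0 < C ∧ 0 < C' ∧ ∀ y σ α, y0 ≤ y → st9_good η δ σ y → σ ≤ 1/2 - 2 * δ →
      0 < α → st9_f1 α y = st9_A σ y →
      σ < α ∧ st9_good η δ α y ∧ α - σ ≤ C' * (y ^ (-σ) / log y) ∧
      c * y ^ (1 - σ) ≤ y ^ (1 - α) ∧
      c * (log y * y ^ (1 - σ)) ≤ st9_f2 α y ∧ st9_f2 α y ≤ C' * (log y * y ^ (1 - σ)) ∧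
      |st9_f2 α y - st9_B σ y| ≤ C' * (log y * y ^ (1 - 2 * σ)) ∧
      c * (y ^ (1 - 3 * σ) / log y) ≤
        (log (zetaP σ y) + σ * st9_A σ y) - (log (zetaP α y) + α * st9_A σ y) ∧
      (log (zetaP σ y) + σ * st9_A σ y) - (log (zetaP α y) + α * st9_A σ y)
        ≤ C * (y ^ (1 - 3 * σ) / log y) ∧
      c * (y ^ (1 - 3 * σ) / log y) ≤ (α * st9_A σ y + log (rhoHat ρ ((α - 1) * log y)))
        - (σ * st9_A σ y + log (rhoHat ρ ((σ - 1) * log y))) ∧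
      (α * st9_A σ y + log (rhoHat ρ ((α - 1) * log y)))
        - (σ * st9_A σ y + log (rhoHat ρ ((σ - 1) * log y))) ≤ C * (y ^ (1 - 3 * σ) / log y) := by
  obtain ⟨y0, m, M, c, C, hm, hM, hc, hC, H⟩ := st9_alpha hη hδ hδ1 hK
  obtain ⟨C3, hC3, H3⟩ := st9_f2_B hη hδ hδ1 hK
  refine ⟨y0, min m (min (m / 2 * c ^ 2) (m / 4 / 2 * c ^ 2)),
    max (M / 2 * C ^ 2) (2 / 2 * C ^ 2), max (max C M) (C3 + 2 * C), by positivity, by positivity,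
    by positivity, ?_⟩
  intro y σ α hy hg hσ hα hL
  obtain ⟨hlt, hgα, hs, hd1, hd2⟩ := H y σ α hy hg hσ hα hL
  have hy4 := hg.y4
  have hy1 : 1 ≤ y := by linarith
  have hyp : 0 < y := by linarith
  have hY := st9_Y1 hy4
  have hY0 : 0 < log y := by linarith
  have hs0 := hg.s0
  have hσA := st9_A_bounds hy4 hs0.le (by linarith)
  have hσB := st9_AB (s := σ) hy1 (by linarith)
  have hBu : st9_B σ y ≤ 2 * (log y * y ^ (1 - σ)) := by
    have := mul_le_mul_of_nonneg_left hσA.2 hY0.le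
    linarith [hσB.2]
  have hP0 : 0 < y ^ (1 - σ) := by positivity
  have hP2 : 0 < y ^ (1 - 2 * σ) := by positivity
  have hP3 : 0 < y ^ (1 - 3 * σ) := by positivity
  have escale : log y * y ^ (1 - σ) * (y ^ (-σ) / log y) ^ 2 = y ^ (1 - 3 * σ) / log y := by
    rw [show 1 - 3 * σ = (1 - σ) + -σ + -σ by ring, rpow_add hyp, rpow_add hyp]
    field_simp
  have escale2 : (y ^ (-σ) / log y) * (log y * (log y * y ^ (1 - σ))) = log y * y ^ (1 - 2 * σ) := by
    rw [show 1 - 2 * σ = (1 - σ) + -σ by ring, rpow_add hyp]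
    field_simp
  have hq0 : 0 < y ^ (-σ) / log y := by positivity
  have hlow2 : c ^ 2 * (y ^ (-σ) / log y) ^ 2 ≤ (α - σ) ^ 2 := by
    rw [← mul_pow]; gcongr
  have hup2 : (α - σ) ^ 2 ≤ C ^ 2 * (y ^ (-σ) / log y) ^ 2 := by
    rw [← mul_pow]; gcongr
  -- transfer lemma
  have low : ∀ k D : ℝ, 0 ≤ k → k * (log y * y ^ (1 - σ)) / 2 * (α - σ) ^ 2 ≤ D →
      k / 2 * c ^ 2 * (y ^ (1 - 3 * σ) / log y) ≤ D := by
    intro k D hk h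
    refine le_trans ?_ h
    rw [← escale]
    calc _ = k * (log y * y ^ (1 - σ)) / 2 * (c ^ 2 * (y ^ (-σ) / log y) ^ 2) := by ring
      _ ≤ _ := by gcongr
  have up : ∀ k D : ℝ, 0 ≤ k → D ≤ k * (log y * y ^ (1 - σ)) / 2 * (α - σ) ^ 2 →
      D ≤ k / 2 * C ^ 2 * (y ^ (1 - 3 * σ) / log y) := by
    intro k D hk h
    refine le_trans h ?_
    rw [← escale]
    calc _ ≤ k * (log y * y ^ (1 - σ)) / 2 * (C ^ 2 * (y ^ (-σ) / log y) ^ 2) := by gcongr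
      _ = _ := by ring
  have hE0 : 0 ≤ y ^ (1 - 3 * σ) / log y := by positivity
  -- D1
  have q1 := st9_quad (h := fun s => log (zetaP (σ + α - s) y) + (σ + α - s) * st9_A σ y)
    (h' := fun s => st9_f1 (σ + α - s) y - st9_A σ y) (m := m * (log y * y ^ (1 - σ)))
    (M := M * (log y * y ^ (1 - σ))) hlt.le
    (fun s hsm => by
      have hi : HasDerivAt (fun s => σ + α - s) (-1) s := by
        simpa using (hasDerivAt_id s).const_sub (σ + α)
      have e := (st9_logzeta_deriv (y := y) (show 0 < σ + α - s by linarith [hsm.2])).2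
      have e' := (e.comp s hi).add (hi.mul_const (st9_A σ y))
      exact e'.congr_deriv (by ring))
    (fun s hsm => by
      rcases eq_or_lt_of_le hsm.1 with rfl | hlt2
      · simp [hL]
      · obtain ⟨t, ht, hmv⟩ := st9_f1_mv (y := y) (a := σ + α - s) (b := α) (by linarith [hsm.2]) (by linarith)
        obtain ⟨-, g2, g3⟩ := hs t ⟨by linarith [ht.1, hsm.2], ht.2.le⟩
        rw [hL] at hmv
        simp only [hmv]
        have : 0 ≤ s - σ := by linarith
        rw [show α - (σ + α - s) = s - σ by ring]
        constructor <;> gcongr)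
  simp only [add_sub_cancel_right, add_sub_cancel_left] at q1
  -- D2
  have q2 := st9_quad (h := fun s => s * st9_A σ y + log (rhoHat ρ ((s - 1) * log y)))
    (h' := fun s => st9_A σ y - st9_A s y) (m := m / 4 * (log y * y ^ (1 - σ)))
    (M := 2 * (log y * y ^ (1 - σ))) hlt.le
    (fun s hsm => by
      have e := (st9_logM_deriv hρ (s := s) (by linarith [hsm.2, hgα.s1]) hy1).2
      exact (((hasDerivAt_id s).mul_const (st9_A σ y)).add e).congr_deriv (by ring))
    (fun s hsm => by
      obtain ⟨e1, e2⟩ := st9_A_diff (y := y) hy1 hsm.1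
      have hss : 0 ≤ s - σ := by linarith [hsm.1]
      have hs12 : s ≤ 1/2 := by linarith [hsm.2, hgα.s1]
      have e3 := (st9_AB (s := s) hy1 (by linarith)).1
      have e4 := (st9_A_bounds hy4 (show 0 ≤ s by linarith [hsm.1]) hs12).1
      have e5 := (hs s hsm).1
      have e6 : m / 4 * (log y * y ^ (1 - σ)) ≤ st9_B s y := by
        have e7 := mul_le_mul_of_nonneg_left (e5.trans (show _ ≤ 2 * st9_A s y by linarith)) hY0.le
        linarith
      have e8 := mul_le_mul_of_nonneg_right e6 hss
      have e9 := mul_le_mul_of_nonneg_right hBu hss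
      constructor <;> linarith)
  refine ⟨hlt, hgα, hd2.trans ?_, ?_, ?_, ?_, ?_, ?_, ?_, ?_, ?_⟩
  · gcongr; exact (le_max_left _ _).trans (le_max_left _ _)
  · refine le_trans ?_ (hs α ⟨hlt.le, le_rfl⟩).1
    gcongr; exact min_le_left _ _
  · refine le_trans ?_ (hs α ⟨hlt.le, le_rfl⟩).2.1
    gcongr; exact min_le_left _ _
  · refine (hs α ⟨hlt.le, le_rfl⟩).2.2.trans ?_
    gcongr; exact (le_max_right _ _).trans (le_max_left _ _)
  · have e1 := H3 y α hgα
    have e2 := st9_B_diff (y := y) hy1 hlt.le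
    have e3 : y ^ (1 - 2 * α) ≤ y ^ (1 - 2 * σ) := rpow_le_rpow_of_exponent_le hy1 (by linarith)
    have e4 : (α - σ) * (log y * st9_B σ y) ≤ 2 * C * (log y * y ^ (1 - 2 * σ)) := by
      rw [← escale2]
      calc _ ≤ (C * (y ^ (-σ) / log y)) * (log y * (2 * (log y * y ^ (1 - σ)))) := by
            have : 0 ≤ α - σ := by linarith
            have : 0 ≤ st9_B σ y := by linarith [e2.1, hσB.1, mul_nonneg hY0.le (hP0.le.trans (show y ^ (1 - σ) ≤ 2 * st9_A σ y by linarith))]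
            gcongr
        _ = _ := by ring
    have e5 : C3 * (log y * y ^ (1 - 2 * α)) ≤ C3 * (log y * y ^ (1 - 2 * σ)) := by gcongr
    calc _ ≤ (C3 + 2 * C) * (log y * y ^ (1 - 2 * σ)) := by
          rw [abs_le] at e1 ⊢
          constructor <;> linarith [e2.1, e2.2, e1.1, e1.2]
      _ ≤ _ := by gcongr; exact le_max_right _ _
  · refine le_trans ?_ (low m _ hm.le q1.1)
    gcongr; exact (min_le_right _ _).trans (min_le_left _ _)
  · refine (up M _ hM.le q1.2).trans ?_
    gcongr; exact le_max_left _ _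
  · refine le_trans ?_ (low (m/4) _ (by positivity) q2.1)
    gcongr; exact (min_le_right _ _).trans (min_le_right _ _)
  · refine (up 2 _ (by norm_num) q2.2).trans ?_
    gcongr; exact le_max_right _ _
end

section
open Real Filter Topology MeasureTheory Set

/-- box factor -/
noncomputable def st9_bx (h : ℝ) (s : ℂ) : ℂ := (1 - Complex.exp (-(h * s))) / (h * s)

theorem st9_bx_eq {h : ℝ} {s : ℂ} (hz : (h:ℂ) * s ≠ 0) :
    st9_bx h s = ∫ w in (0:ℝ)..1, Complex.exp (-(h * s) * w) := by
  rw [integral_exp_mul_complex (neg_ne_zero.2 hz), st9_bx]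
  simp only [Complex.ofReal_one, mul_one, Complex.ofReal_zero, mul_zero, Complex.exp_zero]
  rw [← neg_sub, div_neg, neg_div]

theorem st9_bx_le {h : ℝ} (hh : 0 < h) {s : ℂ} (hs : 0 < s.re) : ‖st9_bx h s‖ ≤ 1 := by
  have hz : (h:ℂ) * s ≠ 0 := mul_ne_zero (by exact_mod_cast hh.ne') (by rintro rfl; simp at hs)
  rw [st9_bx_eq hz]
  have := intervalIntegral.norm_integral_le_of_norm_le_const (a := 0) (b := 1) (C := 1)
    (f := fun w : ℝ => Complex.exp (-(h * s) * w)) (by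
      intro w hw
      rw [uIoc_of_le zero_le_one] at hw
      rw [Complex.norm_exp]
      apply exp_le_one_iff.2
      simp
      have := hw.1.le
      positivity)
  simpa using this

theorem st9_bx_tail {h : ℝ} (hh : 0 < h) {s : ℂ} (hs : 0 < s.re) : ‖st9_bx h s‖ ≤ 2 / (h * ‖s‖) := by
  rw [st9_bx, norm_div, norm_mul, Complex.norm_real, norm_eq_abs, abs_of_pos hh]
  have : 0 < ‖s‖ := norm_pos_iff.2 (by rintro rfl; simp at hs)
  gcongr
  refine (norm_sub_le _ _).trans ?_
  rw [norm_one, Complex.norm_exp]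
  have : rexp (-(h * s)).re ≤ 1 := by
    apply exp_le_one_iff.2
    simp
    positivity
  linarith

theorem st9_bx_one {h : ℝ} (hh : 0 < h) {s : ℂ} (hs : 0 < s.re) (h1 : h * ‖s‖ ≤ 1) :
    ‖st9_bx h s - 1‖ ≤ 2 * (h * ‖s‖) := by
  have hz : (h:ℂ) * s ≠ 0 := mul_ne_zero (by exact_mod_cast hh.ne') (by rintro rfl; simp at hs)
  have e : st9_bx h s - 1 = ∫ w in (0:ℝ)..1, (Complex.exp (-(h * s) * w) - 1) := by
    rw [st9_bx_eq hz, intervalIntegral.integral_sub (Continuous.intervalIntegrable (by fun_prop) _ _) (by simp)]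
    simp
  rw [e]
  have := intervalIntegral.norm_integral_le_of_norm_le_const (a := 0) (b := 1) (C := 2 * (h * ‖s‖))
    (f := fun w : ℝ => Complex.exp (-(h * s) * w) - 1) (by
      intro w hw
      rw [uIoc_of_le zero_le_one] at hw
      have hn : ‖-((h:ℂ) * s) * w‖ ≤ h * ‖s‖ := by
        rw [norm_mul, norm_neg, norm_mul, Complex.norm_real, Complex.norm_real, norm_eq_abs,
          norm_eq_abs, abs_of_pos hh, abs_of_pos hw.1]
        have : 0 ≤ h * ‖s‖ := by positivity
        nlinarith [hw.2]
      refine (Complex.norm_exp_sub_one_le (hn.trans h1)).trans ?_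
      linarith)
  simpa using this

/-- smoothed Perron kernel on the line `Re s = c` -/
noncomputable def st9_K (h : ℝ) (k : ℕ) (s : ℂ) : ℂ := 1 / s * st9_bx h s ^ k

theorem st9_line_re (c t : ℝ) : (c + t * Complex.I : ℂ).re = c := by simp

theorem st9_K_cont {h c : ℝ} (hh : 0 < h) (hc : 0 < c) (k : ℕ) :
    Continuous (fun t : ℝ => st9_K h k (c + t * Complex.I)) := by
  have hne := fun t => st9_line_ne hc t
  have h0 : (h:ℂ) ≠ 0 := by exact_mod_cast hh.ne'
  unfold st9_K st9_bx
  refine Continuous.mul (Continuous.div (by fun_prop) (by fun_prop) hne)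
    (Continuous.pow (Continuous.div (by fun_prop) (by fun_prop) fun t => mul_ne_zero h0 (hne t)) k)

theorem st9_K_le {h c : ℝ} (hh : 0 < h) (hc : 0 < c) (k : ℕ) (t : ℝ) :
    ‖st9_K h (k+1) (c + t * Complex.I)‖ ≤ 2 / h * ‖1 / (c + t * Complex.I : ℂ) ^ 2‖ := by
  have hre : 0 < (c + t * Complex.I : ℂ).re := by rwa [st9_line_re]
  have h0 : 0 < ‖(c + t * Complex.I : ℂ)‖ := norm_pos_iff.2 (st9_line_ne hc t)
  unfold st9_K
  rw [norm_mul, norm_pow, pow_succ, norm_div, norm_one, norm_div, norm_one, norm_pow]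
  calc _ ≤ 1 / ‖(c + t * Complex.I : ℂ)‖ * (1 * (2 / (h * ‖(c + t * Complex.I : ℂ)‖))) := by
        gcongr
        · exact pow_le_one₀ (norm_nonneg _) (st9_bx_le hh hre)
        · exact st9_bx_tail hh hre
    _ = _ := by field_simp

theorem st9_K_int {h c : ℝ} (hh : 0 < h) (hc : 0 < c) (k : ℕ) :
    Integrable (fun t : ℝ => st9_K h (k+1) (c + t * Complex.I)) :=
  Integrable.mono' ((st9_integrable_line_sq hc).norm.const_mul (2 / h))
    (st9_K_cont hh hc _).aestronglyMeasurable (Eventually.of_forall fun t => st9_K_le hh hc k t)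

theorem st9_expK_int {h c : ℝ} (hh : 0 < h) (hc : 0 < c) (k : ℕ) (v : ℝ) :
    Integrable (fun t : ℝ => Complex.exp ((c + t * Complex.I) * v) * st9_K h (k+1) (c + t * Complex.I)) := by
  refine (st9_K_int hh hc k).bdd_mul (c := exp (c * v)) (by fun_prop) (Eventually.of_forall fun t => ?_)
  rw [Complex.norm_exp]; simp

theorem st9_W {h c : ℝ} (hh : 0 < h) (hc : 0 < c) (k : ℕ) : ∃ W : ℝ → ℝ, Continuous W ∧
    (∀ v, 0 ≤ W v ∧ W v ≤ 1) ∧ (∀ v, v ≤ 0 → W v = 0) ∧ (∀ v, (k + 1) * h ≤ v → W v = 1) ∧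
    ∀ v : ℝ, (W v : ℂ) = 1 / (2 * π) * ∫ t : ℝ, Complex.exp ((c + t * Complex.I) * v) *
      st9_K h (k+1) (c + t * Complex.I) := by
  have h0 : (h:ℂ) ≠ 0 := by exact_mod_cast hh.ne'
  induction k with
  | zero =>
    refine ⟨fun v => (max v 0 - max (v - h) 0) / h, by fun_prop, fun v => ?_, fun v hv => ?_,
      fun v hv => ?_, fun v => ?_⟩
    · constructor
      · apply div_nonneg _ hh.le
        rw [sub_nonneg]; exact max_le_max (by linarith) le_rfl
      · rw [div_le_one hh, sub_le_iff_le_add]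
        apply max_le
        · linarith [le_max_left (v - h) 0]
        · linarith [le_max_right (v - h) 0]
    · simp only [max_eq_right hv, max_eq_right (show v - h ≤ 0 by linarith)]; simp
    · simp only [CharP.cast_eq_zero, zero_add, one_mul] at hv
      simp only [max_eq_left (show 0 ≤ v by linarith), max_eq_left (show 0 ≤ v - h by linarith)]
      field_simp; ring
    · push_cast
      have e1 := st9_perron hc v
      have e2 := st9_perron hc (v - h)
      push_cast at e1 e2
      rw [e1, e2, ← mul_sub, ← integral_sub, mul_div_assoc, ← integral_div]
      · congr 2; ext t
        have hne := st9_line_ne hc t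
        unfold st9_K st9_bx
        rw [mul_sub (_ + _) (v:ℂ) (h:ℂ), sub_eq_add_neg ((_ + _) * (v:ℂ)), Complex.exp_add,
          mul_comm (_ + _) (h:ℂ)]
        field_simp
      · exact (st9_integrable_line_sq hc).mul_bdd (c := exp (c * v)) (by fun_prop)
          (Eventually.of_forall fun t => by rw [Complex.norm_exp]; simp)
      · exact (st9_integrable_line_sq hc).mul_bdd (c := exp (c * (v - h))) (by fun_prop)
          (Eventually.of_forall fun t => by rw [Complex.norm_exp]; simp)
  | succ k ih =>
    obtain ⟨W, hWc, hW01, hW0, hW1, hWf⟩ := ih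
    have hWi : ∀ a b, IntervalIntegrable W volume a b := fun a b => hWc.intervalIntegrable a b
    refine ⟨fun v => (∫ w in (v - h)..v, W w) / h, ?_, fun v => ?_, fun v hv => ?_,
      fun v hv => ?_, fun v => ?_⟩
    · have : (fun v => (∫ w in (v - h)..v, W w) / h)
          = fun v => ((∫ w in (0:ℝ)..v, W w) - ∫ w in (0:ℝ)..(v - h), W w) / h := by
        ext v
        rw [intervalIntegral.integral_interval_sub_left (hWi _ _) (hWi _ _)]
      rw [this]
      have hp := intervalIntegral.continuous_primitive (μ := volume) hWi 0
      exact ((hp.sub (hp.comp (by fun_prop : Continuous fun v : ℝ => v - h))).div_const h)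
    · constructor
      · exact div_nonneg (intervalIntegral.integral_nonneg (by linarith) fun w _ => (hW01 w).1) hh.le
      · rw [div_le_one hh]
        have := intervalIntegral.integral_mono_on (a := v - h) (b := v) (by linarith) (hWi _ _)
          (intervalIntegrable_const (c := (1:ℝ))) fun w _ => (hW01 w).2
        simpa using this
    · have : ∫ w in (v - h)..v, W w = ∫ w in (v - h)..v, (0:ℝ) := by
        apply intervalIntegral.integral_congr
        intro w hw
        rw [uIcc_of_le (by linarith)] at hw
        exact hW0 w (hw.2.trans hv)
      simp [this]
    · have : ∫ w in (v - h)..v, W w = ∫ w in (v - h)..v, (1:ℝ) := by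
        apply intervalIntegral.integral_congr
        intro w hw
        rw [uIcc_of_le (by linarith)] at hw
        push_cast at hv
        exact hW1 w (by linarith [hw.1])
      simp [this, hh.ne']
    · push_cast
      rw [← intervalIntegral.integral_ofReal]
      simp only [hWf]
      rw [intervalIntegral.integral_const_mul, mul_div_assoc]
      congr 1
      rw [intervalIntegral_integral_swap]
      · rw [← integral_div]
        congr 1; ext t
        have hne := st9_line_ne hc t
        rw [intervalIntegral.integral_mul_const, integral_exp_mul_complex hne]
        rw [st9_K, st9_K, pow_succ _ (k+1)]
        nth_rewrite 3 [st9_bx]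
        push_cast
        rw [mul_sub (_ + _) (v:ℂ) (h:ℂ), sub_eq_add_neg ((_ + _) * (v:ℂ)), Complex.exp_add,
          mul_comm (_ + _) (h:ℂ)]
        field_simp
      · have hfin : IsFiniteMeasure (volume.restrict (uIoc (v - h) v)) :=
          ⟨by rw [Measure.restrict_apply_univ]; simp [uIoc, Real.volume_Ioc]⟩
        have hg : Integrable (fun z : ℝ × ℝ => exp (c * v) * ‖st9_K h (k+1) (c + z.2 * Complex.I)‖)
            ((volume.restrict (uIoc (v - h) v)).prod volume) := by
          have := ((st9_K_int hh hc k).norm).comp_snd (volume.restrict (uIoc (v - h) v))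
          exact this.const_mul _
        refine Integrable.mono' hg ?_ ?_
        · apply Continuous.aestronglyMeasurable
          have := (st9_K_cont hh hc (k+1)).comp (continuous_snd : Continuous (Prod.snd : ℝ × ℝ → ℝ))
          unfold Function.uncurry
          refine Continuous.mul (by fun_prop) this
        · rw [← Measure.restrict_univ (μ := (volume : Measure ℝ)), Measure.restrict_restrict measurableSet_uIoc,
            inter_univ, Measure.prod_restrict]
          refine ae_restrict_of_forall_mem (measurableSet_uIoc.prod MeasurableSet.univ) ?_
          rintro ⟨w, t⟩ ⟨hw, -⟩
          rw [uIoc_of_le (by linarith)] at hw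
          simp only [Function.uncurry]
          rw [norm_mul, Complex.norm_exp]
          have e : ((c + t * Complex.I : ℂ) * w).re = c * w := by simp
          rw [e]
          gcongr
          exact hw.2
end

section
open Real Filter Topology MeasureTheory Set

noncomputable def st9_zC (s : ℂ) (y : ℝ) : ℂ := ∏ p ∈ st9_Pr y, (1 - (p:ℂ) ^ (-s))⁻¹

theorem st9_zC_sum {y : ℝ} {s : ℂ} (hs : 0 < s.re) :
    Summable (fun m : (⌊y⌋₊+1).smoothNumbers ↦ ‖((m:ℕ):ℂ) ^ (-s)‖) ∧
      HasSum (fun m : (⌊y⌋₊+1).smoothNumbers ↦ ((m:ℕ):ℂ) ^ (-s)) (st9_zC s y) := by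
  have h0 : s ≠ 0 := by rintro rfl; simp at hs
  have := EulerProduct.summable_and_hasSum_smoothNumbers_prod_primesBelow_geometric
    (f := (riemannZetaSummandHom h0 : ℕ →* ℂ)) (by
      intro p hp
      change ‖(p:ℂ) ^ (-s)‖ < 1
      rw [Complex.norm_natCast_cpow_of_pos hp.pos, Complex.neg_re]
      exact rpow_lt_one_of_one_lt_of_neg (by exact_mod_cast hp.one_lt) (by linarith)) (⌊y⌋₊+1)
  exact this

theorem st9_swap {h c y : ℝ} (hh : 0 < h) (hc : 0 < c) (k : ℕ) (W : ℝ → ℝ)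
    (hW : ∀ v : ℝ, (W v : ℂ) = 1 / (2 * π) * ∫ t : ℝ, Complex.exp ((c + t * Complex.I) * v) *
      st9_K h (k+1) (c + t * Complex.I)) (X : ℝ) :
    ((∑' m : (⌊y⌋₊+1).smoothNumbers, W (X - log (m:ℕ)) : ℝ) : ℂ) =
    1 / (2 * π) * ∫ t : ℝ, Complex.exp ((c + t * Complex.I) * X) * (st9_zC (c + t * Complex.I) y *
      st9_K h (k+1) (c + t * Complex.I)) := by
  rw [Complex.ofReal_tsum]
  simp only [hW]
  rw [tsum_mul_left]
  congr 1
  set F : (⌊y⌋₊+1).smoothNumbers → ℝ → ℂ := fun m t => Complex.exp ((c + t * Complex.I) * (X - log (m:ℕ) : ℝ)) *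
      st9_K h (k+1) (c + t * Complex.I) with hF
  have hm : ∀ m : (⌊y⌋₊+1).smoothNumbers, (0:ℝ) < (m:ℕ) := fun m => by
    have := Nat.ne_zero_of_mem_smoothNumbers m.2
    positivity
  have hFe : ∀ m t, F m t = (((m:ℕ):ℂ) ^ (-(c + t * Complex.I) : ℂ)) * (Complex.exp ((c + t * Complex.I) * X) *
      st9_K h (k+1) (c + t * Complex.I)) := by
    intro m t
    have : ((m:ℕ):ℂ) ≠ 0 := by exact_mod_cast (hm m).ne'
    rw [hF, Complex.cpow_def_of_ne_zero this, ← mul_assoc, ← Complex.exp_add, ← Complex.natCast_log]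
    push_cast
    ring_nf
  have hFn : ∀ m t, ‖F m t‖ = ‖((m:ℕ):ℂ) ^ (-(c:ℂ))‖ * (exp (c * X) * ‖st9_K h (k+1) (c + t * Complex.I)‖) := by
    intro m t
    rw [hFe, norm_mul, norm_mul, Complex.norm_exp]
    have hm' : 0 < (m:ℕ) := by exact_mod_cast hm m
    rw [Complex.norm_natCast_cpow_of_pos hm', Complex.norm_natCast_cpow_of_pos hm']
    simp
  have hFi : ∀ m, Integrable (F m) := fun m => st9_expK_int hh hc k _
  have hFs : Summable fun m => ∫ t, ‖F m t‖ := by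
    simp_rw [hFn, integral_const_mul]
    exact ((st9_zC_sum (s := (c:ℂ)) (by simpa using hc)).1).mul_right _
  refine (integral_tsum_of_summable_integral_norm hFi hFs).trans ?_
  congr 1; ext t
  simp only [hFe]
  rw [tsum_mul_right, (st9_zC_sum (s := (c + t * Complex.I : ℂ)) (by simpa using hc)).2.tsum_eq]
  ring

theorem st9_sand {h c x y : ℝ} (hh : 0 < h) (hc : 0 < c) (hx : 0 < x) (hy : 0 ≤ y) (k : ℕ) : ∃ lo hi : ℝ,
    lo ≤ Psi x y ∧ Psi x y ≤ hi ∧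
    (lo : ℂ) = 1 / (2 * π) * ∫ t : ℝ, Complex.exp ((c + t * Complex.I) * log x) *
      (st9_zC (c + t * Complex.I) y * st9_K h (k+1) (c + t * Complex.I)) ∧
    (hi : ℂ) = 1 / (2 * π) * ∫ t : ℝ, Complex.exp ((c + t * Complex.I) * (log x + (k+1) * h : ℝ)) *
      (st9_zC (c + t * Complex.I) y * st9_K h (k+1) (c + t * Complex.I)) := by
  obtain ⟨W, hWc, hW01, hW0, hW1, hWf⟩ := st9_W hh hc k
  refine ⟨_, _, ?_, ?_, st9_swap hh hc k W hWf _, st9_swap hh hc k W hWf _⟩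
  all_goals
    have hm : ∀ m : (⌊y⌋₊+1).smoothNumbers, (0:ℝ) < (m:ℕ) := fun m => by
      have := Nat.ne_zero_of_mem_smoothNumbers m.2
      positivity
    have hsm := (st9_zC_sum (s := (c:ℂ)) (y := y) (by simpa using hc)).1
    have hWs : ∀ X, Summable fun m : (⌊y⌋₊+1).smoothNumbers => W (X - log (m:ℕ)) := by
      intro X
      refine Summable.of_nonneg_of_le (fun m => (hW01 _).1) (fun m => ?_) (hsm.mul_left (exp (c * X)))
      have hm' : 0 < (m:ℕ) := by exact_mod_cast hm m
      rw [Complex.norm_natCast_cpow_of_pos hm', rpow_def_of_pos (hm m), ← exp_add]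
      simp only [Complex.neg_re, Complex.ofReal_re]
      rcases le_total (X - log (m:ℕ)) 0 with h' | h'
      · rw [hW0 _ h']; positivity
      · refine (hW01 _).2.trans (one_le_exp ?_)
        have := mul_nonneg hc.le h'
        linarith
    set T : Set ℕ := {n | 1 ≤ n ∧ (n:ℝ) ≤ x ∧ ∀ p : ℕ, p.Prime → p ∣ n → (p:ℝ) ≤ y} with hT
    have hTf : T.Finite := (Set.finite_Icc 0 ⌊x⌋₊).subset fun n hn => ⟨n.zero_le, Nat.le_floor hn.2.1⟩
    have hTS : ∀ n : ℕ, n ∈ T ↔ n ∈ (⌊y⌋₊+1).smoothNumbers ∧ (n:ℝ) ≤ x := by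
      intro n
      refine ⟨fun ⟨h1, h2, h3⟩ => ⟨Nat.mem_smoothNumbers'.2 fun p hp hpn =>
        Nat.lt_succ_of_le (Nat.le_floor (h3 p hp hpn)), h2⟩, fun ⟨h1, h2⟩ =>
        ⟨Nat.pos_of_ne_zero (Nat.ne_zero_of_mem_smoothNumbers h1), h2, fun p hp hpn =>
        (Nat.le_floor_iff hy).1 (Nat.le_of_lt_succ (Nat.mem_smoothNumbers'.1 h1 p hp hpn))⟩⟩
    have hind : HasSum (fun m : (⌊y⌋₊+1).smoothNumbers => T.indicator (fun _ => (1:ℝ)) (m:ℕ)) (Psi x y) := by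
      rw [← Function.comp_def, hasSum_subtype_iff_indicator]
      have : Psi x y = ∑ n ∈ hTf.toFinset, ((⌊y⌋₊+1).smoothNumbers.indicator (T.indicator (fun _ => (1:ℝ)))) n := by
        rw [Finset.sum_congr rfl (g := fun _ => (1:ℝ))]
        · rw [Finset.sum_const, nsmul_eq_mul, mul_one, ← ncard_eq_toFinset_card _ hTf]; rfl
        · intro n hn
          have hn' : n ∈ T := by simpa using hn
          rw [indicator_of_mem ((hTS n).1 hn').1, indicator_of_mem hn']
      rw [this]
      apply hasSum_sum_of_ne_finset_zero
      intro n hn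
      have hn' : n ∉ T := by simpa using hn
      simp [indicator, hn']
    rw [← hind.tsum_eq]
  · refine (hWs _).tsum_le_tsum (fun m => ?_) hind.summable
    by_cases hm1 : (m:ℕ) ∈ T
    · rw [indicator_of_mem hm1]; exact (hW01 _).2
    · rw [indicator_of_notMem hm1, hW0]
      have : x < (m:ℕ) := by
        by_contra h'
        exact hm1 ((hTS m).2 ⟨m.2, not_lt.1 h'⟩)
      linarith [log_le_log hx this.le]
  · refine hind.summable.tsum_le_tsum (fun m => ?_) (hWs _)
    by_cases hm1 : (m:ℕ) ∈ T
    · rw [indicator_of_mem hm1, hW1]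
      linarith [log_le_log (hm m) hm1.2.1]
    · rw [indicator_of_notMem hm1]; exact (hW01 _).1
end

section
open Real Filter Topology MeasureTheory Set

noncomputable def st9_E (q θ : ℝ) : ℂ := Complex.log (1 - q) - Complex.log (1 - q * Complex.exp (-(θ * Complex.I)))
  + Complex.I * (θ * (q / (1 - q)) : ℝ)

theorem st9_qe (q θ : ℝ) (h0 : 0 ≤ q) : ‖(q:ℂ) * Complex.exp (-(θ * Complex.I))‖ = q := by
  rw [norm_mul, Complex.norm_exp, Complex.norm_real]; simp [abs_of_nonneg h0]

theorem st9_neglog {z : ℂ} (hz : ‖z‖ < 1) :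
    HasSum (fun n : ℕ => z ^ (n+1) / (n+1 : ℕ)) (-Complex.log (1 - z)) := by
  have := (hasSum_nat_add_iff' 1).2 (Complex.hasSum_taylorSeries_neg_log hz)
  simpa using this

theorem st9_E_exp {q : ℝ} (h0 : 0 < q) (h1 : q < 1) (θ : ℝ) : Complex.exp (st9_E q θ) =
    (1 - q) * (1 - q * Complex.exp (-(θ * Complex.I)))⁻¹ * Complex.exp (Complex.I * (θ * (q / (1 - q)) : ℝ)) := by
  have n1 : (1 - q : ℂ) ≠ 0 := by
    have : (1 - q : ℝ) ≠ 0 := by linarith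
    exact_mod_cast this
  have n2 : (1 - q * Complex.exp (-(θ * Complex.I)) : ℂ) ≠ 0 := by
    intro h
    have := st9_qe q θ h0.le
    rw [← sub_eq_zero.1 h, norm_one] at this
    linarith
  rw [st9_E, Complex.exp_add, Complex.exp_sub, Complex.exp_log n1, Complex.exp_log n2, div_eq_mul_inv]

theorem st9_E_sum {q : ℝ} (h0 : 0 < q) (h1 : q < 1) (θ : ℝ) :
    HasSum (fun n : ℕ => ((q ^ (n+1) / (n+1 : ℕ) : ℝ) : ℂ) * (Complex.exp (-(((n+1 : ℕ) * θ : ℝ) * Complex.I)) - 1 +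
      ((n+1 : ℕ) * θ : ℝ) * Complex.I)) (st9_E q θ) := by
  have a1 := st9_neglog (z := (q:ℂ) * Complex.exp (-(θ * Complex.I))) (by rw [st9_qe q θ h0.le]; exact h1)
  have a2 := st9_neglog (z := (q:ℂ)) (by rw [Complex.norm_real, norm_of_nonneg h0.le]; exact h1)
  have a3 := ((hasSum_geometric_of_lt_one h0.le h1).mul_left (θ * q))
  have a4 := Complex.hasSum_ofReal.2 a3
  have := (a1.sub a2).add (a4.mul_left Complex.I)
  have eE : st9_E q θ = -Complex.log (1 - q * Complex.exp (-(θ * Complex.I))) - -Complex.log (1 - q) +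
      Complex.I * (θ * q * (1 - q)⁻¹ : ℝ) := by rw [st9_E]; push_cast; ring
  rw [eE]
  refine this.congr_fun ?_
  · intro n
    rw [mul_pow, ← Complex.exp_nat_mul]
    have : ((n+1 : ℕ):ℂ) ≠ 0 := Nat.cast_ne_zero.2 n.succ_ne_zero
    have e : (-(((n+1 : ℕ) * θ : ℝ) * Complex.I) : ℂ) = ((n+1 : ℕ):ℂ) * -(θ * Complex.I) := by push_cast; ring
    rw [e]
    push_cast at this ⊢
    field_simp
    ring

theorem st9_E_re {q : ℝ} (h0 : 0 < q) (h1 : q < 1) (θ : ℝ) : (st9_E q θ).re ≤ -(q * (1 - cos θ)) := by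
  have hs := Complex.hasSum_re (st9_E_sum h0 h1 θ)
  have e : ∀ n : ℕ, (((q ^ (n+1) / (n+1 : ℕ) : ℝ) : ℂ) * (Complex.exp (-(((n+1 : ℕ) * θ : ℝ) * Complex.I)) - 1 +
      ((n+1 : ℕ) * θ : ℝ) * Complex.I)).re = -(q ^ (n+1) / (n+1 : ℕ) * (1 - cos ((n+1 : ℕ) * θ))) := by
    intro n
    rw [Complex.re_ofReal_mul, Complex.add_re, Complex.sub_re, Complex.exp_re]
    simp [-Nat.cast_add, -Complex.ofReal_mul]
    ring
  simp only [e] at hs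
  have := hs.neg
  simp only [neg_neg] at this
  have h2 := le_hasSum this 0 (fun n _ => mul_nonneg (by positivity) (by linarith [cos_le_one ((n+1 : ℕ) * θ)]))
  simp at h2
  linarith

theorem st9_E_taylor {q : ℝ} (h0 : 0 < q) (h1 : q < 1) : ∃ b : ℝ, |b| ≤ q / (1 - q) ^ 3 ∧ ∀ θ : ℝ,
    ‖st9_E q θ + (θ ^ 2 / 2 * (q / (1 - q) ^ 2) : ℝ) - Complex.I * (b * θ ^ 3 : ℝ)‖ ≤ 24 * (θ ^ 4 * (q / (1 - q) ^ 4)) := by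
  have hq : ‖q‖ < 1 := by rwa [norm_of_nonneg h0.le]
  have g1 : HasSum (fun n : ℕ => (n + 1 : ℕ) * q ^ (n+1)) (q / (1 - q) ^ 2) := by
    have := (hasSum_nat_add_iff' (f := fun n : ℕ => (n:ℝ) * q ^ n) 1).2 (hasSum_coe_mul_geometric_of_norm_lt_one hq)
    simpa using this
  have g2 := (hasSum_choose_mul_geometric_of_norm_lt_one 2 hq).mul_left (2 * q)
  have g3 := (hasSum_choose_mul_geometric_of_norm_lt_one 3 hq).mul_left (6 * q)
  have c2 : ∀ n : ℕ, ((n+2).choose 2 : ℝ) * 2 = (n+2) * (n+1) := by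
    intro n
    induction n with
    | zero => norm_num
    | succ n ih =>
      rw [show n + 1 + 2 = (n + 2) + 1 by ring, Nat.choose_succ_succ, Nat.choose_one_right]
      push_cast at ih ⊢; linarith
  have c3 : ∀ n : ℕ, ((n+3).choose 3 : ℝ) * 6 = (n+3) * (n+2) * (n+1) := by
    intro n
    induction n with
    | zero => norm_num [Nat.choose]
    | succ n ih =>
      rw [show n + 1 + 3 = (n + 3) + 1 by ring, Nat.choose_succ_succ]
      have := c2 (n+1)
      rw [show n + 1 + 2 = n + 3 by ring] at this
      push_cast at ih this ⊢; linarith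
  have b2 : ∀ n : ℕ, ((n+1 : ℕ):ℝ) ^ 2 * q ^ (n+1) ≤ 2 * q * (((n+2).choose 2 : ℝ) * q ^ n) := by
    intro n
    have := c2 n
    have hp : 0 < q * q ^ n := by positivity
    have hn : (0:ℝ) ≤ n := by positivity
    have : ((n+1 : ℕ):ℝ) ^ 2 ≤ ((n+2).choose 2 : ℝ) * 2 := by rw [this]; push_cast; nlinarith
    calc _ = ((n+1 : ℕ):ℝ) ^ 2 * (q * q ^ n) := by ring
      _ ≤ _ := mul_le_mul_of_nonneg_right this hp.le
      _ = _ := by ring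
  have b3 : ∀ n : ℕ, ((n+1 : ℕ):ℝ) ^ 3 * q ^ (n+1) ≤ 6 * q * (((n+3).choose 3 : ℝ) * q ^ n) := by
    intro n
    have := c3 n
    have hp : 0 < q * q ^ n := by positivity
    have hn : (0:ℝ) ≤ n := by positivity
    have : ((n+1 : ℕ):ℝ) ^ 3 ≤ ((n+3).choose 3 : ℝ) * 6 := by
      rw [this]; push_cast
      have : 0 ≤ (n:ℝ) ^ 2 := by positivity
      have : 0 ≤ (n:ℝ) ^ 3 := by positivity
      nlinarith
    calc _ = ((n+1 : ℕ):ℝ) ^ 3 * (q * q ^ n) := by ring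
      _ ≤ _ := mul_le_mul_of_nonneg_right this hp.le
      _ = _ := by ring
  have s2 : Summable (fun n : ℕ => ((n+1 : ℕ):ℝ) ^ 2 * q ^ (n+1)) :=
    Summable.of_nonneg_of_le (fun n => by positivity) b2 g2.summable
  have s3 : Summable (fun n : ℕ => ((n+1 : ℕ):ℝ) ^ 3 * q ^ (n+1)) :=
    Summable.of_nonneg_of_le (fun n => by positivity) b3 g3.summable
  have t2 := s2.tsum_le_tsum b2 g2.summable
  have t3 := s3.tsum_le_tsum b3 g3.summable
  rw [g2.tsum_eq] at t2
  rw [g3.tsum_eq] at t3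
  have h1q : 0 < 1 - q := by linarith
  have p2 : 0 ≤ ∑' n : ℕ, ((n+1 : ℕ):ℝ) ^ 2 * q ^ (n+1) := tsum_nonneg fun n => by positivity
  refine ⟨(∑' n : ℕ, ((n+1 : ℕ):ℝ) ^ 2 * q ^ (n+1)) / 6, ?_, fun θ => ?_⟩
  · rw [abs_of_nonneg (by positivity)]
    have e : 2 * q * (1 / (1 - q) ^ (2 + 1)) = 2 * (q / (1 - q) ^ 3) := by ring
    have : 0 ≤ q / (1 - q) ^ 3 := by positivity
    linarith
  · have hE := st9_E_sum h0 h1 θ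
    have k1 := Complex.hasSum_ofReal.2 (g1.mul_left (θ ^ 2 / 2))
    have k2 := Complex.hasSum_ofReal.2 (s2.hasSum.mul_left (θ ^ 3 / 6))
    have k := (hE.add k1).sub (k2.mul_left Complex.I)
    have e : (st9_E q θ + (θ ^ 2 / 2 * (q / (1 - q) ^ 2) : ℝ) - Complex.I * ((∑' n : ℕ, ((n+1 : ℕ):ℝ) ^ 2 * q ^ (n+1)) / 6 * θ ^ 3 : ℝ))
      = st9_E q θ + (θ ^ 2 / 2 * (q / (1 - q) ^ 2) : ℝ) - Complex.I * (θ ^ 3 / 6 * (∑' n : ℕ, ((n+1 : ℕ):ℝ) ^ 2 * q ^ (n+1)) : ℝ) := by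
      congr 3; ring
    rw [e, ← k.tsum_eq]
    refine (tsum_of_norm_bounded (s3.hasSum.mul_left (4 * θ ^ 4)) fun n => ?_).trans ?_
    · have hm : (0:ℝ) < (n+1 : ℕ) := by positivity
      generalize ((n+1 : ℕ):ℝ) = m at hm
      have h4 := st9_exp4 (m * θ)
      have e : ((q ^ (n+1) / m : ℝ) : ℂ) * (Complex.exp (-((m * θ : ℝ) * Complex.I)) - 1 +
          (m * θ : ℝ) * Complex.I) + (θ ^ 2 / 2 * (m * q ^ (n+1)) : ℝ) - Complex.I * (θ ^ 3 / 6 * (m ^ 2 * q ^ (n+1)) : ℝ)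
          = ((q ^ (n+1) / m : ℝ) : ℂ) * (Complex.exp (-((m * θ : ℝ) * Complex.I)) - 1 +
          (m * θ : ℝ) * Complex.I + (((m * θ) ^ 2 / 2 : ℝ) : ℂ) - Complex.I * (((m * θ) ^ 3 / 6 : ℝ) : ℂ)) := by
        have : (m:ℂ) ≠ 0 := by exact_mod_cast hm.ne'
        push_cast
        field_simp
      rw [e, norm_mul, Complex.norm_real, norm_of_nonneg (by positivity)]
      calc _ ≤ q ^ (n+1) / m * (4 * (m * θ) ^ 4) := by gcongr
        _ = _ := by field_simp
    · have : 0 ≤ 4 * θ ^ 4 := by positivity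
      refine (mul_le_mul_of_nonneg_left t3 this).trans (le_of_eq (by ring))

theorem st9_R_eq {α y : ℝ} (hα : 0 < α) (t X : ℝ) :
    Complex.exp ((α + t * Complex.I) * (st9_f1 α y + X : ℝ)) * st9_zC (α + t * Complex.I) y =
    (exp (α * st9_f1 α y) * zetaP α y : ℝ) * (Complex.exp (∑ p ∈ st9_Pr y, st9_E ((p:ℝ) ^ (-α)) (t * log p)) *
      Complex.exp ((α + t * Complex.I) * X)) := by
  have e1 : Complex.exp (∑ p ∈ st9_Pr y, st9_E ((p:ℝ) ^ (-α)) (t * log p)) * zetaP α y =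
      Complex.exp (t * Complex.I * (st9_f1 α y : ℝ)) * st9_zC (α + t * Complex.I) y := by
    rw [Complex.exp_sum, st9_f1, zetaP, st9_zC, Complex.ofReal_sum, Finset.mul_sum, Complex.exp_sum, Complex.ofReal_prod,
      ← Finset.prod_mul_distrib, ← Finset.prod_mul_distrib]
    refine Finset.prod_congr rfl fun p hp => ?_
    have hp2 := st9_Pr_ge hp
    obtain ⟨a1, a2, a3, a4⟩ := st9_pw hp2 hα
    rw [st9_E_exp a1 a2]
    have hp0 : (p:ℂ) ≠ 0 := by
      have : (p:ℝ) ≠ 0 := by linarith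
      exact_mod_cast this
    have e2 : (p:ℂ) ^ (-(α + t * Complex.I) : ℂ) = ((p:ℝ) ^ (-α) : ℝ) * Complex.exp (-((t * log p : ℝ) * Complex.I)) := by
      rw [neg_add, Complex.cpow_add _ _ hp0, Complex.ofReal_cpow (by linarith), Complex.cpow_def_of_ne_zero hp0 (-(t * Complex.I)),
        ← Complex.natCast_log]
      push_cast; ring_nf
    have e3 : Complex.I * ((t * log p * ((p:ℝ) ^ (-α) / (1 - (p:ℝ) ^ (-α))) : ℝ):ℂ) = t * Complex.I * ((log p / ((p:ℝ) ^ α - 1) : ℝ):ℂ) := by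
      have : log p / ((p:ℝ) ^ α - 1) = log p * ((p:ℝ) ^ (-α) / (1 - (p:ℝ) ^ (-α))) := by
        rw [a4]
        have : 1 - (p:ℝ) ^ (-α) ≠ 0 := by linarith
        field_simp
      rw [this]; push_cast; ring
    rw [e2, e3]
    have n1 : (1 - ((p:ℝ) ^ (-α) : ℝ) : ℂ) ≠ 0 := by
      have : (1 - (p:ℝ) ^ (-α) : ℝ) ≠ 0 := by linarith
      exact_mod_cast this
    rw [Complex.ofReal_inv, Complex.ofReal_sub, Complex.ofReal_one]
    field_simp
  rw [Complex.ofReal_mul, mul_assoc, ← mul_assoc (zetaP α y : ℂ), mul_comm (zetaP α y : ℂ), e1, Complex.ofReal_exp]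
  have : Complex.exp ((α + t * Complex.I) * (st9_f1 α y + X : ℝ)) = Complex.exp ((α * st9_f1 α y : ℝ)) *
    (Complex.exp (t * Complex.I * (st9_f1 α y : ℝ)) * Complex.exp ((α + t * Complex.I) * X)) := by
    rw [← Complex.exp_add, ← Complex.exp_add]; push_cast; ring_nf
  rw [this]; ring
end

section
open Real Filter Topology MeasureTheory Set

theorem st9_cosint {b t y : ℝ} (hy : 4 ≤ y) (hb : 1/2 ≤ b) (hb1 : b ≤ 1) (ht : 1 / log y ≤ |t|) :
    y ^ b / (4 * log y ^ 2) - 2 ≤ ∫ v in (1:ℝ)..y, v ^ (-(1 - b)) * (1 - cos (t * log v)) := by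
  have hY := st9_Y1 hy
  have hY0 : 0 < log y := by linarith
  have hbt : 0 < b ^ 2 + t ^ 2 := by positivity
  have hd : ∀ v ∈ uIcc 1 y, HasDerivAt (fun v : ℝ => v ^ b / b - v ^ b * (b * cos (t * log v) + t * sin (t * log v)) / (b ^ 2 + t ^ 2))
      (v ^ (-(1 - b)) * (1 - cos (t * log v))) v := by
    intro v hv
    rw [uIcc_of_le (by linarith)] at hv
    have hv0 : 0 < v := by linarith [hv.1]
    have h1 : HasDerivAt (fun v : ℝ => v ^ b) (b * v ^ (b - 1)) v := hasDerivAt_rpow_const (Or.inl hv0.ne')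
    have h2 : HasDerivAt (fun v : ℝ => t * log v) (t * v⁻¹) v := (hasDerivAt_log hv0.ne').const_mul t
    refine ((h1.div_const b).sub ((h1.mul ((h2.cos.const_mul b).add (h2.sin.const_mul t))).div_const (b ^ 2 + t ^ 2))).congr_deriv ?_
    have e : v ^ b = v ^ (b - 1) * v := by rw [← rpow_add_one hv0.ne']; ring_nf
    rw [e, show -(1 - b) = b - 1 by ring]
    have hb0 : b ≠ 0 := by linarith
    simp only [Pi.add_apply]
    field_simp
    ring
  rw [intervalIntegral.integral_eq_sub_of_hasDerivAt hd]
  · simp only [log_one, mul_zero, cos_zero, sin_zero, one_rpow]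
    set r := √(b ^ 2 + t ^ 2) with hr
    have hr2 : r ^ 2 = b ^ 2 + t ^ 2 := sq_sqrt hbt.le
    have hr0 : 0 < r := sqrt_pos.2 hbt
    have ht2 : 1 / log y ^ 2 ≤ t ^ 2 := by
      rw [← sq_abs t, ← one_div_pow]; gcongr
    set e := 1 / (3 * log y ^ 2) with he
    have he0 : 0 < e := by positivity
    have he1 : e ≤ 1/3 := by
      rw [he]; apply one_div_le_one_div_of_le (by norm_num); nlinarith
    have he3 : 1 / log y ^ 2 = 3 * e := by rw [he]; field_simp
    have hre : b + e ≤ r := by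
      apply le_sqrt_of_sq_le
      have : e * e ≤ e * (1/3) := by gcongr
      have : b * e ≤ 1 * e := by gcongr
      nlinarith
    have hcs : b * cos (t * log y) + t * sin (t * log y) ≤ r := by
      apply le_sqrt_of_sq_le
      have := sin_sq_add_cos_sq (t * log y)
      nlinarith [sq_nonneg (b * sin (t * log y) - t * cos (t * log y))]
    have hyb : 0 < y ^ b := by positivity
    have i1 : y ^ b * (b * cos (t * log y) + t * sin (t * log y)) / (b ^ 2 + t ^ 2) ≤ y ^ b * (1 / r) := by
      rw [← hr2, mul_div_assoc]
      refine mul_le_mul_of_nonneg_left ?_ hyb.le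
      rw [div_le_div_iff₀ (by positivity) hr0]
      nlinarith
    have i2 : 1 / (4 * log y ^ 2) ≤ 1 / b - 1 / r := by
      have : 1 / r ≤ 1 / (b + e) := one_div_le_one_div_of_le (by linarith) hre
      have h4 : 1 / (4 * log y ^ 2) = 3/4 * e := by rw [he]; field_simp
      rw [h4]
      have : 1 / b - 1 / (b + e) = e / (b * (b + e)) := by field_simp; ring
      have : 3/4 * e ≤ e / (b * (b + e)) := by
        rw [le_div_iff₀ (by positivity)]
        have : b * (b + e) ≤ 1 * (1 + 1/3) := by gcongr
        nlinarith
      linarith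
    have i3 : (1:ℝ) / b ≤ 2 := by rw [div_le_iff₀ (by linarith)]; linarith
    have i4 : 0 ≤ (1:ℝ) * (b * 1 + 0) / (b ^ 2 + t ^ 2) := by positivity
    have := mul_le_mul_of_nonneg_left i2 hyb.le
    have e5 : y ^ b / (4 * log y ^ 2) = y ^ b * (1 / (4 * log y ^ 2)) := by ring
    have e6 : y ^ b / b = y ^ b * (1 / b) := by ring
    rw [e5, e6]
    linarith
  · apply ContinuousOn.intervalIntegrable
    intro v hv
    rw [uIcc_of_le (by linarith)] at hv
    have hv0 : v ≠ 0 := by linarith [hv.1]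
    apply ContinuousAt.continuousWithinAt
    exact (continuousAt_rpow_const _ _ (Or.inl hv0)).mul (continuousAt_const.sub
      (continuous_cos.continuousAt.comp (continuousAt_const.mul (continuousAt_log hv0))))

theorem st9_mid {η δ K : ℝ} (hδ : 0 < δ) (hδ1 : δ ≤ 1/4) (hK : st9_th δ K) :
    ∃ y0 C, 0 < C ∧ ∀ y α t, y0 ≤ y → st9_good η δ α y → 1 / log y ≤ |t| → |t| ≤ y ^ (1/2 - 2 * δ) →
    exp (-∑ p ∈ st9_Pr y, (p:ℝ) ^ (-α) * (1 - cos (t * log p))) ≤ C * (y ^ 4)⁻¹ := by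
  have hKK := hK.K1
  obtain ⟨y0, h40, hy0⟩ := st9_small (δ := δ/2) (by linarith)
    (show 0 < 1 / ((2 + 3 * (K * (2 + 1/δ))) * 8 * (4/δ) ^ 2) by positivity)
  obtain ⟨C, hC, hCC⟩ := st9_pow_exp' 16 (c := 1 / (8 * 12 ^ 3)) (by norm_num)
  refine ⟨y0, C, hC, fun y α t hyy hg ht1 ht2 => ?_⟩
  have hy := hg.y4
  have hyp : 0 < y := by linarith
  have hY := st9_Y1 hy
  have hY0 : 0 < log y := by linarith
  have ha0 := hg.s0
  have ha1 := hg.s1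
  set S := ∑ p ∈ st9_Pr y, log p * ((p:ℝ) ^ (-α) * (1 - cos (t * log p))) with hS
  have h1 := st9_cosint (b := 1 - α) hy (by linarith) (by linarith) ht1
  rw [sub_sub_cancel] at h1
  have h2 := st9_abel_cos t (y := y) (s := α) (by linarith) hKK hK.th hδ (by linarith) ha0.le (by linarith)
  rw [← hS] at h2
  have hT : 1 ≤ y ^ (1/2 - 2 * δ) := one_le_rpow (by linarith) (by linarith)
  have h3 : (2 + |t|) * y ^ (1/2 + δ - α) ≤ 3 * y ^ (1 - α - δ) := by
    calc _ ≤ (3 * y ^ (1/2 - 2 * δ)) * y ^ (1/2 + δ - α) := by gcongr; linarith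
      _ = _ := by rw [mul_assoc, ← rpow_add hyp]; ring_nf
  have h4 : 1 ≤ y ^ (1 - α - δ) := one_le_rpow (by linarith) (by linarith)
  have h5 : log y ≤ y ^ (δ/4) / (δ/4) := log_le_rpow_div hyp.le (by linarith)
  have h6 : log y ^ 2 * y ^ (-δ) ≤ (4/δ) ^ 2 * y ^ (-(δ/2)) := by
    calc _ ≤ (y ^ (δ/4) / (δ/4)) ^ 2 * y ^ (-δ) := by gcongr
      _ = (4/δ) ^ 2 * (y ^ (δ/4) * y ^ (δ/4) * y ^ (-δ)) := by field_simp
      _ = _ := by rw [← rpow_add hyp, ← rpow_add hyp]; ring_nf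
  have h7 : (2 + 3 * (K * (2 + 1/δ))) * 8 * (log y ^ 2 * y ^ (-δ)) ≤ 1 := by
    have h0 : 0 < (2 + 3 * (K * (2 + 1/δ))) * 8 * (4/δ) ^ 2 := by positivity
    have := hy0 y hyy
    rw [le_div_iff₀ h0] at this
    calc _ ≤ (2 + 3 * (K * (2 + 1/δ))) * 8 * ((4/δ) ^ 2 * y ^ (-(δ/2))) := by gcongr
      _ = y ^ (-(δ/2)) * ((2 + 3 * (K * (2 + 1/δ))) * 8 * (4/δ) ^ 2) := by ring
      _ ≤ 1 := this
  have h8 : (2 + 3 * (K * (2 + 1/δ))) * y ^ (1 - α - δ) ≤ y ^ (1 - α) / (8 * log y ^ 2) := by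
    rw [le_div_iff₀ (by positivity), sub_eq_add_neg (1 - α), rpow_add hyp]
    have h9 : 0 < y ^ (1 - α) := by positivity
    calc _ = y ^ (1 - α) * ((2 + 3 * (K * (2 + 1/δ))) * 8 * (log y ^ 2 * y ^ (-δ))) := by ring
      _ ≤ y ^ (1 - α) * 1 := by gcongr
      _ = _ := mul_one _
  have hSl : y ^ (1 - α) / (8 * log y ^ 2) ≤ S := by
    have a1 := (abs_le.1 h2).1
    have a2 : K * (2 + 1/δ) * (2 + |t|) * y ^ (1/2 + δ - α) ≤ K * (2 + 1/δ) * (3 * y ^ (1 - α - δ)) := by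
      rw [mul_assoc]; gcongr
    have a3 : y ^ (1 - α) / (4 * log y ^ 2) = 2 * (y ^ (1 - α) / (8 * log y ^ 2)) := by field_simp; norm_num
    linarith
  have hSu : S ≤ log y * ∑ p ∈ st9_Pr y, (p:ℝ) ^ (-α) * (1 - cos (t * log p)) := by
    rw [Finset.mul_sum]
    refine Finset.sum_le_sum fun p hp => ?_
    have hp2 := st9_Pr_ge hp
    have := log_le_log (by linarith) ((st9_mem_Pr hyp.le).1 hp).2
    have : 0 ≤ 1 - cos (t * log p) := by linarith [cos_le_one (t * log p)]
    gcongr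
  have h12 : log y ^ 3 ≤ 12 ^ 3 * y ^ (1/4 : ℝ) := by
    have := log_le_rpow_div hyp.le (show (0:ℝ) < 1/12 by norm_num)
    calc _ ≤ (y ^ (1/12 : ℝ) / (1/12)) ^ 3 := by gcongr
      _ = 12 ^ 3 * (y ^ (1/12 : ℝ)) ^ (3:ℕ) := by ring
      _ = _ := by rw [← rpow_mul_natCast hyp.le]; norm_num
  have hfin : 1 / (8 * 12 ^ 3) * y ^ (1/4 : ℝ) ≤ ∑ p ∈ st9_Pr y, (p:ℝ) ^ (-α) * (1 - cos (t * log p)) := by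
    have b1 : y ^ (1/2 : ℝ) ≤ y ^ (1 - α) := rpow_le_rpow_of_exponent_le (by linarith) (by linarith)
    have b2 := hSl.trans hSu
    rw [div_le_iff₀ (by positivity)] at b2
    set V := ∑ p ∈ st9_Pr y, (p:ℝ) ^ (-α) * (1 - cos (t * log p)) with hV
    have b3 : y ^ (1/2 : ℝ) = y ^ (1/4 : ℝ) * y ^ (1/4 : ℝ) := by rw [← rpow_add hyp]; norm_num
    have hV0 : 0 ≤ V := Finset.sum_nonneg fun p hp => mul_nonneg (by positivity) (by linarith [cos_le_one (t * log p)])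
    have b4 : 8 * V * log y ^ 3 ≤ 8 * V * (12 ^ 3 * y ^ (1/4 : ℝ)) := by gcongr
    have b5 : y ^ (1/4 : ℝ) * y ^ (1/4 : ℝ) ≤ (8 * V * 12 ^ 3) * y ^ (1/4 : ℝ) := by
      rw [← b3]
      calc _ ≤ _ := b1.trans b2
        _ = 8 * V * log y ^ 3 := by ring
        _ ≤ _ := b4
        _ = _ := by ring
    have b6 := le_of_mul_le_mul_right b5 (by positivity)
    linarith
  have hz := hCC (y ^ (1/4 : ℝ)) (by positivity)
  have e16 : (y ^ (1/4 : ℝ)) ^ 16 = y ^ 4 := by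
    rw [← rpow_mul_natCast hyp.le, ← rpow_natCast]; norm_num
  rw [e16] at hz
  rw [← div_eq_mul_inv, le_div_iff₀ (by positivity), mul_comm]
  refine le_trans ?_ hz
  gcongr
end

section
open Real Filter Topology MeasureTheory Set

noncomputable def st9_Phi (α y t : ℝ) : ℂ := ∑ p ∈ st9_Pr y, st9_E ((p:ℝ) ^ (-α)) (t * log p)
noncomputable def st9_m (h X : ℝ) (k : ℕ) (α t : ℝ) : ℂ :=
  α * st9_K h (k+1) (α + t * Complex.I) * Complex.exp ((α + t * Complex.I) * X)

theorem st9_Phi_cont {α y : ℝ} (hα : 0 < α) : Continuous (fun t => Complex.exp (st9_Phi α y t)) := by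
  simp only [st9_Phi, Complex.exp_sum]
  refine continuous_finsetProd _ fun p hp => ?_
  obtain ⟨a1, a2, -, -⟩ := st9_pw (st9_Pr_ge hp) hα
  simp only [st9_E_exp a1 a2]
  refine Continuous.mul (Continuous.mul continuous_const (Continuous.inv₀ (by fun_prop) fun t h => ?_)) (by fun_prop)
  have := st9_qe ((p:ℝ) ^ (-α)) (t * log p) a1.le
  rw [← sub_eq_zero.1 h, norm_one] at this
  linarith

theorem st9_Phi_re {α y : ℝ} (hα : 0 < α) (t : ℝ) :
    (st9_Phi α y t).re ≤ -∑ p ∈ st9_Pr y, (p:ℝ) ^ (-α) * (1 - cos (t * log p)) := by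
  rw [st9_Phi, Complex.re_sum, ← Finset.sum_neg_distrib]
  refine Finset.sum_le_sum fun p hp => ?_
  obtain ⟨a1, a2, -, -⟩ := st9_pw (st9_Pr_ge hp) hα
  exact st9_E_re a1 a2 _

theorem st9_Phi_nonpos {α y : ℝ} (hα : 0 < α) (t : ℝ) : (st9_Phi α y t).re ≤ 0 := by
  refine (st9_Phi_re hα t).trans (neg_nonpos.2 (Finset.sum_nonneg fun p hp => ?_))
  exact mul_nonneg (by positivity) (by linarith [cos_le_one (t * log p)])

theorem st9_Phi_taylor {η δ : ℝ} (hη : 0 < η) {y α : ℝ} (hg : st9_good η δ α y) :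
    ∃ b : ℝ, |b| ≤ (1 + η) / η * (st9_f2 α y / log y ^ 2) ∧ ∀ τ : ℝ,
    ‖st9_Phi α y (τ / log y) + (st9_f2 α y / log y ^ 2 * τ ^ 2 / 2 : ℝ) - Complex.I * (b * τ ^ 3 : ℝ)‖ ≤
      24 * ((1 + η) / η) ^ 2 * (st9_f2 α y / log y ^ 2) * τ ^ 4 := by
  have hY := st9_Y1 hg.y4
  have hY0 : 0 < log y := by linarith
  have hα := hg.s0
  have hb : ∀ q : ℝ, ∃ b : ℝ, 0 < q → q < 1 → |b| ≤ q / (1 - q) ^ 3 ∧ ∀ θ : ℝ,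
    ‖st9_E q θ + (θ ^ 2 / 2 * (q / (1 - q) ^ 2) : ℝ) - Complex.I * (b * θ ^ 3 : ℝ)‖ ≤ 24 * (θ ^ 4 * (q / (1 - q) ^ 4)) := by
    intro q
    by_cases h : 0 < q ∧ q < 1
    · obtain ⟨b, hb⟩ := st9_E_taylor h.1 h.2
      exact ⟨b, fun _ _ => hb⟩
    · exact ⟨0, fun h1 h2 => absurd ⟨h1, h2⟩ h⟩
  choose b hb using hb
  set C1 := (1 + η) / η with hC1
  have hC0 : 0 < C1 := by positivity
  have key : ∀ p ∈ st9_Pr y, 0 < (p:ℝ) ^ (-α) ∧ (p:ℝ) ^ (-α) < 1 ∧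
      0 ≤ log p / log y / (1 - (p:ℝ) ^ (-α)) ∧ log p / log y / (1 - (p:ℝ) ^ (-α)) ≤ C1 := by
    intro p hp
    obtain ⟨a1, a2, -, -⟩ := st9_pw (st9_Pr_ge hp) hα
    have h1 : 0 < 1 - (p:ℝ) ^ (-α) := by linarith
    have h2 : 0 ≤ log (p:ℝ) := log_nonneg (by linarith [st9_Pr_ge hp])
    refine ⟨a1, a2, by positivity, ?_⟩
    rw [div_div, div_le_iff₀ (by positivity)]
    have := st9_lp hη (by linarith [hg.y4]) hg.pw hp
    linarith
  have ea : st9_f2 α y / log y ^ 2 = ∑ p ∈ st9_Pr y, (p:ℝ) ^ (-α) * (log p / log y / (1 - (p:ℝ) ^ (-α))) ^ 2 := by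
    rw [st9_f2, Finset.sum_div]
    refine Finset.sum_congr rfl fun p hp => ?_
    have := (key p hp).2.1
    have : 1 - (p:ℝ) ^ (-α) ≠ 0 := by linarith
    field_simp
  refine ⟨∑ p ∈ st9_Pr y, b ((p:ℝ) ^ (-α)) * (log p / log y) ^ 3, ?_, fun τ => ?_⟩
  · rw [ea, Finset.mul_sum]
    refine (Finset.abs_sum_le_sum_abs _ _).trans (Finset.sum_le_sum fun p hp => ?_)
    obtain ⟨k1, k2, k3, k4⟩ := key p hp
    have h1 : 0 < 1 - (p:ℝ) ^ (-α) := by linarith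
    have h2 : 0 ≤ log (p:ℝ) := log_nonneg (by linarith [st9_Pr_ge hp])
    rw [abs_mul, abs_of_nonneg (by positivity : 0 ≤ (log (p:ℝ) / log y) ^ 3)]
    calc _ ≤ (p:ℝ) ^ (-α) / (1 - (p:ℝ) ^ (-α)) ^ 3 * (log p / log y) ^ 3 := by gcongr; exact (hb _ k1 k2).1
      _ = (log p / log y / (1 - (p:ℝ) ^ (-α))) * ((p:ℝ) ^ (-α) * (log p / log y / (1 - (p:ℝ) ^ (-α))) ^ 2) := by
        field_simp
      _ ≤ _ := by gcongr
  · have e : st9_Phi α y (τ / log y) + (st9_f2 α y / log y ^ 2 * τ ^ 2 / 2 : ℝ) -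
        Complex.I * ((∑ p ∈ st9_Pr y, b ((p:ℝ) ^ (-α)) * (log p / log y) ^ 3) * τ ^ 3 : ℝ)
        = ∑ p ∈ st9_Pr y, (st9_E ((p:ℝ) ^ (-α)) (τ / log y * log p) +
          ((τ / log y * log p) ^ 2 / 2 * ((p:ℝ) ^ (-α) / (1 - (p:ℝ) ^ (-α)) ^ 2) : ℝ) -
          Complex.I * (b ((p:ℝ) ^ (-α)) * (τ / log y * log p) ^ 3 : ℝ)) := by
      rw [Finset.sum_sub_distrib, Finset.sum_add_distrib, ← Finset.mul_sum, ← Complex.ofReal_sum,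
        ← Complex.ofReal_sum, ← st9_Phi]
      congr 4
      · rw [ea, Finset.sum_mul, Finset.sum_div]
        refine Finset.sum_congr rfl fun p hp => ?_
        have := (key p hp).2.1
        have : 1 - (p:ℝ) ^ (-α) ≠ 0 := by linarith
        field_simp
      · rw [Finset.sum_mul]
        refine Finset.sum_congr rfl fun p hp => ?_
        ring
    rw [e, ea, Finset.mul_sum, Finset.sum_mul]
    refine (norm_sum_le _ _).trans (Finset.sum_le_sum fun p hp => ?_)
    obtain ⟨k1, k2, k3, k4⟩ := key p hp
    have h1 : 0 < 1 - (p:ℝ) ^ (-α) := by linarith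
    refine ((hb _ k1 k2).2 _).trans ?_
    calc _ = 24 * ((log p / log y / (1 - (p:ℝ) ^ (-α))) ^ 2 * ((p:ℝ) ^ (-α) * (log p / log y / (1 - (p:ℝ) ^ (-α))) ^ 2)) * τ ^ 4 := by
          field_simp
      _ ≤ 24 * (C1 ^ 2 * ((p:ℝ) ^ (-α) * (log p / log y / (1 - (p:ℝ) ^ (-α))) ^ 2)) * τ ^ 4 := by gcongr
      _ = _ := by ring

theorem st9_m_bound {η δ : ℝ} (hη : 0 < η) (k : ℕ) : ∃ C, 1 ≤ C ∧ ∀ y α h X : ℝ, st9_good η δ α y → 0 < δ → 0 < h → 0 ≤ X →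
    X ≤ (k+1) * h → (k+1) * h * 2 ≤ 1 → ∃ d : ℝ, |d| ≤ C ∧ ∀ τ : ℝ, |τ| ≤ 1 →
    ‖st9_m h X k α (τ / log y) - 1 - Complex.I * (d * τ : ℝ)‖ ≤ C * (τ ^ 2 + h) := by
  have hl : 0 < log (1 + η) := log_pos (by linarith)
  refine ⟨1 + 1 / log (1 + η) + (1 / log (1 + η)) ^ 2 + 16 * (k + 1), ?_, ?_⟩
  · have : 0 < 1 / log (1 + η) + (1 / log (1 + η)) ^ 2 + 16 * (k + 1) := by positivity
    linarith
  intro y α h X hg hδ hh hX hX1 hh1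
  have hY := st9_Y1 hg.y4
  have hY0 : 0 < log y := by linarith
  have hα := hg.s0
  have hα1 := hg.s1
  have hκ : log (1 + η) ≤ α * log y := by
    have := log_le_log (by linarith) hg.pw
    rwa [log_rpow (by linarith [hg.y4])] at this
  set κ := 1 / (α * log y) with hκd
  have hκ0 : 0 < κ := by positivity
  have hκ1 : κ ≤ 1 / log (1 + η) := one_div_le_one_div_of_le hl hκ
  have hκ2 : κ ^ 2 ≤ (1 / log (1 + η)) ^ 2 := by gcongr
  have hk0 : (0:ℝ) < k + 1 := by positivity
  refine ⟨-κ, ?_, fun τ hτ => ?_⟩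
  · rw [abs_neg, abs_of_pos hκ0]
    have : 0 < (1 / log (1 + η)) ^ 2 + 16 * (k + 1) := by positivity
    linarith
  set s : ℂ := α + (τ / log y : ℝ) * Complex.I with hs
  have hsre : 0 < s.re := by rw [hs, st9_line_re]; exact hα
  have hs0 : s ≠ 0 := st9_line_ne hα _
  have hsn : ‖s‖ ≤ 2 := by
    refine (norm_add_le _ _).trans ?_
    rw [norm_mul, Complex.norm_I, Complex.norm_real, Complex.norm_real, norm_of_nonneg hα.le, norm_eq_abs, abs_div,
      abs_of_pos hY0, mul_one]
    have : |τ| / log y ≤ 1 := by rw [div_le_one hY0]; linarith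
    linarith
  have hαs : ‖(α:ℂ) / s‖ ≤ 1 := by
    rw [norm_div, Complex.norm_real, norm_of_nonneg hα.le, div_le_one (norm_pos_iff.2 hs0)]
    have := Complex.re_le_norm s
    rwa [hs, st9_line_re, ← hs] at this
  have hh2 : h * 2 ≤ 1 := by
    have : h * 2 ≤ (k+1) * h * 2 := by
      have : 0 ≤ (k:ℝ) * h := by positivity
      linarith
    linarith
  have hbx := st9_bx_one hh hsre ((mul_le_mul_of_nonneg_left hsn hh.le).trans hh2)
  have hbx1 := st9_bx_le hh hsre
  have hB : ‖st9_bx h s ^ (k+1) - 1‖ ≤ 4 * (k+1) * h := by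
    have h1 : ‖st9_bx h s ^ (k+1) - 1‖ ≤ (k+1) * ‖st9_bx h s - 1‖ := by
      rw [← mul_geom_sum (st9_bx h s) (k+1), norm_mul, mul_comm]
      gcongr
      refine (norm_sum_le _ _).trans ?_
      calc _ ≤ ∑ i ∈ Finset.range (k+1), (1:ℝ) := Finset.sum_le_sum fun i _ => by
            rw [norm_pow]; exact pow_le_one₀ (norm_nonneg _) hbx1
        _ = _ := by simp
    calc _ ≤ (k+1) * (2 * (h * 2)) := h1.trans (by gcongr; exact hbx.trans (by gcongr))
      _ = _ := by ring
  have hsX : ‖s * X‖ ≤ (k+1) * h * 2 := by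
    rw [norm_mul, Complex.norm_real, norm_of_nonneg hX, mul_comm]; gcongr
  have hE : ‖Complex.exp (s * X) - 1‖ ≤ 4 * (k+1) * h := by
    refine (Complex.norm_exp_sub_one_le (hsX.trans hh1)).trans ?_
    linarith
  have hE2 : ‖Complex.exp (s * X)‖ ≤ 3 := by
    have := norm_add_le (Complex.exp (s * X) - 1) 1
    rw [sub_add_cancel, norm_one] at this
    linarith
  have hBE : ‖st9_bx h s ^ (k+1) * Complex.exp (s * X) - 1‖ ≤ 16 * (k+1) * h := by
    have e : st9_bx h s ^ (k+1) * Complex.exp (s * X) - 1 = (st9_bx h s ^ (k+1) - 1) * Complex.exp (s * X)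
      + (Complex.exp (s * X) - 1) := by ring
    rw [e]
    refine (norm_add_le _ _).trans ?_
    rw [norm_mul]
    have := mul_le_mul hB hE2 (norm_nonneg _) (by positivity)
    linarith
  have hm1 : (α:ℂ) / s - 1 + Complex.I * (κ * τ : ℝ) = (α / s) * ((-(κ * τ) ^ 2 : ℝ) : ℂ) := by
    have e2 : s = α * (1 + Complex.I * (κ * τ : ℝ)) := by
      rw [hs, hκd]
      have : (α:ℂ) ≠ 0 := by exact_mod_cast hα.ne'
      push_cast
      field_simp
    have e3 : (α:ℂ) / s * (1 + Complex.I * (κ * τ : ℝ)) = 1 := by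
      rw [div_mul_eq_mul_div, ← e2, div_self hs0]
    have e4 : ((-(κ * τ) ^ 2 : ℝ) : ℂ) = (1 + Complex.I * (κ * τ : ℝ)) * (Complex.I * (κ * τ : ℝ)) - Complex.I * (κ * τ : ℝ) := by
      push_cast
      linear_combination (-(κ * τ : ℂ) ^ 2) * Complex.I_sq
    rw [e4, mul_sub, ← mul_assoc, e3]
    linear_combination e3
  have e : st9_m h X k α (τ / log y) - 1 - Complex.I * (-κ * τ : ℝ) =
      ((α:ℂ) / s - 1 + Complex.I * (κ * τ : ℝ)) + (α / s) * (st9_bx h s ^ (k+1) * Complex.exp (s * X) - 1) := by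
    rw [st9_m, st9_K, ← hs]; push_cast; ring
  rw [e, hm1]
  refine (norm_add_le _ _).trans ?_
  rw [norm_mul, norm_mul]
  have j1 : ‖(α:ℂ) / s‖ * ‖((-(κ * τ) ^ 2 : ℝ) : ℂ)‖ ≤ 1 * ((1 / log (1 + η)) ^ 2 * τ ^ 2) := by
    rw [Complex.norm_real, norm_neg, norm_of_nonneg (by positivity), mul_pow]
    gcongr
  have j2 : ‖(α:ℂ) / s‖ * ‖st9_bx h s ^ (k+1) * Complex.exp (s * X) - 1‖ ≤ 1 * (16 * (k+1) * h) := by gcongr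
  have j3 : 0 ≤ (1 + 1 / log (1 + η) + 16 * (k + 1)) * τ ^ 2 := by positivity
  have j4 : 0 ≤ (1 + 1 / log (1 + η) + (1 / log (1 + η)) ^ 2) * h := by positivity
  linarith
end

section
open Real Filter Topology MeasureTheory Set

theorem st9_Phi_gauss {η δ K : ℝ} (hη : 0 < η) (hδ : 0 < δ) (hδ1 : δ ≤ 1/4) (hK : st9_th δ K) :
    ∃ y0 c C, 0 < c ∧ c ≤ 1/2 ∧ 0 < C ∧ ∀ y α, y0 ≤ y → st9_good η δ α y → 1 ≤ st9_f2 α y / log y ^ 2 ∧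
    st9_f2 α y / log y ^ 2 ≤ C * y ∧
    ∀ τ : ℝ, |τ| ≤ 1 → (st9_Phi α y (τ / log y)).re ≤ -(c * (st9_f2 α y / log y ^ 2 * τ ^ 2)) := by
  obtain ⟨C, hC, hf2⟩ := st9_f2_le hη hδ hδ1
  obtain ⟨y1, hy1⟩ := st9_sum2_ge hδ hδ1 hK
  obtain ⟨y2, -, hy2⟩ := st9_small (δ := 1/4) (c := 1/32) (by norm_num) (by norm_num)
  refine ⟨max y1 y2, 1 / (64 * (C + 1)), C, by positivity, ?_, hC, fun y α hy hg => ?_⟩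
  · apply one_div_le_one_div_of_le <;> linarith
  have hy4 := hg.y4
  have hyp : 0 < y := by linarith
  have hY := st9_Y1 hy4
  have hY0 : 0 < log y := by linarith
  have hα := hg.s0
  have hα1 := hg.s1
  have hS := hy1 y α ((le_max_left _ _).trans hy) hy4 hα hα1
  have hF := hf2 y α hg
  have hF2 := st9_f2_ge_sum (y := y) hα
  set f := st9_f2 α y
  have hp1 : y ^ (1/4:ℝ) * y ^ (1/4:ℝ) ≤ y ^ (1 - α) := by
    rw [← rpow_add hyp]; exact rpow_le_rpow_of_exponent_le (by linarith) (by linarith)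
  have hp2 : y ^ (1 - α) ≤ y := by
    conv_rhs => rw [← rpow_one y]
    exact rpow_le_rpow_of_exponent_le (by linarith) (by linarith)
  have hl : log y ≤ y ^ (1/4:ℝ) / (1/4) := log_le_rpow_div hyp.le (by norm_num)
  have h32 : 32 ≤ y ^ (1/4:ℝ) := by
    have := hy2 y ((le_max_right _ _).trans hy)
    rw [rpow_neg hyp.le, ← one_div] at this
    exact (one_div_le_one_div (by positivity) (by norm_num)).1 this
  refine ⟨?_, ?_, fun τ hτ => ?_⟩
  · rw [one_le_div (by positivity)]
    have e1 : 32 * y ^ (1/4:ℝ) ≤ y ^ (1/4:ℝ) * y ^ (1/4:ℝ) := by gcongr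
    have : log y * (8 * log y) ≤ log y * y ^ (1 - α) := by gcongr; linarith
    linarith
  · rw [div_le_iff₀ (by positivity)]
    refine hF.trans ?_
    have : log y * y ^ (1 - α) ≤ y * log y ^ 2 := by
      have e : log y * y ^ (1 - α) ≤ log y * y := by gcongr
      have e2 : log y * y * 1 ≤ log y * y * log y := by gcongr
      linarith
    calc _ ≤ C * (y * log y ^ 2) := by gcongr
      _ = _ := by ring
  · refine (st9_Phi_re hα _).trans (neg_le_neg ?_)
    have h1 : τ ^ 2 / (8 * log y ^ 2) * ∑ p ∈ st9_Pr y, log p * (log p * (p:ℝ) ^ (-α)) ≤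
        ∑ p ∈ st9_Pr y, (p:ℝ) ^ (-α) * (1 - cos (τ / log y * log p)) := by
      rw [Finset.mul_sum]
      refine Finset.sum_le_sum fun p hp => ?_
      have hp2 := st9_Pr_ge hp
      have hpy : (p:ℝ) ≤ y := ((st9_mem_Pr hyp.le).1 hp).2
      have hlp0 : 0 ≤ log p := log_nonneg (by linarith)
      have hlp : log p ≤ log y := log_le_log (by linarith) hpy
      have hθ : |τ / log y * log p| ≤ 1 := by
        rw [abs_mul, abs_div, abs_of_pos hY0, abs_of_nonneg hlp0, div_mul_eq_mul_div, div_le_one hY0]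
        calc _ ≤ 1 * log y := by gcongr
          _ = _ := one_mul _
      have hc := cos_le_one_sub_mul_cos_sq (hθ.trans (by linarith [pi_gt_three]))
      have hpi : (1:ℝ)/8 ≤ 2 / π ^ 2 := by
        rw [div_le_div_iff₀ (by norm_num) (by positivity)]
        nlinarith [pi_lt_four, pi_pos]
      have e : (1:ℝ)/8 * (τ / log y * log p) ^ 2 ≤ 1 - cos (τ / log y * log p) := by
        have : (1:ℝ)/8 * (τ / log y * log p) ^ 2 ≤ 2 / π ^ 2 * (τ / log y * log p) ^ 2 := by gcongr
        linarith
      calc _ = (p:ℝ) ^ (-α) * ((1:ℝ)/8 * (τ / log y * log p) ^ 2) := by field_simp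
        _ ≤ _ := by gcongr
    refine le_trans ?_ h1
    have h2 : f ≤ 8 * (C + 1) * ∑ p ∈ st9_Pr y, log p * (log p * (p:ℝ) ^ (-α)) := by
      have e0 : 0 ≤ log y * y ^ (1 - α) := by positivity
      calc f ≤ (C + 1) * (log y * y ^ (1 - α)) := by linarith
        _ = 8 * (C + 1) * (log y * y ^ (1 - α) / 8) := by ring
        _ ≤ _ := by gcongr
    calc _ = τ ^ 2 / (8 * log y ^ 2) * (f / (8 * (C + 1))) := by field_simp; norm_num; ring
      _ ≤ _ := by gcongr; rw [div_le_iff₀ (by positivity)]; linarith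

theorem st9_tail {η δ K : ℝ} (hδ : 0 < δ) (hδ1 : δ ≤ 1/16) (hK : st9_th δ K) (k : ℕ) (hk : 4 ≤ k * δ) :
    ∃ y0 C, 0 < C ∧ ∀ y α X τ : ℝ, y0 ≤ y → st9_good η δ α y → 0 ≤ X → X ≤ 1 → 1 ≤ |τ| →
    ‖Complex.exp (st9_Phi α y (τ / log y)) * st9_m (y ^ (-1/2 + 3 * δ)) X k α (τ / log y)‖ ≤
      C * (y ^ 2)⁻¹ * |τ| ^ (-(3/2:ℝ)) := by
  obtain ⟨y0, C, hC, hmid⟩ := st9_mid (η := η) hδ (by linarith) hK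
  refine ⟨y0, 12 * C + 24 * 2 ^ k, by positivity, fun y α X τ hy hg hX hX1 hτ => ?_⟩
  have hy4 := hg.y4
  have hyp : 0 < y := by linarith
  have hY := st9_Y1 hy4
  have hY0 : 0 < log y := by linarith
  have hα := hg.s0
  have hα1 := hg.s1
  set h := y ^ (-1/2 + 3 * δ) with hh
  have hh0 : 0 < h := by positivity
  set t := τ / log y with ht
  have hta : |t| = |τ| / log y := by rw [ht, abs_div, abs_of_pos hY0]
  have htY : |τ| = |t| * log y := by rw [hta]; field_simp
  set s : ℂ := α + t * Complex.I with hs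
  have hsre : 0 < s.re := by rw [hs, st9_line_re]; exact hα
  have hs0 : 0 < ‖s‖ := norm_pos_iff.2 (st9_line_ne hα _)
  have hst : |t| ≤ ‖s‖ := by
    have := Complex.abs_im_le_norm s
    simpa [hs] using this
  have hsα : α ≤ ‖s‖ := by
    have := Complex.re_le_norm s
    rwa [hs, st9_line_re, ← hs] at this
  have hY2 : log y ^ 2 ≤ 4 * y := by
    have : log y ≤ y ^ (1/2:ℝ) / (1/2) := log_le_rpow_div hyp.le (by norm_num)
    calc log y ^ 2 ≤ (y ^ (1/2:ℝ) / (1/2)) ^ 2 := by gcongr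
      _ = 4 * (y ^ (1/2:ℝ) * y ^ (1/2:ℝ)) := by ring
      _ = _ := by rw [← rpow_add hyp]; norm_num
  have hm : ‖st9_m h X k α t‖ ≤ α / ‖s‖ * ‖st9_bx h s‖ ^ (k+1) * 3 := by
    rw [st9_m, st9_K, ← hs, norm_mul, norm_mul, norm_mul, norm_pow, Complex.norm_real, norm_of_nonneg hα.le, Complex.norm_exp]
    have e : (s * X).re = α * X := by rw [Complex.re_mul_ofReal, hs, st9_line_re]
    have e2 : exp (α * X) ≤ 3 := by
      have : α * X ≤ 1 * 1 := by gcongr; linarith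
      have := exp_le_exp.2 this
      rw [one_mul] at this
      linarith [exp_one_lt_d9]
    rw [e, norm_div, norm_one]
    calc _ = α / ‖s‖ * ‖st9_bx h s‖ ^ (k+1) * exp (α * X) := by ring
      _ ≤ _ := by gcongr
  have hb1 := st9_bx_le hh0 hsre
  have key : ‖Complex.exp (st9_Phi α y t) * st9_m h X k α t‖ * τ ^ 2 ≤ (12 * C + 24 * 2 ^ k) * (y ^ 2)⁻¹ := by
    rw [norm_mul, Complex.norm_exp]
    have hc0 : 0 ≤ 12 * C * (y ^ 2)⁻¹ := by positivity
    have hc1 : 0 ≤ 24 * 2 ^ k * (y ^ 2)⁻¹ := by positivity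
    by_cases hT : |t| ≤ y ^ (1/2 - 2 * δ)
    · have h1 := hmid y α t hy hg (by rw [hta]; gcongr) hT
      have h2 : exp (st9_Phi α y t).re ≤ C * (y ^ 4)⁻¹ := (exp_le_exp.2 (st9_Phi_re hα t)).trans h1
      have h3 : ‖st9_m h X k α t‖ ≤ 3 := by
        refine hm.trans ?_
        have e1 : α / ‖s‖ ≤ 1 := (div_le_one hs0).2 hsα
        have e2 : ‖st9_bx h s‖ ^ (k+1) ≤ 1 := pow_le_one₀ (norm_nonneg _) hb1
        have : α / ‖s‖ * ‖st9_bx h s‖ ^ (k+1) ≤ 1 * 1 := by gcongr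
        linarith
      have h4 : τ ^ 2 ≤ 4 * y ^ 2 := by
        have e1 : |t| ≤ y ^ (1/2:ℝ) := hT.trans (rpow_le_rpow_of_exponent_le (by linarith) (by linarith))
        rw [← sq_abs, htY, mul_pow]
        calc _ ≤ (y ^ (1/2:ℝ)) ^ 2 * (4 * y) := by gcongr
          _ = 4 * y ^ 2 := by rw [← rpow_mul_natCast hyp.le]; norm_num; ring
      calc _ ≤ C * (y ^ 4)⁻¹ * 3 * (4 * y ^ 2) := by gcongr
        _ = 12 * C * (y ^ 2)⁻¹ := by field_simp; norm_num
        _ ≤ _ := by linarith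
    · push Not at hT
      have ht0 : 0 < |t| := lt_of_lt_of_le (by positivity) hT.le
      have h2 : exp (st9_Phi α y t).re ≤ 1 := exp_le_one_iff.2 (st9_Phi_nonpos hα t)
      have hb2 : ‖st9_bx h s‖ ≤ 2 / (h * |t|) := (st9_bx_tail hh0 hsre).trans (by gcongr)
      have hb3 : ‖st9_bx h s‖ ≤ 2 * y ^ (-δ) := by
        refine hb2.trans ?_
        rw [div_le_iff₀ (by positivity)]
        have : y ^ δ ≤ h * |t| := by
          calc y ^ δ = h * y ^ (1/2 - 2 * δ) := by rw [hh, ← rpow_add hyp]; congr 1; ring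
            _ ≤ _ := by gcongr
        calc (2:ℝ) = 2 * (y ^ (-δ) * y ^ δ) := by rw [← rpow_add hyp]; simp
          _ ≤ 2 * (y ^ (-δ) * (h * |t|)) := by gcongr
          _ = _ := by ring
      have hb4 : ‖st9_bx h s‖ ^ k ≤ 2 ^ k * (y ^ 4)⁻¹ := by
        calc _ ≤ (2 * y ^ (-δ)) ^ k := by gcongr
          _ = 2 ^ k * y ^ (-(k * δ)) := by rw [mul_pow, ← rpow_mul_natCast hyp.le]; congr 2; ring
          _ ≤ 2 ^ k * y ^ (-4:ℝ) := by gcongr; linarith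
          _ = _ := by rw [rpow_neg hyp.le]; norm_cast
      have h3 : ‖st9_m h X k α t‖ ≤ 1 / |t| * (2 ^ k * (y ^ 4)⁻¹ * (2 / (h * |t|))) * 3 := by
        refine hm.trans ?_
        rw [pow_succ]
        gcongr
        linarith
      have hh1 : 1 / h ≤ y := by
        rw [hh, one_div, ← rpow_neg hyp.le]
        conv_rhs => rw [← rpow_one y]
        exact rpow_le_rpow_of_exponent_le (by linarith) (by linarith)
      calc _ ≤ 1 * (1 / |t| * (2 ^ k * (y ^ 4)⁻¹ * (2 / (h * |t|))) * 3) * τ ^ 2 := by gcongr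
        _ = 6 * 2 ^ k * (y ^ 4)⁻¹ * (1 / h) * log y ^ 2 := by
            rw [← sq_abs τ, htY]; field_simp; norm_num
        _ ≤ 6 * 2 ^ k * (y ^ 4)⁻¹ * y * (4 * y) := by gcongr
        _ = 24 * 2 ^ k * (y ^ 2)⁻¹ := by field_simp; norm_num
        _ ≤ _ := by linarith
  have hτ0 : 0 < |τ| := by linarith
  have hr : (τ ^ 2)⁻¹ ≤ |τ| ^ (-(3/2:ℝ)) := by
    have : (τ ^ 2)⁻¹ = |τ| ^ (-2:ℝ) := by rw [rpow_neg hτ0.le, ← sq_abs]; norm_cast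
    rw [this]
    exact rpow_le_rpow_of_exponent_le hτ (by norm_num)
  have hτ2 : 0 < τ ^ 2 := by rw [← sq_abs]; positivity
  calc _ ≤ (12 * C + 24 * 2 ^ k) * (y ^ 2)⁻¹ * (τ ^ 2)⁻¹ := by
        rw [← div_eq_mul_inv, le_div_iff₀ hτ2]; exact key
    _ ≤ _ := by gcongr

theorem st9_J {η δ K : ℝ} (hη : 0 < η) (hδ : 0 < δ) (hδ1 : δ ≤ 1/16) (hK : st9_th δ K) (k : ℕ) (hk : 4 ≤ k * δ) :
    ∃ y0 C, 0 < C ∧ ∀ y α X : ℝ, y0 ≤ y → st9_good η δ α y → 0 ≤ X → X ≤ (k+1) * y ^ (-1/2 + 3 * δ) →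
    ‖(∫ τ : ℝ, Complex.exp (st9_Phi α y (τ / log y)) * st9_m (y ^ (-1/2 + 3 * δ)) X k α (τ / log y)) -
      (√(2 * π / (st9_f2 α y / log y ^ 2)) : ℝ)‖ ≤
      C * (1 / (st9_f2 α y / log y ^ 2) + y ^ (-1/2 + 3 * δ)) * √(2 * π / (st9_f2 α y / log y ^ 2)) := by
  obtain ⟨y1, c, C1, hc, hc2, hC1, hG⟩ := st9_Phi_gauss hη hδ (by linarith) hK
  obtain ⟨y2, C2, hC2, hT⟩ := st9_tail (η := η) hδ hδ1 hK k hk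
  obtain ⟨C3, hC3, hm⟩ := st9_m_bound (δ := δ) hη k
  obtain ⟨y3, -, hy3⟩ := st9_small (δ := 1/4) (c := 1 / (2 * (k+1))) (by norm_num) (by positivity)
  set C4 := C3 + (1 + η) / η + 24 * ((1 + η) / η) ^ 2 with hC4
  have hr : 0 < (1 + η) / η := by positivity
  have hr2 : 0 < 24 * ((1 + η) / η) ^ 2 := by positivity
  obtain ⟨C5, hC5, hcen⟩ := st9_central (C := C4) (by linarith) hc hc2
  refine ⟨max y1 (max y2 y3), C5 + 4 * C2 * C1 ^ 2, by positivity, fun y α X hy hg hX hX1 => ?_⟩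
  simp only [max_le_iff] at hy
  obtain ⟨hya, hyb, hyc⟩ := hy
  have hy4 := hg.y4
  have hyp : 0 < y := by linarith
  have hY := st9_Y1 hy4
  have hY0 : 0 < log y := by linarith
  have hα := hg.s0
  set h := y ^ (-1/2 + 3 * δ) with hh
  have hh0 : 0 < h := by positivity
  have hk0 : (0:ℝ) < k + 1 := by positivity
  have hh2 : (k+1) * h * 2 ≤ 1 := by
    have e1 : h ≤ y ^ (-(1/4:ℝ)) := rpow_le_rpow_of_exponent_le (by linarith) (by linarith)
    have e2 := e1.trans (hy3 y hyc)
    rw [le_div_iff₀ (by positivity)] at e2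
    linarith
  obtain ⟨ha1, ha2, hre⟩ := hG y α hya hg
  obtain ⟨b, hb, hb2⟩ := st9_Phi_taylor hη hg
  obtain ⟨d, hd, hd2⟩ := hm y α h X hg hδ hh0 hX hX1 hh2
  set a := st9_f2 α y / log y ^ 2 with ha
  have ha0 : 0 < a := by linarith
  have hcΦ : Continuous fun τ : ℝ => Complex.exp (st9_Phi α y (τ / log y)) :=
    (st9_Phi_cont (y := y) hα).comp (by fun_prop)
  have hcm : Continuous fun t : ℝ => st9_m h X k α t := by
    simp only [st9_m]
    exact (continuous_const.mul (st9_K_cont hh0 hα _)).mul (by fun_prop)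
  have hmi : Integrable fun t : ℝ => st9_m h X k α t := by
    have := (st9_expK_int hh0 hα k X).const_mul (α:ℂ)
    refine this.congr (Eventually.of_forall fun t => ?_)
    simp only [st9_m]; ring
  have hint : Integrable fun τ : ℝ => Complex.exp (st9_Phi α y (τ / log y)) * st9_m h X k α (τ / log y) := by
    refine (hmi.comp_div hY0.ne').bdd_mul (c := 1) hcΦ.aestronglyMeasurable (Eventually.of_forall fun τ => ?_)
    rw [Complex.norm_exp]
    exact exp_le_one_iff.2 (st9_Phi_nonpos hα _)
  have h1 := hcen a h b d (fun τ => st9_Phi α y (τ / log y)) (fun τ => st9_m h X k α (τ / log y)) ha1 hh0.le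
    (hb.trans (by gcongr; linarith)) (hd.trans (by linarith))
    (hcΦ.mul (hcm.comp (by fun_prop : Continuous fun τ : ℝ => τ / log y))).continuousOn
    (fun τ _ => (hb2 τ).trans (by gcongr; linarith)) hre
    (fun τ hτ => (hd2 τ hτ).trans (by gcongr; linarith))
  have hX2 : X ≤ 1 := by linarith
  have h2 := st9_tail_int hint (K := C2 * (y ^ 2)⁻¹) (fun τ hτ => hT y α X τ hyb hg hX hX2 hτ)
  have h3 : (y ^ 2)⁻¹ ≤ C1 ^ 2 * (1 / a * √(2 * π / a)) := by
    have e1 : 1 / a ≤ √(2 * π / a) := by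
      apply le_sqrt_of_sq_le
      rw [div_pow, div_le_div_iff₀ (by positivity) ha0]
      have : a * 1 ≤ a * (2 * π * a) := by
        gcongr
        have : 1 * 1 ≤ 2 * π * a := by gcongr; linarith [pi_gt_three]
        linarith
      linarith
    have e2 : a ^ 2 ≤ (C1 * y) ^ 2 := by gcongr
    calc (y ^ 2)⁻¹ ≤ C1 ^ 2 * (1 / a * (1 / a)) := by
          rw [inv_le_iff_one_le_mul₀ (by positivity)]
          have : C1 ^ 2 * (1 / a * (1 / a)) * y ^ 2 = (C1 * y) ^ 2 / a ^ 2 := by field_simp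
          rw [mul_comm, mul_comm, this, one_le_div (by positivity)]; exact e2
      _ ≤ _ := by gcongr
  have h4 : 0 ≤ 4 * C2 * C1 ^ 2 * (h * √(2 * π / a)) := by positivity
  have h5 : 4 * (C2 * (y ^ 2)⁻¹) ≤ 4 * (C2 * (C1 ^ 2 * (1 / a * √(2 * π / a)))) := by gcongr
  refine (norm_sub_le_norm_sub_add_norm_sub _ (∫ τ in (-1:ℝ)..1, Complex.exp (st9_Phi α y (τ / log y)) * st9_m h X k α (τ / log y)) _).trans ?_
  linarith
end

section
open Real Filter Topology MeasureTheory Set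

theorem st9_Psi {η δ K : ℝ} (hη : 0 < η) (hδ : 0 < δ) (hδ1 : δ ≤ 1/16) (hK : st9_th δ K) :
    ∃ y0 C, 0 < C ∧ ∀ x y α : ℝ, 0 < x → y0 ≤ y → st9_good η δ α y → st9_f1 α y = log x →
    |Psi x y * (α * √(2 * π * st9_f2 α y)) / (exp (α * log x) * zetaP α y) - 1| ≤
      C * (log y ^ 2 / st9_f2 α y + y ^ (-1/2 + 3 * δ)) := by
  obtain ⟨k, hk⟩ := exists_nat_ge (4 / δ)
  rw [div_le_iff₀ hδ] at hk
  obtain ⟨y1, C, hC, hJ⟩ := st9_J hη hδ hδ1 hK k hk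
  obtain ⟨y2, c, C1, hc, hc2, hC1, hG⟩ := st9_Phi_gauss hη hδ (by linarith) hK
  refine ⟨max y1 y2, C, hC, fun x y α hx hy hg hf => ?_⟩
  have hy1 := (le_max_left _ _).trans hy
  have hy4 := hg.y4
  have hyp : 0 < y := by linarith
  have hY := st9_Y1 hy4
  have hY0 : 0 < log y := by linarith
  have hα := hg.s0
  have ha1 := (hG y α ((le_max_right _ _).trans hy) hg).1
  set h := y ^ (-1/2 + 3 * δ) with hh
  have hh0 : 0 < h := by positivity
  set f := st9_f2 α y with hfd
  have hf0 : 0 < f := by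
    rw [one_le_div (by positivity)] at ha1
    have : 0 < log y ^ 2 := by positivity
    linarith
  have hζ := (st9_logzeta_deriv (y := y) hα).1
  set R := exp (α * log x) * zetaP α y with hR
  have hR0 : 0 < R := by positivity
  have key : ∀ r X : ℝ, 0 ≤ X → X ≤ (k+1) * h → (r:ℂ) = 1 / (2 * π) * ∫ t : ℝ, Complex.exp ((α + t * Complex.I) * (log x + X : ℝ)) *
      (st9_zC (α + t * Complex.I) y * st9_K h (k+1) (α + t * Complex.I)) →
      |r * (α * √(2 * π * f)) / R - 1| ≤ C * (log y ^ 2 / f + h) := by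
    intro r X hX hX1 hr
    have h1 := hJ y α X hy1 hg hX hX1
    rw [Measure.integral_comp_div (fun t => Complex.exp (st9_Phi α y t) * st9_m h X k α t), abs_of_pos hY0] at h1
    have e1 : ∀ t : ℝ, Complex.exp ((α + t * Complex.I) * (log x + X : ℝ)) *
        (st9_zC (α + t * Complex.I) y * st9_K h (k+1) (α + t * Complex.I)) =
        ((R / α : ℝ) : ℂ) * (Complex.exp (st9_Phi α y t) * st9_m h X k α t) := by
      intro t
      rw [← hf, ← mul_assoc, st9_R_eq hα, hf, ← hR, st9_m, st9_Phi]
      have : (α:ℂ) ≠ 0 := by exact_mod_cast hα.ne'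
      push_cast
      field_simp
    simp_rw [e1] at hr
    rw [integral_const_mul] at hr
    set J := ∫ t : ℝ, Complex.exp (st9_Phi α y t) * st9_m h X k α t
    set S := √(2 * π / (f / log y ^ 2)) with hS
    have hS0 : 0 < S := by positivity
    have hSf : S * √(2 * π * f) = 2 * π * log y := by
      rw [hS, ← sqrt_mul (by positivity)]
      have : 2 * π / (f / log y ^ 2) * (2 * π * f) = (2 * π * log y) ^ 2 := by field_simp
      rw [this, sqrt_sq (by positivity)]
    have e2 : ((r * (α * √(2 * π * f)) / R - 1 : ℝ) : ℂ) * S = log y • J - S := by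
      have hc1 : (π:ℂ) ≠ 0 := by exact_mod_cast pi_ne_zero
      have hc2 : (R:ℂ) ≠ 0 := by exact_mod_cast hR0.ne'
      have hc3 : (α:ℂ) ≠ 0 := by exact_mod_cast hα.ne'
      have hc4 : (S:ℂ) * (√(2 * π * f) : ℝ) = 2 * π * (log y : ℝ) := by exact_mod_cast hSf
      rw [Complex.real_smul]
      push_cast [hr]
      rw [sub_mul, one_mul]
      congr 1
      calc _ = 1 / (2 * (π:ℂ)) * J * ((S:ℂ) * (√(2 * π * f) : ℝ)) := by field_simp
        _ = _ := by rw [hc4]; field_simp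
    rw [← e2, norm_mul, Complex.norm_real, Complex.norm_real, norm_of_nonneg hS0.le, norm_eq_abs, one_div_div] at h1
    exact le_of_mul_le_mul_right h1 hS0
  obtain ⟨lo, hi, h1, h2, h3, h4⟩ := st9_sand hh0 hα hx hyp.le k
  have k1 := key lo 0 le_rfl (by positivity) (by rw [h3, add_zero])
  have k2 := key hi _ (by positivity) le_rfl h4
  rw [abs_le] at k1 k2 ⊢
  have m1 : lo * (α * √(2 * π * f)) / R ≤ Psi x y * (α * √(2 * π * f)) / R := by gcongr
  have m2 : Psi x y * (α * √(2 * π * f)) / R ≤ hi * (α * √(2 * π * f)) / R := by gcongr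
  constructor <;> linarith
end

section
open Real Filter Topology MeasureTheory Set

noncomputable def st9_q (s : ℝ) : ℝ := (riemannZeta₁ (s:ℂ)).re

theorem st9_qz {s : ℝ} (hs : s < 1) : (riemannZeta (s:ℂ)).re * (s - 1) = st9_q s := by
  have h1 : (s:ℂ) - 1 ≠ 0 := by rw [sub_ne_zero]; exact_mod_cast hs.ne
  have h : riemannZeta (s:ℂ) * ((s - 1 : ℝ) : ℂ) = riemannZeta₁ s := by
    rw [riemannZeta_eq_inv_sub_mul (sub_ne_zero.1 h1)]; push_cast; field_simp
  rw [st9_q, ← h, Complex.re_mul_ofReal]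

theorem st9_logq : ∃ C, 0 < C ∧ ∀ s ∈ Icc (0:ℝ) (1/2), ∀ t ∈ Icc (0:ℝ) (1/2), |log (st9_q t) - log (st9_q s)| ≤ C * |t - s| := by
  have hp : ∀ s ∈ Icc (0:ℝ) (1/2), 0 < st9_q s := fun s hs => st9_zeta1_pos hs.1 (by linarith [hs.2])
  have hd : ∀ s : ℝ, HasDerivAt st9_q (deriv riemannZeta₁ (s:ℂ)).re s := fun s =>
    HasDerivAt.real_of_complex (differentiable_riemannZeta₁ (s:ℂ)).hasDerivAt
  have hdc : Continuous fun s : ℝ => (deriv riemannZeta₁ (s:ℂ)).re :=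
    Complex.continuous_re.comp (((differentiable_riemannZeta₁.contDiff (n := 2)).differentiable_deriv_two).continuous.comp Complex.continuous_ofReal)
  have hc : ContinuousOn (fun s : ℝ => (deriv riemannZeta₁ (s:ℂ)).re / st9_q s) (Icc 0 (1/2)) :=
    hdc.continuousOn.div (fun s _ => (hd s).continuousAt.continuousWithinAt) fun s hs => (hp s hs).ne'
  obtain ⟨C, hC⟩ := isCompact_Icc.exists_bound_of_continuousOn hc
  refine ⟨|C| + 1, by positivity, fun s hs t ht => ?_⟩
  have := (convex_Icc (0:ℝ) (1/2)).norm_image_sub_le_of_norm_hasDerivWithin_le (f := fun s => log (st9_q s))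
    (fun s hs => ((hd s).log (hp s hs).ne').hasDerivWithinAt)
    (fun s hs => (hC s hs).trans ((le_abs_self C).trans (by linarith : |C| ≤ |C| + 1))) hs ht
  simpa using this

theorem st9_abslog {r : ℝ} (hr : 0 < r) : |log r| ≤ |r - 1| * (1 + 1 / r) := by
  have h1 := log_le_sub_one_of_pos hr
  have h2 := one_sub_inv_le_log_of_pos hr
  have h3 : 0 ≤ |r - 1| * (1 / r) := by positivity
  have h4 : -(|r - 1| * (1 / r)) ≤ 1 - r⁻¹ := by
    have : (1:ℝ) - r⁻¹ = (r - 1) * (1 / r) := by field_simp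
    rw [this, ← neg_mul]; gcongr; exact neg_abs_le _
  have h5 := abs_nonneg (r - 1)
  have h6 := le_abs_self (r - 1)
  rw [abs_le]; constructor <;> linarith

theorem st9_abslog' {r e : ℝ} (h : |r - 1| ≤ e) (he : e ≤ 1/2) : 0 < r ∧ |log r| ≤ 3 * e := by
  have h1 := (abs_le.1 h).1
  have hr : 1/2 ≤ r := by linarith
  have hr0 : 0 < r := by linarith
  refine ⟨hr0, (st9_abslog hr0).trans ?_⟩
  have : 1 / r ≤ 2 := by rw [div_le_iff₀ hr0]; linarith
  have h0 : 0 ≤ e := (abs_nonneg _).trans h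
  calc _ ≤ e * (1 + 2) := by gcongr
    _ = _ := by ring

/-- the small quantities -/
theorem st9_smalls {δ κ : ℝ} (hδ : 0 < δ) (hδ1 : δ ≤ 1/16) (hκ : 0 < κ) : ∃ y0, 4 ≤ y0 ∧ ∀ y σ : ℝ, y0 ≤ y → 0 < σ → σ ≤ 1/2 - 2 * δ →
    y ^ (-σ) + y ^ (-1/2 + 3 * δ) + log y * y ^ (-(1 - σ)) ≤ κ * (y ^ (1 - 3 * σ) / log y) ∧
    y ^ (-1/2 + 3 * δ) + log y * y ^ (-(1 - σ)) ≤ κ := by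
  obtain ⟨y0, h4, h⟩ := st9_small hδ (show 0 < min (κ / 3 * δ ^ 2) 1 * (min (κ / 3) 1 * δ) by positivity)
  refine ⟨y0, h4, fun y σ hy hσ hσ1 => ?_⟩
  have hy4 : 4 ≤ y := h4.trans hy
  have hyp : 0 < y := by linarith
  have hY := st9_Y1 hy4
  have hY0 : 0 < log y := by linarith
  have hs := h y hy
  have hl : log y ≤ y ^ δ / δ := log_le_rpow_div hyp.le hδ
  have m1 : min (κ / 3 * δ ^ 2) 1 ≤ 1 := min_le_right _ _
  have m2 : min (κ / 3) 1 ≤ 1 := min_le_right _ _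
  have m3 : min (κ / 3 * δ ^ 2) 1 ≤ κ / 3 * δ ^ 2 := min_le_left _ _
  have m4 : min (κ / 3) 1 ≤ κ / 3 := min_le_left _ _
  have m0 : 0 < min (κ / 3 * δ ^ 2) 1 := by positivity
  have m5 : 0 < min (κ / 3) 1 := by positivity
  have s1 : y ^ (-δ) ≤ κ / 3 * δ ^ 2 := by
    have : min (κ / 3 * δ ^ 2) 1 * (min (κ / 3) 1 * δ) ≤ (κ / 3 * δ ^ 2) * (1 * 1) := by gcongr; linarith
    linarith
  have s2 : y ^ (-δ) ≤ κ / 3 * δ := by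
    have : min (κ / 3 * δ ^ 2) 1 * (min (κ / 3) 1 * δ) ≤ 1 * (κ / 3 * δ) := by gcongr
    linarith
  have hl2 : log y ^ 2 * y ^ (-(3 * δ)) ≤ κ / 3 := by
    calc _ ≤ (y ^ δ / δ) ^ 2 * y ^ (-(3 * δ)) := by gcongr
      _ = y ^ (-δ) / δ ^ 2 := by
        rw [div_pow, ← rpow_mul_natCast hyp.le, div_mul_eq_mul_div, ← rpow_add hyp]; congr 2; push_cast; ring
      _ ≤ κ / 3 * δ ^ 2 / δ ^ 2 := by gcongr
      _ = _ := by field_simp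
  have hl1 : log y * y ^ (-(3 * δ)) ≤ log y ^ 2 * y ^ (-(3 * δ)) := by gcongr; nlinarith
  have hl0 : y ^ (-(3 * δ)) ≤ log y ^ 2 * y ^ (-(3 * δ)) := by
    calc _ = 1 * y ^ (-(3 * δ)) := by ring
      _ ≤ _ := by gcongr; nlinarith
  have P : ∀ a b : ℝ, a ≤ b → y ^ a ≤ y ^ b := fun a b hab => rpow_le_rpow_of_exponent_le (by linarith) hab
  have a1 : y ^ (-σ) ≤ y ^ (1 - 3 * σ) * y ^ (-(3 * δ)) := by rw [← rpow_add hyp]; exact P _ _ (by linarith)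
  have a2 : y ^ (-1/2 + 3 * δ) ≤ y ^ (1 - 3 * σ) * y ^ (-(3 * δ)) := by rw [← rpow_add hyp]; exact P _ _ (by linarith)
  have a3 : y ^ (-(1 - σ)) ≤ y ^ (1 - 3 * σ) * y ^ (-(3 * δ)) := by rw [← rpow_add hyp]; exact P _ _ (by linarith)
  have w0 : 0 < y ^ (1 - 3 * σ) := by positivity
  constructor
  · rw [← mul_div_assoc, le_div_iff₀ hY0]
    have b1 : y ^ (-σ) * log y ≤ y ^ (1 - 3 * σ) * (κ / 3) := by
      calc _ ≤ y ^ (1 - 3 * σ) * y ^ (-(3 * δ)) * log y := by gcongr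
        _ = y ^ (1 - 3 * σ) * (log y * y ^ (-(3 * δ))) := by ring
        _ ≤ _ := by gcongr; linarith
    have b2 : y ^ (-1/2 + 3 * δ) * log y ≤ y ^ (1 - 3 * σ) * (κ / 3) := by
      calc _ ≤ y ^ (1 - 3 * σ) * y ^ (-(3 * δ)) * log y := by gcongr
        _ = y ^ (1 - 3 * σ) * (log y * y ^ (-(3 * δ))) := by ring
        _ ≤ _ := by gcongr; linarith
    have b3 : log y * y ^ (-(1 - σ)) * log y ≤ y ^ (1 - 3 * σ) * (κ / 3) := by
      calc _ ≤ log y * (y ^ (1 - 3 * σ) * y ^ (-(3 * δ))) * log y := by gcongr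
        _ = y ^ (1 - 3 * σ) * (log y ^ 2 * y ^ (-(3 * δ))) := by ring
        _ ≤ _ := by gcongr
    linarith
  · have b1 := P (-1/2 + 3 * δ) (-(3 * δ)) (by linarith)
    have b2 := P (-(1 - σ)) (-(3 * δ)) (by linarith)
    have b3 : log y * y ^ (-(1 - σ)) ≤ log y * y ^ (-(3 * δ)) := by gcongr
    linarith
end

section
open Real Filter Topology MeasureTheory Set

theorem st9_ident {Ψ x r z σ α f B I Y H q L r1 r2 ζ ξu : ℝ} (hr1 : 0 < r1) (hx : 0 < x) (hxL : log x = L)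
    (hr : 0 < r) (hσ : 0 < σ) (hα : 0 < α) (hf : 0 < f) (hI : 0 < I) (hY : 0 < Y) (hB : B = Y ^ 2 * I) (hH : 0 < H) (hq : 0 < q)
    (hζ : 0 < ζ) (hξ : ξu = (1 - σ) * L) (hz : z = q / σ)
    (h1 : Ψ * (α * √(2 * π * f)) / (exp (α * L) * ζ) = r1) (h2 : r * √(2 * π * I) * exp ξu / H = r2)
    (G E : ℝ) (hG : 0 < G)
    (hE : E = log G - (α * L + log ζ - σ * L - log q - log Y - log H - (log (α / σ) + log (f / B) / 2 - log r1 + log r2))) :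
    Ψ / (x * r * z) = G * exp (-E) := by
  have hΨ : 0 < Ψ := by
    have : Ψ = r1 * (exp (α * L) * ζ) / (α * √(2 * π * f)) := by rw [← h1]; field_simp
    rw [this]; positivity
  have hs : ∀ v : ℝ, 0 < v → log √(2 * π * v) = (log (2 * π) + log v) / 2 := fun v hv => by
    rw [log_sqrt (by positivity), log_mul (by positivity) hv.ne']
  have l1 : log r1 = log Ψ + (log α + (log (2 * π) + log f) / 2) - (α * L + log ζ) := by
    rw [← h1, log_div (by positivity) (by positivity), log_mul (by positivity) (by positivity), log_mul (by positivity) (by positivity),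
      log_mul (by positivity) (by positivity), log_exp, hs f hf]
  have l2 : log r2 = log r + (log (2 * π) + log I) / 2 + ξu - log H := by
    rw [← h2, log_div (by positivity) (by positivity), log_mul (by positivity) (by positivity), log_mul (by positivity) (by positivity),
      log_exp, hs I hI]
  have hB0 : 0 < B := by rw [hB]; positivity
  have l3 : log B = 2 * log Y + log I := by
    rw [hB, log_mul (by positivity) (by positivity), log_pow]; norm_num
  refine log_injOn_pos (mem_Ioi.2 (by rw [hz]; positivity)) (mem_Ioi.2 (by positivity)) ?_
  rw [hz, log_div (by positivity) (by positivity), log_mul (by positivity) (by positivity), log_mul (by positivity) (by positivity),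
    log_div (by positivity) (by positivity), log_mul (by positivity) (by positivity), log_exp, hE,
    log_div (by positivity) (by positivity), log_div (by positivity) (by positivity), l1, l2, l3, hxL, hξ]
  ring

set_option maxHeartbeats 1000000 in
theorem st9_main {ρ : ℝ → ℝ} (hρ : st9_Dk ρ) {η δ K : ℝ} (hη : 0 < η) (hδ : 0 < δ) (hδ1 : δ ≤ 1/16) (hK : st9_th δ K) :
    ∃ y0 c C, 0 < c ∧ 0 < C ∧ ∀ x y σ α u ξ, y0 ≤ y → 0 < x → st9_good η δ σ y → σ ≤ 1/2 - 2 * δ → 2 ≤ u → 0 < ξ →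
      exp ξ = 1 + u * ξ → u * log y = log x → ξ = (1 - σ) * log y → 0 < α → st9_f1 α y = log x →
      ∃ E₁ E₂ : ℝ, c * (y ^ (1 - 3 * σ) / log y) ≤ E₁ ∧ E₁ ≤ C * (y ^ (1 - 3 * σ) / log y) ∧
        c * (y ^ (1 - 3 * σ) / log y) ≤ E₂ ∧ E₂ ≤ C * (y ^ (1 - 3 * σ) / log y) ∧
         (Psi x y : ℝ) / (x * ρ u * Zfun σ) = Gfun ρ σ y * Real.exp (-E₁) ∧
         (Psi x y : ℝ) / (x * ρ u * Zfun σ) = Gfun ρ α y * Real.exp E₂ := by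
  obtain ⟨y1, c, C, C', hc, hC, hC', hD⟩ := st9_Dbounds hρ hη hδ (by linarith) hK
  obtain ⟨y2, C2, hC2, hP⟩ := st9_Psi hη hδ hδ1 hK
  obtain ⟨C3, hC3, hR⟩ := st9_rho_asymp hρ
  obtain ⟨C4, hC4, hq⟩ := st9_logq
  have hl : 0 < log (1 + η) := log_pos (by linarith)
  set M := C' / log (1 + η) + 4 * C' * (1 + 2 / c) + 3 * (C2 * (1 / c + 1)) + 3 * (2 * C3) + C4 * C' with hM
  have hM0 : 0 < M := by positivity
  obtain ⟨y3, hy34, hy3⟩ := st9_smalls hδ hδ1 (show 0 < min (c / 2 / M) (min (1/2 / (C2 * (1 / c + 1))) (1/2 / (2 * C3))) by positivity)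
  refine ⟨max y1 (max y2 y3), c / 2, C + c / 2, by positivity, by positivity, fun x y σ α u ξ hy hx hg hσ2 hu hξ0 hξ huL hξσ hα hf1 => ?_⟩
  simp only [max_le_iff] at hy
  obtain ⟨hya, hyb, hyc⟩ := hy
  have hy4 := hg.y4
  have hyp : 0 < y := by linarith
  have hY := st9_Y1 hy4
  have hY0 : 0 < log y := by linarith
  have hσ := hg.s0
  have hA : st9_A σ y = log x := by
    rw [st9_A_w (by linarith), ← hξσ, st9_int_exp_xi hξ0 hξ, ← huL]; ring
  obtain ⟨hlt, hgα, hd, -, hf2a, hf2b, hfB, d1, d2, d3, d4⟩ := hD y σ α hya hg hσ2 hα (by rw [hf1, hA])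
  rw [hA] at d1 d2 d3 d4
  obtain ⟨hA1, hA2⟩ := st9_A_bounds hy4 hσ.le (by linarith : σ ≤ 1/2)
  obtain ⟨hB1, hB2⟩ := st9_AB (y := y) (s := σ) (by linarith) (by linarith)
  obtain ⟨sm1, sm2⟩ := hy3 y σ hyc hσ hσ2
  have hα1 := hgα.s1
  have p1 := hP x y α hx hyb hgα hf1
  have p2 := hR u ξ hu hξ0 hξ
  set w := y ^ (1 - 3 * σ) / log y with hw
  have hw0 : 0 < w := by positivity
  set f := st9_f2 α y with hfd
  set h := y ^ (-1/2 + 3 * δ) with hh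
  have hh0 : 0 < h := by positivity
  set g := log y * y ^ (-(1 - σ)) with hgd
  have hg0 : 0 < g := by positivity
  set b := y ^ (-σ) with hb
  have hb0 : 0 < b := by positivity
  have hyi : y ^ (-(1 - σ)) * y ^ (1 - σ) = 1 := by rw [← rpow_add hyp]; simp
  have hy0 : 0 < y ^ (1 - σ) := by positivity
  have hf0 : 0 < f := lt_of_lt_of_le (by positivity) hf2a
  have e1 : C2 * (log y ^ 2 / f + h) ≤ C2 * (1 / c + 1) * (h + g) := by
    have : log y ^ 2 / f ≤ 1 / c * g := by
      rw [div_le_iff₀ hf0]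
      calc log y ^ 2 = 1 / c * g * (c * (log y * y ^ (1 - σ))) := by
            rw [hgd]; field_simp; linear_combination (-1 : ℝ) * hyi
        _ ≤ _ := by gcongr
    have h2 : 0 ≤ 1 / c * h := by positivity
    rw [mul_assoc]
    gcongr
    linarith
  have e2 : C3 / u ≤ 2 * C3 * (h + g) := by
    rw [div_le_iff₀ (by linarith)]
    have : 1 ≤ 2 * g * u := by
      have : y ^ (1 - σ) / 2 ≤ u * log y := by rw [huL, ← hA]; exact hA1
      calc (1:ℝ) = 2 * y ^ (-(1 - σ)) * (y ^ (1 - σ) / 2) := by linear_combination (-1 : ℝ) * hyi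
        _ ≤ 2 * y ^ (-(1 - σ)) * (u * log y) := by gcongr
        _ = _ := by rw [hgd]; ring
    have h3 : C3 * 1 ≤ C3 * (2 * g * u) := by gcongr
    have h2 : 0 ≤ 2 * C3 * h * u := by positivity
    linarith
  have sm3 := sm2.trans ((min_le_right _ _).trans (min_le_left _ _))
  have sm4 := sm2.trans ((min_le_right _ _).trans (min_le_right _ _))
  rw [le_div_iff₀ (by positivity)] at sm3 sm4
  obtain ⟨r1, l1⟩ := st9_abslog' (p1.trans e1) (by linarith)
  obtain ⟨r2, l2⟩ := st9_abslog' (p2.trans e2) (by linarith)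
  set R1 := Psi x y * (α * √(2 * π * f)) / (exp (α * log x) * zetaP α y) with hR1
  set I := ∫ w in (0:ℝ)..1, w * exp (ξ * w) with hI
  set R2 := ρ u * √(2 * π * I) * exp (ξ * u) / rhoHat ρ (-ξ) with hR2
  have hBI : st9_B σ y = log y ^ 2 * I := by rw [st9_B_w (by linarith), hI, hξσ]
  have hI0 : 0 < I := by
    have := (st9_a_bounds ξ hξ0.le).1
    rw [st9_int_exp_xi hξ0 hξ] at this
    linarith
  set B := st9_B σ y with hBd
  have hB0 : 0 < B := by rw [hBI]; positivity
  have hBl : log y * y ^ (1 - σ) / 4 ≤ B := by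
    have : log y * (y ^ (1 - σ) / 2) ≤ log y * st9_A σ y := by gcongr
    linarith
  have hBu : B ≤ 2 * (log y * y ^ (1 - σ)) := by
    have : log y * st9_A σ y ≤ log y * (2 * y ^ (1 - σ)) := by gcongr
    linarith
  -- log (f/B)
  have l3 : |log (f / B)| ≤ 4 * C' * (1 + 2 / c) * b := by
    refine (st9_abslog (by positivity)).trans ?_
    have t1 : |f / B - 1| ≤ 4 * C' * b := by
      have : f / B - 1 = (f - B) / B := by field_simp
      rw [this, abs_div, abs_of_pos hB0, div_le_iff₀ hB0]
      refine hfB.trans ?_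
      have e : y ^ (1 - 2 * σ) = b * y ^ (1 - σ) := by rw [hb, ← rpow_add hyp]; congr 1; ring
      rw [e]
      calc _ = 4 * C' * b * (log y * y ^ (1 - σ) / 4) := by ring
        _ ≤ _ := by gcongr
    have t2 : 1 / (f / B) ≤ 2 / c := by
      rw [one_div_div, div_le_div_iff₀ hf0 hc]
      have : B * c ≤ 2 * (log y * y ^ (1 - σ)) * c := by gcongr
      linarith
    calc _ ≤ 4 * C' * b * (1 + 2 / c) := by gcongr
      _ = _ := by ring
  have l4 : |log (α / σ)| ≤ C' / log (1 + η) * b := by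
    rw [abs_of_nonneg (log_nonneg (by rw [one_le_div hσ]; exact hlt.le))]
    refine (log_le_sub_one_of_pos (by positivity)).trans ?_
    have hκ : log (1 + η) ≤ σ * log y := by
      have := log_le_log (by linarith) hg.pw
      rwa [log_rpow hyp] at this
    have : α / σ - 1 = (α - σ) / σ := by field_simp
    rw [this]
    calc _ ≤ C' * (b / log y) / σ := by gcongr
      _ = C' / (σ * log y) * b := by field_simp
      _ ≤ _ := by gcongr
  have l5 : |log (st9_q α) - log (st9_q σ)| ≤ C4 * C' * b := by
    refine (hq σ ⟨hσ.le, by linarith⟩ α ⟨hα.le, by linarith⟩).trans ?_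
    rw [abs_of_pos (by linarith), mul_assoc]
    gcongr
    refine hd.trans ?_
    gcongr
    exact div_le_self hb0.le hY
  set P := log (α / σ) + log (f / B) / 2 - log R1 + log R2 with hPd
  have hPw : |P| + |log (st9_q α) - log (st9_q σ)| ≤ c / 2 * w := by
    have t1 : M * (b + h + g) ≤ c / 2 * w := by
      have t := sm1.trans (mul_le_mul_of_nonneg_right (min_le_left _ _) hw0.le)
      calc _ ≤ M * (c / 2 / M * w) := by gcongr
        _ = _ := by field_simp
    have t2 : |P| ≤ |log (α / σ)| + |log (f / B)| / 2 + |log R1| + |log R2| := by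
      rw [hPd]
      refine (abs_add_le _ _).trans ?_
      gcongr
      refine (abs_sub _ _).trans ?_
      gcongr
      refine (abs_add_le _ _).trans ?_
      rw [abs_div, abs_two]
    have t3 : M * (b + h + g) = (C' / log (1 + η) * b + 4 * C' * (1 + 2 / c) * b + 3 * (C2 * (1 / c + 1) * (h + g)) + 3 * (2 * C3 * (h + g)) + C4 * C' * b)
      + ((C' / log (1 + η) + 4 * C' * (1 + 2 / c) + C4 * C') * (h + g) + (3 * (C2 * (1 / c + 1)) + 3 * (2 * C3)) * b) := by
      rw [hM]; ring
    have t4 : 0 ≤ (C' / log (1 + η) + 4 * C' * (1 + 2 / c) + C4 * C') * (h + g) + (3 * (C2 * (1 / c + 1)) + 3 * (2 * C3)) * b := by positivity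
    have t5 := abs_nonneg (log (f / B))
    linarith
  have hξu : ξ * u = (1 - σ) * log x := by rw [hξσ, ← huL]; ring
  have hζα := (st9_logzeta_deriv (y := y) hα).1
  have hζσ := (st9_logzeta_deriv (y := y) hσ).1
  have hHα := (st9_logM_deriv hρ (by linarith : α ≤ 1) (by linarith : 1 ≤ y)).1
  have hHσ := (st9_logM_deriv hρ (by linarith : σ ≤ 1) (by linarith : 1 ≤ y)).1
  have hξ2 : -ξ = (σ - 1) * log y := by rw [hξσ]; ring
  have hqσ : 0 < st9_q σ := st9_zeta1_pos hσ.le (by linarith)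
  have hqα : 0 < st9_q α := st9_zeta1_pos hα.le (by linarith)
  have hZ : Zfun σ = st9_q σ / σ := by rw [Zfun, if_neg (by linarith), st9_qz (by linarith)]
  have hGf : ∀ s : ℝ, s < 1 → Gfun ρ s y = zetaP s y / (st9_q s * log y * rhoHat ρ ((s - 1) * log y)) := fun s hs => by
    rw [Gfun, Ffun, st9_qz hs]
  have hlG : ∀ s : ℝ, 0 < zetaP s y → 0 < st9_q s → 0 < rhoHat ρ ((s - 1) * log y) →
      log (zetaP s y / (st9_q s * log y * rhoHat ρ ((s - 1) * log y))) =
      log (zetaP s y) - (log (st9_q s) + log (log y) + log (rhoHat ρ ((s - 1) * log y))) := fun s a1 a2 a3 => by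
    rw [log_div (by positivity) (by positivity), log_mul (by positivity) (by positivity), log_mul (by positivity) (by positivity)]
  have key := st9_ident (Ψ := Psi x y) (x := x) (r := ρ u) (z := Zfun σ) (σ := σ) (α := α) (f := f) (B := B) (I := I) (Y := log y) (H := rhoHat ρ (-ξ))
    (q := st9_q σ) (L := log x) (ζ := zetaP α y) (ξu := ξ * u)
    r1 hx rfl (st9_rho_pos hρ (by linarith)) hσ hα hf0 hI0 hY0 hBI (by rw [hξ2]; exact hHσ) hqσ hζα hξu hZ rfl rfl
  rw [← hPd, hξ2] at key
  have hPa := abs_le.1 (le_refl |P|)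
  have hQa := abs_le.1 (le_refl |log (st9_q α) - log (st9_q σ)|)
  have hP0 := abs_nonneg P
  have hQ0 := abs_nonneg (log (st9_q α) - log (st9_q σ))
  refine ⟨((log (zetaP σ y) + σ * log x) - (log (zetaP α y) + α * log x)) + P,
    ((α * log x + log (rhoHat ρ ((α - 1) * log y))) - (σ * log x + log (rhoHat ρ ((σ - 1) * log y)))) + (log (st9_q α) - log (st9_q σ)) - P,
    by linarith, by linarith, by linarith, by linarith, ?_, ?_⟩
  · rw [hGf σ (by linarith)]
    apply key _ _ (by positivity)
    rw [hlG σ hζσ hqσ hHσ]; ring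
  · rw [hGf α (by linarith)]
    rw [← neg_neg ((α * log x + log (rhoHat ρ ((α - 1) * log y))) - (σ * log x + log (rhoHat ρ ((σ - 1) * log y))) + (log (st9_q α) - log (st9_q σ)) - P)]
    apply key _ _ (by positivity)
    rw [hlG α hζα hqα hHα]; ring
end

section
open Real Filter Topology MeasureTheory Set

theorem st9_xi_mono {a b : ℝ} (hab : a ≤ b) : ∫ w in (0:ℝ)..1, exp (a * w) ≤ ∫ w in (0:ℝ)..1, exp (b * w) := by
  refine intervalIntegral.integral_mono_on zero_le_one (Continuous.intervalIntegrable (by fun_prop) _ _)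
    (Continuous.intervalIntegrable (by fun_prop) _ _) fun w hw => ?_
  have := hw.1
  gcongr

theorem st9_param {ε : ℝ} (hε : 0 < ε) (hε1 : ε < 1) (y0 : ℝ) : ∃ L0 : ℝ, 4 ≤ L0 ∧ ∀ L y u ξ σ : ℝ, L0 ≤ L → (1 + ε) * L ≤ y →
    y ≤ L ^ (2 - ε) → u = L / log y → (1 < u → 0 < ξ ∧ exp ξ = 1 + u * ξ) → σ = 1 - ξ / log y →
    y0 ≤ y ∧ st9_good (ε/2) (ε/16) σ y ∧ σ ≤ 1/2 - 2 * (ε/16) ∧ 2 ≤ u ∧ 0 < ξ ∧ exp ξ = 1 + u * ξ ∧ u * log y = L ∧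
      ξ = (1 - σ) * log y := by
  obtain ⟨L1, h4, hL1⟩ := st9_small (δ := ε/4) (c := 1/3) (by positivity) (by norm_num)
  refine ⟨max L1 (max y0 (max 64 ((2 + ε) / ε))), by simp [h4], fun L y u ξ σ hL hy1 hy2 hu hξ hσ => ?_⟩
  simp only [max_le_iff] at hL
  obtain ⟨ha, hb, hc, hd⟩ := hL
  rw [div_le_iff₀ hε] at hd
  have hL0 : 0 < L := by linarith
  have hεL : 0 < ε * L := by positivity
  have hyL : L ≤ y := by linarith
  have hyp : 0 < y := by linarith
  have hY := st9_Y1 (y := y) (by linarith)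
  have hY0 : 0 < log y := by linarith
  have hYL : 2 * log y ≤ L := by
    have e1 : log y ≤ (2 - ε) * log L := by
      rw [← log_rpow hL0]; exact log_le_log hyp hy2
    have e0 : 0 ≤ log L := log_nonneg (by linarith)
    have e2 : log L ≤ L ^ (1/2:ℝ) / (1/2) := log_le_rpow_div hL0.le (by norm_num)
    have e3 : 8 ≤ L ^ (1/2:ℝ) := by
      rw [← sqrt_eq_rpow]; exact le_sqrt_of_sq_le (by linarith)
    have e4 : L ^ (1/2:ℝ) * L ^ (1/2:ℝ) = L := by rw [← rpow_add hL0]; norm_num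
    have e5 : 8 * L ^ (1/2:ℝ) ≤ L ^ (1/2:ℝ) * L ^ (1/2:ℝ) := by gcongr
    have e6 : 0 ≤ ε * log L := by positivity
    linarith
  have hu2 : 2 ≤ u := by rw [hu, le_div_iff₀ hY0]; linarith
  obtain ⟨hξ0, hξe⟩ := hξ (by linarith)
  have huL : u * log y = L := by rw [hu]; field_simp
  have hξσ : ξ = (1 - σ) * log y := by rw [hσ]; field_simp; ring
  have hI := st9_int_exp_xi hξ0 hξe
  have hσ0 : 0 < σ := by
    by_contra hn
    have : 1 * log y ≤ ξ := by rw [hξσ]; gcongr; linarith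
    have h1 := st9_xi_mono this
    have h2 := st9_A_w (s := 0) (y := y) (by linarith)
    rw [st9_A_eq (by norm_num)] at h2
    simp only [sub_zero, rpow_one, div_one] at h2
    have h3 : log y * ∫ w in (0:ℝ)..1, exp (1 * log y * w) ≤ log y * u := by rw [← hI]; gcongr
    linarith
  have hσ2 : σ ≤ 1/2 - 2 * (ε/16) := by
    by_contra! hn
    have : ξ ≤ (1 - (1/2 - 2 * (ε/16))) * log y := by rw [hξσ]; gcongr
    have h1 := st9_xi_mono this
    have h2 := st9_A_w (s := 1/2 - 2 * (ε/16)) (y := y) (by linarith)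
    have h3 := (st9_A_bounds (s := 1/2 - 2 * (ε/16)) (y := y) (by linarith) (by linarith) (by linarith)).2
    have h4 : log y * u ≤ log y * ∫ w in (0:ℝ)..1, exp ((1 - (1/2 - 2 * (ε/16))) * log y * w) := by rw [← hI]; gcongr
    have h5 : y ^ (1 - (1/2 - 2 * (ε/16))) ≤ L * L ^ (-(ε/4)) := by
      calc _ ≤ (L ^ (2 - ε)) ^ (1 - (1/2 - 2 * (ε/16))) := by gcongr; linarith
        _ = L ^ ((2 - ε) * (1 - (1/2 - 2 * (ε/16)))) := by rw [← rpow_mul hL0.le]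
        _ ≤ L ^ (1 + -(ε/4)) := by
          apply rpow_le_rpow_of_exponent_le (by linarith)
          have : 0 ≤ ε * ε := by positivity
          linarith
        _ = _ := by rw [rpow_add hL0, rpow_one]
    have h6 : L * L ^ (-(ε/4)) ≤ L * (1/3) := by gcongr; exact hL1 L ha
    linarith
  refine ⟨hb.trans hyL, ⟨by linarith, hσ0, by linarith, ?_⟩, hσ2, hu2, hξ0, hξe, huL, hξσ⟩
  have e1 : y ^ (1 - σ) = 1 + (1 - σ) * L := by
    rw [rpow_def_of_pos hyp, mul_comm, ← hξσ, hξe, ← huL, hξσ]; ring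
  have e2 : y ^ σ * y ^ (1 - σ) = y := by rw [← rpow_add hyp]; simp
  have e3 : (1 + ε/2) * y ^ (1 - σ) ≤ y ^ σ * y ^ (1 - σ) := by
    have : 0 ≤ σ * L := by positivity
    rw [e2, e1]
    calc _ ≤ (1 + ε/2) * (1 + L) := by gcongr; linarith
      _ ≤ _ := by linarith
  exact le_of_mul_le_mul_right e3 (by positivity)

end

/-- Phase transition under RH: for `(1+ε) log x ≤ y ≤ (log x)^{2-ε}` and `x` large,
`Ψ(x,y)/(x ρ(u) Z(σ)) = G(σ,y) exp(-Θ_ε((log x)³/(y² log y))) = G(α,y) exp(Θ_ε(...))`.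
The Dickman function `ρ` and the function `ξ` are characterized by the hypotheses. -/
theorem stmt9 (ρ : ℝ → ℝ) (hρ_cont : ContinuousOn ρ (Set.Ici 0))
    (hρ_one : ∀ t ∈ Set.Icc (0 : ℝ) 1, ρ t = 1)
    (hρ_eq : ∀ t ≥ (1 : ℝ), ρ t = 1 - ∫ v in (1 : ℝ)..t, ρ (v - 1) / v)
    (ξ : ℝ → ℝ) (hξ_one : ξ 1 = 0)
    (hξ : ∀ u > (1 : ℝ), 0 < ξ u ∧ Real.exp (ξ u) = 1 + u * ξ u)
    (hRH : RiemannHypothesis) (ε : ℝ) (hε : 0 < ε) :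
    ∃ c C x₀ : ℝ, 0 < c ∧ 0 < C ∧
      ∀ x y α : ℝ, x₀ ≤ x → (1 + ε) * Real.log x ≤ y → y ≤ (Real.log x) ^ (2 - ε) →
      (0 < α ∧ ∑ p ∈ Nat.primesBelow (⌊y⌋₊ + 1),
          Real.log p / ((p : ℝ) ^ α - 1) = Real.log x) →
      (let u := Real.log x / Real.log y
       let σ := 1 - ξ u / Real.log y
       ∃ E₁ E₂ : ℝ,
         c * (Real.log x) ^ 3 / (y ^ 2 * Real.log y) ≤ E₁ ∧
         E₁ ≤ C * (Real.log x) ^ 3 / (y ^ 2 * Real.log y) ∧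
         c * (Real.log x) ^ 3 / (y ^ 2 * Real.log y) ≤ E₂ ∧
         E₂ ≤ C * (Real.log x) ^ 3 / (y ^ 2 * Real.log y) ∧
         (Psi x y : ℝ) / (x * ρ u * Zfun σ) = Gfun ρ σ y * Real.exp (-E₁) ∧
         (Psi x y : ℝ) / (x * ρ u * Zfun σ) = Gfun ρ α y * Real.exp E₂) := by
  rcases le_or_gt 1 ε with hε1 | hε1
  · refine ⟨1, 1, Real.exp 1, one_pos, one_pos, fun x y α hx h1 h2 _ => ?_⟩
    exfalso
    have hL : 1 ≤ Real.log x := by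
      rw [Real.le_log_iff_exp_le ((Real.exp_pos 1).trans_le hx)]; exact hx
    have h3 : Real.log x ^ (2 - ε) ≤ Real.log x := by
      conv_rhs => rw [← Real.rpow_one (Real.log x)]
      exact Real.rpow_le_rpow_of_exponent_le hL (by linarith)
    have : 0 < ε * Real.log x := by positivity
    linarith
  obtain ⟨K, hK, hθ⟩ := st9_theta_RH hRH (δ := ε/16) (by positivity) (by linarith)
  have hK' : st9_th (ε/16) (K + 1) := ⟨by linarith, fun v hv => (hθ v hv).trans (by gcongr; linarith)⟩
  obtain ⟨y0, c, C, hc, hC, H⟩ := st9_main (ρ := ρ) ⟨hρ_cont, hρ_one, hρ_eq⟩ (η := ε/2) (by positivity)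
    (by positivity) (by linarith) hK'
  obtain ⟨L0, hL04, hL0⟩ := st9_param hε hε1 y0
  refine ⟨c / 8, 8 * C, Real.exp L0, by positivity, by positivity, fun x y α hx h1 h2 hα => ?_⟩
  intro u σ
  have hx0 : 0 < x := (Real.exp_pos _).trans_le hx
  have hL : L0 ≤ Real.log x := by rwa [Real.le_log_iff_exp_le hx0]
  obtain ⟨hy0, hg, hσ, hu, hξ0, hξe, huL, hξσ⟩ := hL0 (Real.log x) y u (ξ u) σ hL h1 h2 rfl (hξ u) rfl
  obtain ⟨E₁, E₂, a1, a2, a3, a4, a5, a6⟩ := H x y σ α u (ξ u) hy0 hx0 hg hσ hu hξ0 hξe huL hξσ hα.1 hα.2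
  have hy4 := hg.y4
  have hyp : 0 < y := by linarith
  have hY := st9_Y1 hy4
  have hA : st9_A σ y = Real.log x := by
    rw [st9_A_w (by linarith), ← hξσ, st9_int_exp_xi hξ0 hξe, ← huL]; ring
  obtain ⟨b1, b2⟩ := st9_A_bounds hy4 hg.s0.le (by linarith : σ ≤ 1/2)
  rw [hA] at b1 b2
  have hw : (y ^ (1 - σ)) ^ 3 / (y ^ 2 * Real.log y) = y ^ (1 - 3 * σ) / Real.log y := by
    have : (y ^ (1 - σ)) ^ 3 = y ^ (1 - 3 * σ) * y ^ 2 := by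
      rw [← Real.rpow_mul_natCast hyp.le, ← Real.rpow_natCast y 2, ← Real.rpow_add hyp]; congr 1; push_cast; ring
    rw [this]; field_simp
  set w := y ^ (1 - 3 * σ) / Real.log y with hwd
  have hp : 0 < y ^ (1 - σ) := by positivity
  have hL0' : 0 < Real.log x := by linarith
  have w1 : Real.log x ^ 3 / (y ^ 2 * Real.log y) ≤ 8 * w := by
    rw [← hw, ← mul_div_assoc]
    gcongr
    calc _ ≤ (2 * y ^ (1 - σ)) ^ 3 := by gcongr
      _ = _ := by ring
  have w2 : w ≤ 8 * (Real.log x ^ 3 / (y ^ 2 * Real.log y)) := by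
    rw [← hw, ← mul_div_assoc]
    gcongr
    calc (y ^ (1 - σ)) ^ 3 ≤ (2 * Real.log x) ^ 3 := by gcongr; linarith
      _ = _ := by ring
  have w3 : c / 8 * Real.log x ^ 3 / (y ^ 2 * Real.log y) ≤ c * w := by
    rw [mul_div_assoc]
    calc _ ≤ c / 8 * (8 * w) := by gcongr
      _ = _ := by ring
  have w4 : C * w ≤ 8 * C * Real.log x ^ 3 / (y ^ 2 * Real.log y) := by
    rw [mul_div_assoc]
    calc _ ≤ C * (8 * (Real.log x ^ 3 / (y ^ 2 * Real.log y))) := by gcongr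
      _ = _ := by ring
  exact ⟨E₁, E₂, w3.trans a1, a2.trans w4, w3.trans a3, a4.trans w4, a5, a6⟩
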